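/- arXiv:1609.01877 — 2 statements merged into one kernel-verified Lean document; each statement's English description precedes it below -/
import Mathlib

section
/- For each k with 2 ≤ k ≤ n−1: (1) X_k(K) is exactly the set of classes [G] of degree-k homogeneous divisors G of G_P, as P ranges over the singular points of C; (2) for each such G the singular point P with G dividing G_P is unique (namely P = f(v) for any root v of G), so X_k(K) is the disjoint union over singular points P of the sets of classes of degree-k divisors of G_P, and #X_k(K) = Σ_P #{degree-k homogeneous divisors of G_P up to nonzero scalar}; (3) if k₀ denotes the largest k with X_k(K) ≠ ∅, then every singular point of C has multiplicity at most k₀, and [G] ↦ f(any root of G) is a bijection from X_{k₀}(K) onto the set of singular points of C of multiplicity exactly k₀. -/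
open MvPolynomial

noncomputable section

/-- The coefficient `a_i` of `s^(n-i) t^i` in a binary form `f` of degree `n`. -/
def bcoeff {K : Type*} [Field K] (n : ℕ) (f : MvPolynomial (Fin 2) K) (i : Fin (n + 1)) : K :=
  MvPolynomial.coeff (Finsupp.single 0 (n - (i : ℕ)) + Finsupp.single 1 (i : ℕ)) f

/-- The binary form of degree `k` with coefficient vector `x`. -/
def formOf {K : Type*} [Field K] (k : ℕ) (x : Fin (k + 1) → K) : MvPolynomial (Fin 2) K :=
  ∑ i : Fin (k + 1),
    MvPolynomial.C (x i) * MvPolynomial.X 0 ^ (k - (i : ℕ)) * MvPolynomial.X 1 ^ (i : ℕ)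

/-- The matrix `M_k` associated to the parameterization `f`: the first `n-k+1` rows contain
the variables `x_0, …, x_k` in staircase position, the last three rows are the coefficient
vectors of `f_0, f_1, f_2`. -/
def Mmat {K : Type*} [Field K] (n k : ℕ) (f : Fin 3 → MvPolynomial (Fin 2) K) :
    Matrix (Fin (n - k + 4)) (Fin (n + 1)) (MvPolynomial (Fin (k + 1)) K) :=
  fun j c =>
    if hj : (j : ℕ) ≤ n - k then
      if h : (j : ℕ) ≤ (c : ℕ) ∧ (c : ℕ) ≤ (j : ℕ) + k then
        MvPolynomial.X ⟨(c : ℕ) - (j : ℕ), by omega⟩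
      else 0
    else
      MvPolynomial.C (bcoeff n (f ⟨(j : ℕ) - (n - k + 1), by have := j.isLt; omega⟩) c)

/-- The set of `(n-k+3) × (n-k+3)` minors of the matrix `M_k`; it generates the ideal
`I_{X_k}`. -/
def minorsSet {K : Type*} [Field K] (n k : ℕ) (f : Fin 3 → MvPolynomial (Fin 2) K) :
    Set (MvPolynomial (Fin (k + 1)) K) :=
  { g | ∃ (r : Fin (n - k + 3) → Fin (n - k + 4)) (c : Fin (n - k + 3) → Fin (n + 1)),
      Function.Injective r ∧ Function.Injective c ∧
      g = ((Mmat n k f).submatrix r c).det }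

/-- The projective zero locus `X_k(K) ⊆ ℙ^k(K)` of the ideal of minors of `M_k`. -/
def XkSet {K : Type*} [Field K] (n k : ℕ) (f : Fin 3 → MvPolynomial (Fin 2) K) :
    Set (Projectivization K (Fin (k + 1) → K)) :=
  { P | ∀ g ∈ minorsSet n k f, MvPolynomial.eval P.rep g = 0 }

/-- Evaluation of the parameterization at a vector `v ∈ K²`. -/
def evalVec {K : Type*} [Field K] (f : Fin 3 → MvPolynomial (Fin 2) K) (v : Fin 2 → K) :
    Fin 3 → K :=
  fun u => MvPolynomial.eval v (f u)

/-- The induced map `f : ℙ¹(K) → ℙ²(K)` (with a junk value where undefined). -/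
def projMap {K : Type*} [Field K] (f : Fin 3 → MvPolynomial (Fin 2) K)
    (P : Projectivization K (Fin 2 → K)) : Projectivization K (Fin 3 → K) :=
  haveI := Classical.propDecidable (evalVec f P.rep ≠ 0)
  if h : evalVec f P.rep ≠ 0 then Projectivization.mk K _ h
  else Projectivization.mk K (fun _ => 1) (fun hc => one_ne_zero (congrFun hc 0))

/-- `f = (f_0, f_1, f_2)` is a proper parameterization of degree `n`: the `f_u` are
homogeneous of degree `n`, have no common zero outside the origin, and the induced map
`ℙ¹(K) → ℙ²(K)` is injective outside some finite set. -/
structure IsProperParam {K : Type*} [Field K] (n : ℕ)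
    (f : Fin 3 → MvPolynomial (Fin 2) K) : Prop where
  homog : ∀ u, (f u).IsHomogeneous n
  no_common_zero : ∀ v : Fin 2 → K, v ≠ 0 → evalVec f v ≠ 0
  gen_injective : ∃ S : Set (Projectivization K (Fin 2 → K)), S.Finite ∧
    Set.InjOn (projMap f) Sᶜ

/-- The homogeneous vanishing ideal of the point `p ∈ ℙ²(K)`. -/
def pointIdeal {K : Type*} [Field K] (p : Fin 3 → K) : Ideal (MvPolynomial (Fin 3) K) :=
  Ideal.span { L | L.IsHomogeneous 1 ∧ MvPolynomial.eval p L = 0 }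

/-- The multiplicity of the curve `{F = 0}` at the point `p`:
the largest `m` with `F ∈ I(p)^m`. -/
def multAt {K : Type*} [Field K] (F : MvPolynomial (Fin 3) K) (p : Fin 3 → K) : ℕ :=
  sSup { m | F ∈ pointIdeal p ^ m }

/-- The cross difference `p_i f_j - p_j f_i`. -/
def crossDiff {K : Type*} [Field K] (f : Fin 3 → MvPolynomial (Fin 2) K) (p : Fin 3 → K)
    (i j : Fin 3) : MvPolynomial (Fin 2) K :=
  MvPolynomial.C (p i) * f j - MvPolynomial.C (p j) * f i

/-- `G` is a greatest common divisor of the three cross differences `p_i f_j - p_j f_i`,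
`0 ≤ i < j ≤ 2`. -/
def IsGcdOfCross {K : Type*} [Field K] (f : Fin 3 → MvPolynomial (Fin 2) K) (p : Fin 3 → K)
    (G : MvPolynomial (Fin 2) K) : Prop :=
  (∀ i j : Fin 3, i < j → G ∣ crossDiff f p i j) ∧
  (∀ D : MvPolynomial (Fin 2) K, (∀ i j : Fin 3, i < j → D ∣ crossDiff f p i j) → D ∣ G)

/-- The linear binary form with root `v = (v 0 : v 1)`. -/
def linFormOf {K : Type*} [Field K] (v : Fin 2 → K) : MvPolynomial (Fin 2) K :=
  MvPolynomial.C (v 1) * MvPolynomial.X 0 - MvPolynomial.C (v 0) * MvPolynomial.X 1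

/-- The multiplicity of `v` as a root of the binary form `h`. -/
def ordAt {K : Type*} [Field K] (v : Fin 2 → K) (h : MvPolynomial (Fin 2) K) : ℕ :=
  sSup { e | linFormOf v ^ e ∣ h }

/-- The point `x ∈ ℙ²` lies on the conic `4 x₀ x₂ - x₁² = 0`. -/
def onConic {K : Type*} [Field K] (x : Fin 3 → K) : Prop :=
  4 * x 0 * x 2 - x 1 ^ 2 = 0

section BinaryForms

variable {K : Type*} [Field K]

/-- Dehomogenization of binary forms: `s ↦ 1`, `t ↦ X`. -/
def dehom (K : Type*) [Field K] : MvPolynomial (Fin 2) K →ₐ[K] Polynomial K :=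
  MvPolynomial.aeval ![1, Polynomial.X]

/-- The binary form of degree `n` attached to a univariate polynomial of degree at most `n`. -/
def homForm (n : ℕ) (a : Polynomial K) : MvPolynomial (Fin 2) K :=
  formOf n (fun i => a.coeff i)

theorem formOf_isHomogeneous (k : ℕ) (x : Fin (k + 1) → K) : (formOf k x).IsHomogeneous k := by
  refine MvPolynomial.IsHomogeneous.sum _ _ _ fun i _ => ?_
  have h := ((MvPolynomial.isHomogeneous_X_pow (R := K) (0 : Fin 2) (k - (i : ℕ))).C_mul (x i)).mul
    (MvPolynomial.isHomogeneous_X_pow (R := K) (1 : Fin 2) (i : ℕ))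
  rwa [Nat.sub_add_cancel (by omega)] at h

theorem homForm_isHomogeneous (n : ℕ) (a : Polynomial K) : (homForm n a).IsHomogeneous n :=
  formOf_isHomogeneous _ _

theorem dehom_formOf (k : ℕ) (x : Fin (k + 1) → K) :
    dehom K (formOf k x) = ∑ i : Fin (k + 1), Polynomial.C (x i) * Polynomial.X ^ (i : ℕ) := by
  simp [dehom, formOf, map_sum, Polynomial.algebraMap_eq]

theorem coeff_dehom_formOf (k : ℕ) (x : Fin (k + 1) → K) (i : ℕ) :
    (dehom K (formOf k x)).coeff i = if h : i < k + 1 then x ⟨i, h⟩ else 0 := by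
  rw [dehom_formOf, Polynomial.finsetSum_coeff]
  simp only [Polynomial.coeff_C_mul, Polynomial.coeff_X_pow, mul_ite, mul_one, mul_zero]
  split_ifs with h
  · rw [Finset.sum_eq_single ⟨i, h⟩]
    · simp
    · intro b _ hb
      rw [if_neg]
      rintro rfl
      exact hb rfl
    · simp
  · refine Finset.sum_eq_zero fun b _ => if_neg ?_
    have := b.isLt
    omega

theorem natDegree_dehom_formOf_le (k : ℕ) (x : Fin (k + 1) → K) :
    (dehom K (formOf k x)).natDegree ≤ k := by
  refine Polynomial.natDegree_le_iff_coeff_eq_zero.2 fun i hi => ?_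
  rw [coeff_dehom_formOf, dif_neg (by omega)]

theorem dehom_homForm {n : ℕ} {a : Polynomial K} (ha : a.natDegree ≤ n) :
    dehom K (homForm n a) = a := by
  ext i
  rw [homForm, coeff_dehom_formOf]
  split_ifs with h
  · rfl
  · rw [Polynomial.coeff_eq_zero_of_natDegree_lt (by omega)]

theorem exponent_eq_of_degree_eq {n : ℕ} {d : Fin 2 →₀ ℕ} (hd : d.degree = n) :
    Finsupp.single 0 (n - d 1) + Finsupp.single 1 (d 1) = d := by
  have h : d 0 + d 1 = n := by simpa [Finsupp.degree_eq_sum, Fin.sum_univ_two] using hd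
  ext j
  fin_cases j
  · simp; omega
  · simp

theorem eq_formOf_bcoeff {n : ℕ} {f : MvPolynomial (Fin 2) K} (hf : f.IsHomogeneous n) :
    f = formOf n (bcoeff n f) := by
  have key : ∀ i : Fin (n + 1),
      MvPolynomial.C (bcoeff n f i) * MvPolynomial.X (0 : Fin 2) ^ (n - (i : ℕ)) *
      MvPolynomial.X 1 ^ (i : ℕ) = MvPolynomial.monomial
        (Finsupp.single 0 (n - (i : ℕ)) + Finsupp.single 1 (i : ℕ)) (bcoeff n f i) := by
    intro i
    rw [MvPolynomial.X_pow_eq_monomial, MvPolynomial.X_pow_eq_monomial, mul_assoc,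
      MvPolynomial.monomial_mul, MvPolynomial.C_mul_monomial]
    simp
  ext d
  simp only [formOf, key, MvPolynomial.coeff_sum, MvPolynomial.coeff_monomial]
  by_cases hd : d.degree = n
  · have hd1 : d 1 < n + 1 := by
      have h : d 0 + d 1 = n := by simpa [Finsupp.degree_eq_sum, Fin.sum_univ_two] using hd
      omega
    rw [Finset.sum_eq_single ⟨d 1, hd1⟩]
    · rw [if_pos (exponent_eq_of_degree_eq hd), bcoeff, exponent_eq_of_degree_eq hd]
    · intro b _ hb
      rw [if_neg]
      intro h
      apply hb
      ext
      simpa using congrArg (fun e : Fin 2 →₀ ℕ => e 1) h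
    · simp
  · rw [hf.coeff_eq_zero hd, Finset.sum_eq_zero]
    intro b _
    rw [if_neg]
    rintro rfl
    apply hd
    have := b.isLt
    simp [Finsupp.degree_eq_sum, Fin.sum_univ_two]
    omega

theorem coeff_dehom {n : ℕ} {f : MvPolynomial (Fin 2) K} (hf : f.IsHomogeneous n)
    (i : Fin (n + 1)) : (dehom K f).coeff i = bcoeff n f i := by
  conv_lhs => rw [eq_formOf_bcoeff hf]
  rw [coeff_dehom_formOf, dif_pos i.isLt]

theorem natDegree_dehom_le {n : ℕ} {f : MvPolynomial (Fin 2) K} (hf : f.IsHomogeneous n) :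
    (dehom K f).natDegree ≤ n := by
  rw [eq_formOf_bcoeff hf]
  exact natDegree_dehom_formOf_le _ _

theorem homForm_dehom {n : ℕ} {f : MvPolynomial (Fin 2) K} (hf : f.IsHomogeneous n) :
    homForm n (dehom K f) = f := by
  conv_rhs => rw [eq_formOf_bcoeff hf]
  rw [homForm]
  congr 1
  funext i
  exact coeff_dehom hf i

theorem eq_of_dehom_eq {n : ℕ} {f g : MvPolynomial (Fin 2) K} (hf : f.IsHomogeneous n)
    (hg : g.IsHomogeneous n) (h : dehom K f = dehom K g) : f = g := by
  rw [← homForm_dehom hf, ← homForm_dehom hg, h]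

theorem dehom_ne_zero {n : ℕ} {f : MvPolynomial (Fin 2) K} (hf : f.IsHomogeneous n)
    (h0 : f ≠ 0) : dehom K f ≠ 0 := fun h =>
  h0 (eq_of_dehom_eq hf (MvPolynomial.isHomogeneous_zero _ _ n) (by rw [h, map_zero]))

theorem eval_dehom (f : MvPolynomial (Fin 2) K) (x : K) :
    (dehom K f).eval x = MvPolynomial.eval ![1, x] f := by
  have h : (Polynomial.aeval x).comp (dehom K) = MvPolynomial.aeval ![1, x] := by
    apply MvPolynomial.algHom_ext
    intro i
    fin_cases i <;> simp [dehom]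
  have := DFunLike.congr_fun h f
  simpa [MvPolynomial.aeval_eq_eval, Polynomial.aeval_def] using this

theorem coeff_dehom_eq_eval {n : ℕ} {f : MvPolynomial (Fin 2) K} (hf : f.IsHomogeneous n) :
    (dehom K f).coeff n = MvPolynomial.eval ![0, 1] f := by
  have h := coeff_dehom hf (Fin.last n)
  rw [Fin.val_last] at h
  rw [h]
  conv_rhs => rw [eq_formOf_bcoeff hf, formOf]
  simp only [map_sum, map_mul, MvPolynomial.eval_C, map_pow, MvPolynomial.eval_X]
  rw [Finset.sum_eq_single (Fin.last n)]
  · simp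
  · intro b _ hb
    have : n - (b : ℕ) ≠ 0 := by
      have := b.isLt
      have : (b : ℕ) ≠ n := fun h => hb (Fin.ext h)
      omega
    simp [this]
  · simp

theorem exists_root_of_isHomogeneous [IsAlgClosed K] {k : ℕ} (hk : 1 ≤ k)
    {g : MvPolynomial (Fin 2) K} (hg : g.IsHomogeneous k) :
    ∃ v : Fin 2 → K, v ≠ 0 ∧ MvPolynomial.eval v g = 0 := by
  by_cases h : (dehom K g).natDegree = 0
  · refine ⟨![0, 1], fun h => one_ne_zero (congrFun h 1), ?_⟩
    rw [← coeff_dehom_eq_eval hg, Polynomial.coeff_eq_zero_of_natDegree_lt (by omega)]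
  · obtain ⟨x, hx⟩ := IsAlgClosed.exists_root (dehom K g)
      (fun hd => h (Polynomial.natDegree_eq_of_degree_eq_some hd))
    refine ⟨![1, x], fun h => one_ne_zero (congrFun h 0), ?_⟩
    rw [← eval_dehom]
    exact hx

theorem exists_dehom_eq_mul_of_dvd {k n : ℕ} (hkn : k ≤ n) {g h : MvPolynomial (Fin 2) K}
    (hg : g.IsHomogeneous k) (hh : h.IsHomogeneous n) (hd : g ∣ h) :
    ∃ q : Polynomial K, q.natDegree ≤ n - k ∧ dehom K h = dehom K g * q := by
  obtain ⟨q, rfl⟩ := hd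
  let _ := MvPolynomial.gradedAlgebra (σ := Fin 2) (R := K)
  have hmem : g ∈ MvPolynomial.homogeneousSubmodule (Fin 2) K k := hg
  have h1 := DirectSum.coe_decompose_mul_of_left_mem_of_le
    (MvPolynomial.homogeneousSubmodule (Fin 2) K) (b := q) hmem hkn
  rw [DirectSum.decompose_of_mem_same (MvPolynomial.homogeneousSubmodule (Fin 2) K) hh] at h1
  refine ⟨dehom K ((DirectSum.decompose (MvPolynomial.homogeneousSubmodule (Fin 2) K) q) (n - k) :
    MvPolynomial (Fin 2) K), natDegree_dehom_le (n := n - k) ?_, ?_⟩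
  · exact (DirectSum.decompose (MvPolynomial.homogeneousSubmodule (Fin 2) K) q (n - k)).2
  · rw [← map_mul, ← h1]

theorem dvd_of_dehom_eq_mul {k n : ℕ} (hkn : k ≤ n) {g h : MvPolynomial (Fin 2) K}
    (hg : g.IsHomogeneous k) (hh : h.IsHomogeneous n) {q : Polynomial K}
    (hq : q.natDegree ≤ n - k) (he : dehom K h = dehom K g * q) : g ∣ h := by
  refine ⟨homForm (n - k) q, eq_of_dehom_eq hh ?_ ?_⟩
  · have := hg.mul (homForm_isHomogeneous (n - k) q)
    rwa [Nat.add_sub_cancel' hkn] at this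
  · rw [map_mul, dehom_homForm hq, he]

theorem le_of_dvd_of_isHomogeneous {k e : ℕ} {g h : MvPolynomial (Fin 2) K}
    (hg : g.IsHomogeneous k) (hh : h.IsHomogeneous e) (h0 : h ≠ 0) (hd : g ∣ h) : k ≤ e := by
  have hg0 : g ≠ 0 := fun h => h0 (by rw [h] at hd; exact zero_dvd_iff.1 hd)
  obtain ⟨q, rfl⟩ := hd
  have hq0 : q ≠ 0 := right_ne_zero_of_mul h0
  rw [← hg.totalDegree hg0, ← hh.totalDegree h0, MvPolynomial.totalDegree_mul_of_isDomain hg0 hq0]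
  omega

theorem formOf_ne_zero {k : ℕ} {x : Fin (k + 1) → K} (hx : x ≠ 0) : formOf k x ≠ 0 := by
  intro h
  apply hx
  funext i
  have := coeff_dehom_formOf k x i
  rw [h, map_zero, Polynomial.coeff_zero, dif_pos i.isLt] at this
  exact this.symm

theorem formOf_smul {k : ℕ} (c : K) (x : Fin (k + 1) → K) :
    formOf k (c • x) = MvPolynomial.C c * formOf k x := by
  simp [formOf, Finset.mul_sum, mul_assoc]

theorem formOf_injective {k : ℕ} {x y : Fin (k + 1) → K} (h : formOf k x = formOf k y) :
    x = y := by
  funext i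
  have h1 := coeff_dehom_formOf k x i
  have h2 := coeff_dehom_formOf k y i
  rw [dif_pos i.isLt] at h1 h2
  rw [h] at h1
  exact h1.symm.trans h2

end BinaryForms

section Minors

variable {K : Type*} [Field K]

theorem exists_maximal_minor_ne_zero {m N : ℕ} (A : Matrix (Fin m) (Fin N) K)
    (hA : LinearIndependent K A.row) :
    ∃ c : Fin m → Fin N, Function.Injective c ∧ (A.submatrix id c).det ≠ 0 := by
  obtain ⟨κ, a, ha, hspan, hli⟩ := exists_linearIndependent' K A.col
  have : Finite κ := Finite.of_injective a ha
  have := Fintype.ofFinite κ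
  have hcard : Fintype.card κ = m := by
    rw [← finrank_span_eq_card hli, hspan, ← Matrix.rank_eq_finrank_span_cols, hA.rank_matrix,
      Fintype.card_fin]
  let e : Fin m ≃ κ := (Fintype.equivFinOfCardEq hcard).symm
  refine ⟨a ∘ e, ha.comp e.injective, ?_⟩
  have h : LinearIndependent K (A.submatrix id (a ∘ e)).col := hli.comp e e.injective
  rw [Matrix.linearIndependent_cols_iff_isUnit, Matrix.isUnit_iff_isUnit_det] at h
  exact h.ne_zero

/-- The univariate polynomial whose coefficients form row `j` of `M_k` at the point `x`. -/
def rowPoly (n k : ℕ) (f : Fin 3 → MvPolynomial (Fin 2) K) (x : Fin (k + 1) → K)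
    (j : Fin (n - k + 4)) : Polynomial K :=
  if hj : (j : ℕ) ≤ n - k then Polynomial.X ^ (j : ℕ) * dehom K (formOf k x)
  else dehom K (f ⟨(j : ℕ) - (n - k + 1), by have := j.isLt; omega⟩)

theorem eval_Mmat {n k : ℕ} {f : Fin 3 → MvPolynomial (Fin 2) K}
    (hf : ∀ u, (f u).IsHomogeneous n) (x : Fin (k + 1) → K) (j : Fin (n - k + 4))
    (c : Fin (n + 1)) : MvPolynomial.eval x (Mmat n k f j c) = (rowPoly n k f x j).coeff c := by
  unfold Mmat rowPoly
  by_cases hj : (j : ℕ) ≤ n - k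
  · simp only [hj, dif_pos]
    rw [Polynomial.coeff_X_pow_mul', coeff_dehom_formOf]
    by_cases h : (j : ℕ) ≤ (c : ℕ) ∧ (c : ℕ) ≤ (j : ℕ) + k
    · rw [dif_pos h, if_pos h.1, dif_pos (by omega), MvPolynomial.eval_X]
    · rw [dif_neg h, map_zero]
      split_ifs <;> first | rfl | omega
  · simp only [hj, dif_neg, not_false_eq_true]
    rw [MvPolynomial.eval_C, coeff_dehom (hf _)]

theorem natDegree_rowPoly_le {n k : ℕ} (hkn : k ≤ n) {f : Fin 3 → MvPolynomial (Fin 2) K}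
    (hf : ∀ u, (f u).IsHomogeneous n) (x : Fin (k + 1) → K) (j : Fin (n - k + 4)) :
    (rowPoly n k f x j).natDegree ≤ n := by
  unfold rowPoly
  split_ifs with hj
  · refine Polynomial.natDegree_mul_le.trans ?_
    have h1 := natDegree_dehom_formOf_le k x
    have h2 := Polynomial.natDegree_X_pow_le (R := K) (j : ℕ)
    omega
  · exact natDegree_dehom_le (hf _)

theorem eval_minor {n k : ℕ} {f : Fin 3 → MvPolynomial (Fin 2) K}
    (hf : ∀ u, (f u).IsHomogeneous n) (x : Fin (k + 1) → K)
    (r : Fin (n - k + 3) → Fin (n - k + 4)) (c : Fin (n - k + 3) → Fin (n + 1)) :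
    MvPolynomial.eval x ((Mmat n k f).submatrix r c).det =
      (Matrix.of fun i j => (rowPoly n k f x (r i)).coeff (c j) :
        Matrix (Fin (n - k + 3)) (Fin (n - k + 3)) K).det := by
  rw [RingHom.map_det]
  congr 1
  ext i j
  simp [eval_Mmat hf]

/-- Vanishing of the minors makes any two of the `f_u` linearly dependent modulo the form. -/
theorem exists_relation_of_minors {n k : ℕ} (hkn : k ≤ n)
    {f : Fin 3 → MvPolynomial (Fin 2) K} (hf : ∀ u, (f u).IsHomogeneous n)
    {x : Fin (k + 1) → K} (hx : x ≠ 0)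
    (hminor : ∀ g ∈ minorsSet n k f, MvPolynomial.eval x g = 0) {u w : Fin 3} (huw : u ≠ w) :
    ∃ (α β : K) (Q : Polynomial K), (α ≠ 0 ∨ β ≠ 0) ∧ Q.natDegree ≤ n - k ∧
      Polynomial.C α * dehom K (f u) + Polynomial.C β * dehom K (f w) =
        dehom K (formOf k x) * Q := by
  let r : Fin (n - k + 3) → Fin (n - k + 4) := fun l =>
    if (l : ℕ) ≤ n - k then ⟨l, by omega⟩
    else if (l : ℕ) = n - k + 1 then ⟨n - k + 1 + u, by omega⟩ else ⟨n - k + 1 + w, by omega⟩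
  have hr : Function.Injective r := by
    intro a b hab
    have hne : (u : ℕ) ≠ w := fun h => huw (Fin.ext h)
    have ha := a.isLt
    have hb := b.isLt
    simp only [r] at hab
    ext
    split_ifs at hab <;> simp only [Fin.mk.injEq] at hab <;> omega
  let A : Matrix (Fin (n - k + 3)) (Fin (n + 1)) K :=
    Matrix.of fun i j => (rowPoly n k f x (r i)).coeff j
  have hdep : ¬ LinearIndependent K A.row := by
    intro hli
    obtain ⟨c, hc, hdet⟩ := exists_maximal_minor_ne_zero A hli
    refine hdet ?_
    rw [← hminor _ ⟨r, c, hr, hc, rfl⟩, eval_minor hf]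
    rfl
  rw [Fintype.not_linearIndependent_iff] at hdep
  obtain ⟨c, hc, i₀, hi₀⟩ := hdep
  have hsum : ∑ i, Polynomial.C (c i) * rowPoly n k f x (r i) = 0 := by
    ext j
    by_cases hj : j < n + 1
    · have := congrFun hc ⟨j, hj⟩
      simpa [A, Polynomial.finsetSum_coeff, Matrix.row] using this
    · rw [Polynomial.finsetSum_coeff, Polynomial.coeff_zero]
      refine Finset.sum_eq_zero fun i _ => ?_
      rw [Polynomial.coeff_C_mul, Polynomial.coeff_eq_zero_of_natDegree_lt, mul_zero]
      have := natDegree_rowPoly_le hkn hf x (r i)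
      omega
  rw [Fin.sum_univ_castSucc, Fin.sum_univ_castSucc] at hsum
  have h1 : ∀ i : Fin (n - k + 1), rowPoly n k f x (r i.castSucc.castSucc) =
      Polynomial.X ^ (i : ℕ) * dehom K (formOf k x) := by
    intro i
    have : (i : ℕ) ≤ n - k := by omega
    simp [r, rowPoly, this]
  have h2 : rowPoly n k f x (r (Fin.last (n - k + 1)).castSucc) = dehom K (f u) := by
    simp [r, rowPoly]
    omega
  have h3 : rowPoly n k f x (r (Fin.last (n - k + 2))) = dehom K (f w) := by
    simp [r, rowPoly]
    omega
  rw [h2, h3] at hsum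
  simp only [h1] at hsum
  set Q : Polynomial K := ∑ i : Fin (n - k + 1),
    Polynomial.C (c i.castSucc.castSucc) * Polynomial.X ^ (i : ℕ) with hQ
  have hQsum : ∑ i : Fin (n - k + 1), Polynomial.C (c i.castSucc.castSucc) *
      (Polynomial.X ^ (i : ℕ) * dehom K (formOf k x)) = Q * dehom K (formOf k x) := by
    rw [hQ, Finset.sum_mul]
    exact Finset.sum_congr rfl fun i _ => by ring
  rw [hQsum] at hsum
  refine ⟨c (Fin.last (n - k + 1)).castSucc, c (Fin.last (n - k + 2)), -Q, ?_, ?_, ?_⟩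
  · by_contra! h
    rw [h.1, h.2] at hsum
    have hQ0 : Q = 0 := by
      have hx0 := dehom_ne_zero (formOf_isHomogeneous k x) (formOf_ne_zero hx)
      simpa [hx0] using hsum
    apply hi₀
    induction i₀ using Fin.lastCases with
    | last => exact h.2
    | cast i =>
      induction i using Fin.lastCases with
      | last => exact h.1
      | cast i =>
        rw [hQ, ← dehom_formOf (n - k) (fun i => c i.castSucc.castSucc)] at hQ0
        have := coeff_dehom_formOf (n - k) (fun i => c i.castSucc.castSucc) i
        rw [hQ0, dif_pos i.isLt, Polynomial.coeff_zero] at this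
        exact this.symm
  · rw [Polynomial.natDegree_neg, hQ, ← dehom_formOf (n - k) (fun i => c i.castSucc.castSucc)]
    exact natDegree_dehom_formOf_le _ _
  · linear_combination hsum

theorem crossDiff_isHomogeneous {n : ℕ} {f : Fin 3 → MvPolynomial (Fin 2) K}
    (hf : ∀ u, (f u).IsHomogeneous n) (p : Fin 3 → K) (i j : Fin 3) :
    (crossDiff f p i j).IsHomogeneous n :=
  ((hf j).C_mul _).sub ((hf i).C_mul _)

theorem dvd_crossDiff_of_lt {f : Fin 3 → MvPolynomial (Fin 2) K} {p : Fin 3 → K}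
    {g : MvPolynomial (Fin 2) K} (h : ∀ i j : Fin 3, i < j → g ∣ crossDiff f p i j)
    (i j : Fin 3) : g ∣ crossDiff f p i j := by
  rcases lt_trichotomy i j with hij | rfl | hij
  · exact h i j hij
  · simp [crossDiff]
  · have := h j i hij
    rw [← dvd_neg] at this
    convert this using 1
    simp [crossDiff]

theorem dehom_crossDiff (f : Fin 3 → MvPolynomial (Fin 2) K) (p : Fin 3 → K) (i j : Fin 3) :
    dehom K (crossDiff f p i j) =
      Polynomial.C (p i) * dehom K (f j) - Polynomial.C (p j) * dehom K (f i) := by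
  simp [crossDiff, dehom, Polynomial.algebraMap_eq]

theorem minors_vanish_of_dvd_crossDiff {n k : ℕ} (hkn : k ≤ n)
    {f : Fin 3 → MvPolynomial (Fin 2) K} (hf : ∀ u, (f u).IsHomogeneous n)
    {x : Fin (k + 1) → K} {p : Fin 3 → K} (hp : p ≠ 0)
    (h : ∀ i j : Fin 3, i < j → formOf k x ∣ crossDiff f p i j) :
    ∀ g ∈ minorsSet n k f, MvPolynomial.eval x g = 0 := by
  classical
  rintro _ ⟨r, c, hr, hc, rfl⟩
  rw [eval_minor hf]
  obtain ⟨i, hi⟩ := Function.ne_iff.1 hp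
  by_contra hdet
  let b : Fin (n - k + 2) → Polynomial K := Fin.snoc
    (fun l : Fin (n - k + 1) => Polynomial.X ^ (l : ℕ) * dehom K (formOf k x)) (dehom K (f i))
  have hmem : ∀ j, rowPoly n k f x j ∈ Submodule.span K (Set.range b) := by
    intro j
    unfold rowPoly
    split_ifs with hj
    · refine Submodule.subset_span ⟨Fin.castSucc ⟨j, by omega⟩, ?_⟩
      simp only [b, Fin.snoc_castSucc]
    · generalize (⟨(j : ℕ) - (n - k + 1), _⟩ : Fin 3) = u
      obtain ⟨q, hq, he⟩ := exists_dehom_eq_mul_of_dvd hkn (formOf_isHomogeneous k x)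
        (crossDiff_isHomogeneous hf p i u) (dvd_crossDiff_of_lt h i u)
      rw [dehom_crossDiff] at he
      have hfu : dehom K (f u) = (p i)⁻¹ • (∑ l : Fin (n - k + 1), q.coeff l •
          (Polynomial.X ^ (l : ℕ) * dehom K (formOf k x)) + p u • dehom K (f i)) := by
        have hq' : q =
            ∑ l : Fin (n - k + 1), Polynomial.C (q.coeff l) * Polynomial.X ^ (l : ℕ) := by
          conv_lhs => rw [q.as_sum_range' (n - k + 1) (by omega)]
          rw [← Fin.sum_univ_eq_sum_range (fun l => Polynomial.monomial l (q.coeff l))]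
          simp only [Polynomial.C_mul_X_pow_eq_monomial]
        have hsum : ∑ l : Fin (n - k + 1), q.coeff l •
          (Polynomial.X ^ (l : ℕ) * dehom K (formOf k x)) = dehom K (formOf k x) * q := by
          conv_rhs => rw [hq']
          rw [Finset.mul_sum]
          refine Finset.sum_congr rfl fun l _ => ?_
          rw [Polynomial.smul_eq_C_mul]
          ring
        rw [hsum, ← he, Polynomial.smul_eq_C_mul, Polynomial.smul_eq_C_mul, sub_add_cancel,
          ← mul_assoc, ← Polynomial.C_mul, inv_mul_cancel₀ hi, Polynomial.C_1, one_mul]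
      rw [hfu]
      refine Submodule.smul_mem _ _ (Submodule.add_mem _ (Submodule.sum_mem _ fun l _ =>
        Submodule.smul_mem _ _ (Submodule.subset_span ⟨l.castSucc, ?_⟩))
        (Submodule.smul_mem _ _ (Submodule.subset_span ⟨Fin.last _, ?_⟩)))
      · simp only [b, Fin.snoc_castSucc]
      · simp only [b, Fin.snoc_last]
  have hli : LinearIndependent K fun l => rowPoly n k f x (r l) := by
    have h1 : LinearIndependent K (Matrix.of fun i j => (rowPoly n k f x (r i)).coeff (c j) :
        Matrix (Fin (n - k + 3)) (Fin (n - k + 3)) K).row := by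
      rw [Matrix.linearIndependent_rows_iff_isUnit, Matrix.isUnit_iff_isUnit_det]
      exact isUnit_iff_ne_zero.2 hdet
    exact LinearIndependent.of_comp
      (LinearMap.pi fun j => Polynomial.lcoeff K (c j : ℕ)) h1
  have h2 := linearIndependent_le_span' _ hli (Set.range b) (by
    rintro _ ⟨l, rfl⟩
    exact hmem _)
  have h3 := Fintype.card_range_le b
  simp only [Fintype.card_fin, Cardinal.mk_fin] at h2 h3
  have h4 : n - k + 3 ≤ Fintype.card (Set.range b) := by exact_mod_cast h2
  omega

theorem mem_XkSet_iff [IsAlgClosed K] {n k : ℕ} (hk : 1 ≤ k) (hkn : k ≤ n)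
    {f : Fin 3 → MvPolynomial (Fin 2) K} (hf : ∀ u, (f u).IsHomogeneous n)
    (hzero : ∀ v : Fin 2 → K, v ≠ 0 → evalVec f v ≠ 0)
    (x : Projectivization K (Fin (k + 1) → K)) :
    x ∈ XkSet n k f ↔ ∃ p : Fin 3 → K, p ≠ 0 ∧
      ∀ i j : Fin 3, i < j → formOf k x.rep ∣ crossDiff f p i j := by
  refine ⟨fun h => ?_, fun ⟨p, hp, h⟩ => minors_vanish_of_dvd_crossDiff hkn hf hp h⟩
  obtain ⟨v, hv, hroot⟩ := exists_root_of_isHomogeneous hk (formOf_isHomogeneous k x.rep)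
  obtain ⟨i, hi⟩ : ∃ i, ¬ formOf k x.rep ∣ f i := by
    by_contra! hall
    refine hzero v hv (funext fun i => ?_)
    obtain ⟨q, hq⟩ := hall i
    simp [evalVec, hq, hroot]
  have hex : ∀ j, ∃ (c : K) (Q : Polynomial K), Q.natDegree ≤ n - k ∧
      dehom K (f j) = Polynomial.C c * dehom K (f i) + dehom K (formOf k x.rep) * Q ∧
      (j = i → c = 1) := by
    intro j
    by_cases hji : j = i
    · subst hji
      exact ⟨1, 0, by simp⟩
    obtain ⟨α, β, Q, hne, hQ, he⟩ :=
      exists_relation_of_minors hkn hf x.rep_nonzero h (Ne.symm hji)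
    have hβ : β ≠ 0 := by
      rintro rfl
      have hα : α ≠ 0 := by simpa using hne
      refine hi (dvd_of_dehom_eq_mul hkn (formOf_isHomogeneous k x.rep) (hf i)
        (q := Polynomial.C α⁻¹ * Q) ((Polynomial.natDegree_C_mul_le _ _).trans hQ) ?_)
      have hC : Polynomial.C α⁻¹ * Polynomial.C α = 1 := by
        rw [← Polynomial.C_mul, inv_mul_cancel₀ hα, Polynomial.C_1]
      rw [Polynomial.C_0] at he
      linear_combination Polynomial.C α⁻¹ * he - dehom K (f i) * hC
    have hC : Polynomial.C β⁻¹ * Polynomial.C β = 1 := by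
      rw [← Polynomial.C_mul, inv_mul_cancel₀ hβ, Polynomial.C_1]
    refine ⟨-(β⁻¹ * α), Polynomial.C β⁻¹ * Q, (Polynomial.natDegree_C_mul_le _ _).trans hQ, ?_,
      fun h => absurd h hji⟩
    rw [Polynomial.C_neg, Polynomial.C_mul]
    linear_combination Polynomial.C β⁻¹ * he - dehom K (f j) * hC
  choose c Q hQ he hci using hex
  refine ⟨c, fun h0 => one_ne_zero ((hci i rfl).symm.trans (congrFun h0 i)), fun a b _ => ?_⟩
  refine dvd_of_dehom_eq_mul hkn (formOf_isHomogeneous k x.rep) (crossDiff_isHomogeneous hf c a b)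
    (q := Polynomial.C (c a) * Q b - Polynomial.C (c b) * Q a) ?_ ?_
  · refine (Polynomial.natDegree_sub_le _ _).trans (max_le ?_ ?_)
    · exact (Polynomial.natDegree_C_mul_le _ _).trans (hQ b)
    · exact (Polynomial.natDegree_C_mul_le _ _).trans (hQ a)
  · rw [dehom_crossDiff, he a, he b]
    ring

end Minors

section Pencils

variable {K : Type*} [Field K]

theorem isCoprime_of_no_common_root [IsAlgClosed K] {A B : Polynomial K}
    (h : ∀ x, A.eval x = 0 → B.eval x ≠ 0) : IsCoprime A B := by
  classical
  rw [← EuclideanDomain.gcd_isUnit_iff]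
  by_contra hu
  obtain ⟨x, hx⟩ := IsAlgClosed.exists_root (EuclideanDomain.gcd A B) (fun hd => by
    rcases eq_or_ne (EuclideanDomain.gcd A B) 0 with h0 | h0
    · rw [h0] at hd; simp at hd
    · exact hu (Polynomial.isUnit_iff_degree_eq_zero.2 hd))
  exact h x (hx.dvd (EuclideanDomain.gcd_dvd_left A B)) (hx.dvd (EuclideanDomain.gcd_dvd_right A B))

theorem eval_ne_zero_of_isCoprime {A B : Polynomial K} (h : IsCoprime A B) {x c : K}
    (hx : A.eval x = c * B.eval x) : B.eval x ≠ 0 := by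
  intro h0
  obtain ⟨a, b, hab⟩ := h
  have := congrArg (Polynomial.eval x) hab
  rw [Polynomial.eval_add, Polynomial.eval_mul, Polynomial.eval_mul, hx, h0] at this
  simp at this

/-- All but finitely many members of a pencil of polynomials without base points have only
simple roots, avoiding a given finite set. -/
theorem exists_simple_roots_of_pencil [IsAlgClosed K] [CharZero K] {A B : Polynomial K}
    (hAB : IsCoprime A B) {d : ℕ} (hd : max A.natDegree B.natDegree = d) (hd1 : 1 ≤ d)
    (T : Finset K) : ∃ Z : Finset K, ∀ c ∉ Z, ∃ s : Finset K, s.card = d ∧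
      ∀ x ∈ s, x ∉ T ∧ A.eval x = c * B.eval x ∧ B.eval x ≠ 0 := by
  classical
  set W := Polynomial.wronskian A B with hW
  have hW0 : W ≠ 0 := by
    intro h0
    rw [hW, hAB.wronskian_eq_zero_iff] at h0
    have h1 := Polynomial.derivative_eq_zero.1 h0.1
    have h2 := Polynomial.derivative_eq_zero.1 h0.2
    omega
  refine ⟨insert (A.coeff d / B.coeff d)
    ((T ∪ W.roots.toFinset).image fun x => A.eval x / B.eval x), fun c hc => ?_⟩
  rw [Finset.mem_insert, not_or] at hc
  have hav : ∀ x, A.eval x = c * B.eval x → x ∉ T ∪ W.roots.toFinset := by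
    intro x hx hmem
    refine hc.2 (Finset.mem_image.2 ⟨x, hmem, ?_⟩)
    rw [hx, mul_div_cancel_right₀ _ (eval_ne_zero_of_isCoprime hAB hx)]
  set P := A - Polynomial.C c * B with hP
  have hPcoeff : P.coeff d ≠ 0 := by
    rw [hP, Polynomial.coeff_sub, Polynomial.coeff_C_mul, sub_ne_zero]
    intro h
    by_cases hB : B.coeff d = 0
    · rw [hB, mul_zero] at h
      rcases max_choice A.natDegree B.natDegree with hm | hm
      · rw [hm] at hd
        rw [← hd, Polynomial.coeff_natDegree, Polynomial.leadingCoeff_eq_zero] at h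
        rw [h, Polynomial.natDegree_zero] at hd
        omega
      · rw [hm] at hd
        rw [← hd, Polynomial.coeff_natDegree, Polynomial.leadingCoeff_eq_zero] at hB
        rw [hB, Polynomial.natDegree_zero] at hd
        omega
    · exact hc.1 (by rw [h, mul_div_cancel_right₀ _ hB])
  have hP0 : P ≠ 0 := fun h => hPcoeff (by rw [h, Polynomial.coeff_zero])
  have hPdeg : P.natDegree = d := by
    refine le_antisymm ?_ (Polynomial.le_natDegree_of_ne_zero hPcoeff)
    refine (Polynomial.natDegree_sub_le _ _).trans ?_
    have := Polynomial.natDegree_C_mul_le c B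
    omega
  have hroot : ∀ x, P.IsRoot x ↔ A.eval x = c * B.eval x := by
    intro x
    rw [Polynomial.IsRoot.def, hP, Polynomial.eval_sub, Polynomial.eval_mul, Polynomial.eval_C,
      sub_eq_zero]
  have hnodup : P.roots.Nodup := by
    rw [Multiset.nodup_iff_count_le_one]
    intro x
    rw [Polynomial.count_roots]
    by_contra! hlt
    rw [Polynomial.one_lt_rootMultiplicity_iff_isRoot hP0] at hlt
    have h1 := (hroot x).1 hlt.1
    have h2 := hlt.2
    rw [Polynomial.IsRoot.def, hP, Polynomial.derivative_sub, Polynomial.derivative_C_mul,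
      Polynomial.eval_sub, Polynomial.eval_mul, Polynomial.eval_C, sub_eq_zero] at h2
    refine hav x h1 (Finset.mem_union_right _ ?_)
    rw [Multiset.mem_toFinset, Polynomial.mem_roots hW0, Polynomial.IsRoot.def, hW,
      Polynomial.wronskian, Polynomial.eval_sub, Polynomial.eval_mul, Polynomial.eval_mul, h1, h2]
    ring
  refine ⟨P.roots.toFinset, ?_, fun x hx => ?_⟩
  · rw [Multiset.toFinset_card_of_nodup hnodup, IsAlgClosed.card_roots_eq_natDegree, hPdeg]
  · rw [Multiset.mem_toFinset, Polynomial.mem_roots hP0, hroot] at hx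
    exact ⟨fun h => hav x hx (Finset.mem_union_left _ h), hx, eval_ne_zero_of_isCoprime hAB hx⟩

end Pencils

section Parameterizations

variable {K : Type*} [Field K]

theorem eval_smul_of_isHomogeneous {σ : Type*} [Fintype σ] {n : ℕ} {F : MvPolynomial σ K}
    (hF : F.IsHomogeneous n) (c : K) (v : σ → K) :
    MvPolynomial.eval (c • v) F = c ^ n * MvPolynomial.eval v F := by
  rw [MvPolynomial.eval_eq', MvPolynomial.eval_eq', Finset.mul_sum]
  refine Finset.sum_congr rfl fun d hd => ?_
  have hdeg : ∑ i, d i = n := by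
    rw [← Finsupp.degree_eq_sum]
    by_contra h
    exact (MvPolynomial.mem_support_iff.1 hd) (hF.coeff_eq_zero h)
  simp only [Pi.smul_apply, smul_eq_mul, mul_pow, Finset.prod_mul_distrib,
    Finset.prod_pow_eq_pow_sum, hdeg]
  ring

theorem evalVec_smul {n : ℕ} {f : Fin 3 → MvPolynomial (Fin 2) K}
    (hf : ∀ u, (f u).IsHomogeneous n) (c : K) (v : Fin 2 → K) :
    evalVec f (c • v) = c ^ n • evalVec f v :=
  funext fun u => eval_smul_of_isHomogeneous (hf u) c v

/-- A parameterization of degree `n` without base points whose restriction to the affine line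
`s = 1` is injective outside a finite set. -/
structure IsGoodParam (n : ℕ) (f : Fin 3 → MvPolynomial (Fin 2) K) : Prop where
  homog : ∀ u, (f u).IsHomogeneous n
  no_common_zero : ∀ v : Fin 2 → K, v ≠ 0 → evalVec f v ≠ 0
  gen_injective : ∃ T : Finset K, ∀ x ∉ T, ∀ y ∉ T, ∀ c : K,
    evalVec f ![1, y] = c • evalVec f ![1, x] → x = y

theorem IsProperParam.isGoodParam {n : ℕ} {f : Fin 3 → MvPolynomial (Fin 2) K}
    (hf : IsProperParam n f) : IsGoodParam n f := by
  refine ⟨hf.homog, hf.no_common_zero, ?_⟩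
  obtain ⟨S, hS, hinj⟩ := hf.gen_injective
  have hne : ∀ x : K, (![1, x] : Fin 2 → K) ≠ 0 := fun x h => one_ne_zero (congrFun h 0)
  let ι : K → Projectivization K (Fin 2 → K) := fun x => Projectivization.mk K ![1, x] (hne x)
  have hι : Function.Injective ι := by
    intro x y hxy
    rw [Projectivization.mk_eq_mk_iff'] at hxy
    obtain ⟨a, ha⟩ := hxy
    have h0 : a = 1 := by simpa using congrFun ha 0
    have h1 : a * y = x := by simpa using congrFun ha 1
    rw [← h1, h0, one_mul]
  have hpre : (ι ⁻¹' S).Finite := hS.preimage hι.injOn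
  have hproj : ∀ x, projMap f (ι x) =
      Projectivization.mk K _ (hf.no_common_zero ![1, x] (hne x)) := by
    intro x
    have hrep := hf.no_common_zero _ (ι x).rep_nonzero
    rw [projMap, dif_pos hrep, Projectivization.mk_eq_mk_iff']
    obtain ⟨a, ha⟩ := Projectivization.exists_smul_eq_mk_rep K ![1, x] (hne x)
    refine ⟨(a : K) ^ n, ?_⟩
    rw [← evalVec_smul hf.homog]
    congr 1
  refine ⟨hpre.toFinset, fun x hx y hy c hc => hι (hinj ?_ ?_ ?_)⟩
  · simpa using hx
  · simpa using hy
  · rw [hproj, hproj, eq_comm, Projectivization.mk_eq_mk_iff']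
    exact ⟨c, hc.symm⟩

variable {n : ℕ} {f : Fin 3 → MvPolynomial (Fin 2) K}

theorem evalVec_one_apply (f : Fin 3 → MvPolynomial (Fin 2) K) (x : K) (u : Fin 3) :
    evalVec f ![1, x] u = (dehom K (f u)).eval x := (eval_dehom _ _).symm

theorem IsGoodParam.not_on_line [IsAlgClosed K] [CharZero K] (hf : IsGoodParam n f) (hn : 2 ≤ n)
    (α β : K) {h : Polynomial K} (hh : h.natDegree ≤ n)
    (h1 : dehom K (f 1) = Polynomial.C α * h) (h2 : dehom K (f 2) = Polynomial.C β * h) :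
    False := by
  have hcop : IsCoprime (dehom K (f 0)) h := by
    refine isCoprime_of_no_common_root fun x hx hx' => hf.no_common_zero ![1, x]
      (fun h => one_ne_zero (congrFun h 0)) (funext fun u => ?_)
    rw [evalVec_one_apply]
    fin_cases u <;> simp [hx, h1, h2, hx']
  have hdeg : max (dehom K (f 0)).natDegree h.natDegree = n := by
    refine le_antisymm (max_le (natDegree_dehom_le (hf.homog 0)) hh) ?_
    by_contra! hlt
    have hlt0 : (dehom K (f 0)).natDegree < n := lt_of_le_of_lt (le_max_left _ _) hlt
    have hlth : h.natDegree < n := lt_of_le_of_lt (le_max_right _ _) hlt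
    refine hf.no_common_zero ![0, 1] (fun h => one_ne_zero (congrFun h 1)) (funext fun u => ?_)
    rw [evalVec, ← coeff_dehom_eq_eval (hf.homog u)]
    have hh0 := Polynomial.coeff_eq_zero_of_natDegree_lt hlth
    fin_cases u
    · exact Polynomial.coeff_eq_zero_of_natDegree_lt hlt0
    · simp [h1, hh0]
    · simp [h2, hh0]
  obtain ⟨T, hT⟩ := hf.gen_injective
  obtain ⟨Z, hZ⟩ := exists_simple_roots_of_pencil hcop hdeg (by omega) T
  obtain ⟨c, hc⟩ := Infinite.exists_notMem_finset Z
  obtain ⟨s, hs, hsx⟩ := hZ c hc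
  obtain ⟨x, hx, y, hy, hxy⟩ := Finset.one_lt_card.1 (by omega : 1 < s.card)
  obtain ⟨hxT, hx1, hx2⟩ := hsx x hx
  obtain ⟨hyT, hy1, hy2⟩ := hsx y hy
  refine hxy (hT x hxT y hyT (h.eval y / h.eval x) (funext fun u => ?_))
  rw [Pi.smul_apply, evalVec_one_apply, evalVec_one_apply, smul_eq_mul]
  fin_cases u
  · simp only [Fin.zero_eta, hx1, hy1]
    field_simp
  · simp only [Fin.mk_one, h1, Polynomial.eval_mul, Polynomial.eval_C]
    field_simp
  · simp only [Fin.reduceFinMk, h2, Polynomial.eval_mul, Polynomial.eval_C]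
    field_simp

/-- The forms `f_1, f_2` share a greatest common form, with coprime cofactors of degree `d`. -/
theorem IsGoodParam.exists_gcd [IsAlgClosed K] [CharZero K] (hf : IsGoodParam n f) (hn : 2 ≤ n) :
    ∃ (d : ℕ) (Γ A B : Polynomial K), dehom K (f 1) = Γ * A ∧ dehom K (f 2) = Γ * B ∧
      IsCoprime A B ∧ max A.natDegree B.natDegree = d ∧ 1 ≤ d ∧ d ≤ n ∧ Γ.natDegree ≤ n - d ∧
      Γ ≠ 0 := by
  classical
  have hne : ¬ (dehom K (f 1) = 0 ∧ dehom K (f 2) = 0) := fun h =>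
    hf.not_on_line hn 0 0 (h := 0) (by simp) (by simp [h.1]) (by simp [h.2])
  set Γ := EuclideanDomain.gcd (dehom K (f 1)) (dehom K (f 2)) with hΓ
  have hΓ0 : Γ ≠ 0 := fun h => hne (EuclideanDomain.gcd_eq_zero_iff.1 h)
  obtain ⟨A, hA⟩ := EuclideanDomain.gcd_dvd_left (dehom K (f 1)) (dehom K (f 2))
  obtain ⟨B, hB⟩ := EuclideanDomain.gcd_dvd_right (dehom K (f 1)) (dehom K (f 2))
  rw [← hΓ] at hA hB
  have hAd := natDegree_dehom_le (hf.homog 1)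
  have hBd := natDegree_dehom_le (hf.homog 2)
  have hAn : A ≠ 0 → Γ.natDegree + A.natDegree ≤ n := fun h => by
    rwa [← Polynomial.natDegree_mul hΓ0 h, ← hA]
  have hBn : B ≠ 0 → Γ.natDegree + B.natDegree ≤ n := fun h => by
    rwa [← Polynomial.natDegree_mul hΓ0 h, ← hB]
  have hsum : Γ.natDegree + max A.natDegree B.natDegree ≤ n := by
    by_cases hA0 : A = 0
    · by_cases hB0 : B = 0
      · exact absurd ⟨by rw [hA, hA0, mul_zero], by rw [hB, hB0, mul_zero]⟩ hne
      · have := hBn hB0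
        rw [hA0, Polynomial.natDegree_zero]
        omega
    · by_cases hB0 : B = 0
      · have := hAn hA0
        rw [hB0, Polynomial.natDegree_zero]
        omega
      · have := hAn hA0
        have := hBn hB0
        omega
  refine ⟨_, Γ, A, B, hA, hB, ?_, rfl, ?_, by omega, by omega, hΓ0⟩
  · obtain ⟨a, b, hab⟩ : ∃ a b, Γ = dehom K (f 1) * a + dehom K (f 2) * b :=
      ⟨_, _, EuclideanDomain.gcd_eq_gcd_ab _ _⟩
    refine ⟨a, b, mul_left_cancel₀ hΓ0 ?_⟩
    conv_rhs => rw [mul_one, hab]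
    rw [hA, hB]
    ring
  · by_contra! h0
    have h1 : A.natDegree = 0 := by omega
    have h2 : B.natDegree = 0 := by omega
    obtain ⟨α, hα⟩ := Polynomial.natDegree_eq_zero.1 h1
    obtain ⟨β, hβ⟩ := Polynomial.natDegree_eq_zero.1 h2
    exact hf.not_on_line hn α β (h := Γ) (by omega) (by rw [hA, ← hα, mul_comm])
      (by rw [hB, ← hβ, mul_comm])

/-- For almost all `c`, the line `w_1 = c w_2` meets the curve in at least `d` points coming from
distinct generic parameters. -/
theorem IsGoodParam.exists_fibre [IsAlgClosed K] [CharZero K]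
    {d : ℕ} {Γ A B : Polynomial K} (h1 : dehom K (f 1) = Γ * A) (h2 : dehom K (f 2) = Γ * B)
    (hAB : IsCoprime A B) (hd : max A.natDegree B.natDegree = d) (hd1 : 1 ≤ d) (hΓ : Γ ≠ 0)
    (T : Finset K) :
    ∃ Z : Finset K, ∀ c ∉ Z, ∃ s : Finset K, s.card = d ∧ ∀ x ∈ s, x ∉ T ∧
      evalVec f ![1, x] 1 = c * evalVec f ![1, x] 2 ∧ evalVec f ![1, x] 2 ≠ 0 := by
  classical
  obtain ⟨Z, hZ⟩ := exists_simple_roots_of_pencil hAB hd hd1 (T ∪ Γ.roots.toFinset)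
  refine ⟨Z, fun c hc => ?_⟩
  obtain ⟨s, hs, hsx⟩ := hZ c hc
  refine ⟨s, hs, fun x hx => ?_⟩
  obtain ⟨hxT, hx1, hx2⟩ := hsx x hx
  rw [Finset.mem_union, not_or, Multiset.mem_toFinset, Polynomial.mem_roots hΓ] at hxT
  refine ⟨hxT.1, ?_, ?_⟩
  · rw [evalVec_one_apply, evalVec_one_apply, h1, h2, Polynomial.eval_mul, Polynomial.eval_mul, hx1]
    ring
  · rw [evalVec_one_apply, h2, Polynomial.eval_mul]
    exact mul_ne_zero hxT.2 hx2

end Parameterizations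

section ImplicitDegree

variable {K : Type*} [Field K] {n : ℕ} {f : Fin 3 → MvPolynomial (Fin 2) K}

theorem eval_evalVec_eq_zero {F : MvPolynomial (Fin 3) K} (hF : MvPolynomial.aeval f F = 0)
    (v : Fin 2 → K) : MvPolynomial.eval (evalVec f v) F = 0 := by
  have h : (MvPolynomial.aeval v : MvPolynomial (Fin 2) K →ₐ[K] K).comp (MvPolynomial.aeval f) =
      MvPolynomial.aeval (evalVec f v) := by
    apply MvPolynomial.algHom_ext
    intro i
    simp [evalVec, MvPolynomial.aeval_eq_eval]
  have := DFunLike.congr_fun h F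
  rw [AlgHom.comp_apply, hF, map_zero, MvPolynomial.aeval_eq_eval] at this
  exact this.symm

theorem eval_aeval_polynomial {σ : Type*} (g : σ → Polynomial K) (F : MvPolynomial σ K) (x : K) :
    (MvPolynomial.aeval g F).eval x = MvPolynomial.eval (fun i => (g i).eval x) F := by
  have h : (Polynomial.aeval x).comp (MvPolynomial.aeval g) =
      (MvPolynomial.aeval (fun i => (g i).eval x) : MvPolynomial σ K →ₐ[K] K) := by
    apply MvPolynomial.algHom_ext
    intro i
    simp
  have := DFunLike.congr_fun h F
  simpa [MvPolynomial.aeval_eq_eval, Polynomial.aeval_def] using this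

theorem natDegree_aeval_le_degreeOf (F : MvPolynomial (Fin 3) K) (c : K) :
    (MvPolynomial.aeval ![Polynomial.X, Polynomial.C c, 1] F).natDegree ≤
      MvPolynomial.degreeOf 0 F := by
  rw [MvPolynomial.aeval_def, MvPolynomial.eval₂_eq']
  refine Polynomial.natDegree_sum_le_of_forall_le _ _ fun m hm => ?_
  have h1 := MvPolynomial.monomial_le_degreeOf 0 hm
  refine le_trans ?_ h1
  simp only [Polynomial.algebraMap_eq, Fin.prod_univ_three, Matrix.cons_val_zero,
    Matrix.cons_val_one, Matrix.cons_val, one_pow, mul_one, ← Polynomial.C_pow]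
  refine (Polynomial.natDegree_C_mul_le _ _).trans ((Polynomial.natDegree_mul_C_le _ _).trans ?_)
  exact Polynomial.natDegree_X_pow_le _

theorem exists_eval_chart_ne_zero [Infinite K] {N : ℕ} {F : MvPolynomial (Fin 3) K}
    (hF : F.IsHomogeneous N) (hF0 : F ≠ 0) :
    ∃ a b : K, MvPolynomial.eval ![a, b, 1] F ≠ 0 := by
  have hne : F * MvPolynomial.X 2 ≠ 0 := mul_ne_zero hF0 (MvPolynomial.X_ne_zero _)
  obtain ⟨v, hv⟩ : ∃ v, MvPolynomial.eval v (F * MvPolynomial.X 2) ≠ 0 := by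
    by_contra! h
    exact hne (MvPolynomial.funext fun v => by rw [h v, map_zero])
  rw [map_mul, MvPolynomial.eval_X] at hv
  have hv2 : v 2 ≠ 0 := right_ne_zero_of_mul hv
  refine ⟨v 0 / v 2, v 1 / v 2, fun h => left_ne_zero_of_mul hv ?_⟩
  have hvec : v = v 2 • ![v 0 / v 2, v 1 / v 2, 1] := by
    funext i
    fin_cases i <;> simp <;> field_simp
  rw [hvec, eval_smul_of_isHomogeneous hF, h, mul_zero]

theorem IsGoodParam.le_degreeOf [IsAlgClosed K] [CharZero K] (hf : IsGoodParam n f)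
    {N : ℕ} {F : MvPolynomial (Fin 3) K} (hF : F.IsHomogeneous N) (hF0 : F ≠ 0)
    (hFf : MvPolynomial.aeval f F = 0)
    {d : ℕ} {Γ A B : Polynomial K} (h1 : dehom K (f 1) = Γ * A) (h2 : dehom K (f 2) = Γ * B)
    (hAB : IsCoprime A B) (hd : max A.natDegree B.natDegree = d) (hd1 : 1 ≤ d) (hΓ : Γ ≠ 0) :
    d ≤ MvPolynomial.degreeOf 0 F := by
  classical
  obtain ⟨T, hT⟩ := hf.gen_injective
  obtain ⟨Z, hZ⟩ := IsGoodParam.exists_fibre h1 h2 hAB hd hd1 hΓ T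
  obtain ⟨a, b, hab⟩ := exists_eval_chart_ne_zero hF hF0
  set Q := MvPolynomial.aeval ![Polynomial.C a, Polynomial.X, 1] F with hQ
  have hQeval : ∀ c, Q.eval c = MvPolynomial.eval ![a, c, 1] F := by
    intro c
    rw [hQ, eval_aeval_polynomial]
    congr 2
    funext i
    fin_cases i <;> simp
  have hQ0 : Q ≠ 0 := fun h => hab (by rw [← hQeval, h, Polynomial.eval_zero])
  obtain ⟨c, hc⟩ := Infinite.exists_notMem_finset (Z ∪ Q.roots.toFinset)
  rw [Finset.mem_union, not_or, Multiset.mem_toFinset, Polynomial.mem_roots hQ0,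
    Polynomial.IsRoot.def, hQeval] at hc
  obtain ⟨s, hs, hsx⟩ := hZ c hc.1
  set P := MvPolynomial.aeval ![Polynomial.X, Polynomial.C c, 1] F with hP
  have hPeval : ∀ e, P.eval e = MvPolynomial.eval ![e, c, 1] F := by
    intro e
    rw [hP, eval_aeval_polynomial]
    congr 2
    funext i
    fin_cases i <;> simp
  have hP0 : P ≠ 0 := fun h => hc.2 (by rw [← hPeval, h, Polynomial.eval_zero])
  have hvec : ∀ x ∈ s, evalVec f ![1, x] = evalVec f ![1, x] 2 •
      ![evalVec f ![1, x] 0 / evalVec f ![1, x] 2, c, 1] := by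
    intro x hx
    obtain ⟨-, hx1, hx2⟩ := hsx x hx
    funext i
    fin_cases i
    · simp; field_simp
    · simp [hx1, mul_comm]
    · simp
  let ε : K → K := fun x => evalVec f ![1, x] 0 / evalVec f ![1, x] 2
  have hinj : Set.InjOn ε s := by
    intro x hx y hy hxy
    have hx' := hsx x hx
    have hy' := hsx y hy
    refine hT x hx'.1 y hy'.1 (evalVec f ![1, y] 2 / evalVec f ![1, x] 2) ?_
    rw [hvec y hy, hvec x hx, smul_smul]
    have hx2 := hx'.2.2
    simp only [ε] at hxy
    rw [hxy]
    congr 1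
    simp
    field_simp
  have hsub : s.image ε ⊆ P.roots.toFinset := by
    intro e he
    obtain ⟨x, hx, rfl⟩ := Finset.mem_image.1 he
    rw [Multiset.mem_toFinset, Polynomial.mem_roots hP0, Polynomial.IsRoot.def, hPeval]
    have h0 := eval_evalVec_eq_zero hFf ![1, x]
    rw [hvec x hx, eval_smul_of_isHomogeneous hF] at h0
    exact (mul_eq_zero.1 h0).resolve_left (pow_ne_zero _ (hsx x hx).2.2)
  calc d = (s.image ε).card := by rw [Finset.card_image_of_injOn hinj, hs]
    _ ≤ P.roots.toFinset.card := Finset.card_le_card hsub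
    _ ≤ P.roots.card := Multiset.toFinset_card_le _
    _ ≤ P.natDegree := Polynomial.card_roots' P
    _ ≤ MvPolynomial.degreeOf 0 F := natDegree_aeval_le_degreeOf F c

theorem IsGoodParam.algebraicIndependent [IsAlgClosed K] [CharZero K] (hf : IsGoodParam n f)
    (hn : 2 ≤ n) {R : MvPolynomial (Fin 2) K}
    (hR : MvPolynomial.aeval (fun i : Fin 2 => f i.succ) R = 0) : R = 0 := by
  obtain ⟨d, Γ, A, B, h1, h2, hAB, hd, hd1, -, -, hΓ⟩ := hf.exists_gcd hn
  obtain ⟨Z, hZ⟩ := IsGoodParam.exists_fibre h1 h2 hAB hd hd1 hΓ ∅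
  have hvan : ∀ v : Fin 2 → K, MvPolynomial.eval (fun i : Fin 2 => evalVec f v i.succ) R = 0 := by
    intro v
    have h : (MvPolynomial.aeval v : MvPolynomial (Fin 2) K →ₐ[K] K).comp
        (MvPolynomial.aeval (fun i : Fin 2 => f i.succ)) =
        MvPolynomial.aeval (fun i : Fin 2 => evalVec f v i.succ) := by
      apply MvPolynomial.algHom_ext
      intro i
      simp [evalVec, MvPolynomial.aeval_eq_eval]
    have := DFunLike.congr_fun h R
    rw [AlgHom.comp_apply, hR, map_zero, MvPolynomial.aeval_eq_eval] at this
    exact this.symm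
  set S : MvPolynomial (Fin 2) K := MvPolynomial.X 1 *
    ∏ c ∈ Z, (MvPolynomial.X 0 - MvPolynomial.C c * MvPolynomial.X 1) with hS
  have hS0 : S ≠ 0 := by
    refine mul_ne_zero (MvPolynomial.X_ne_zero _) (Finset.prod_ne_zero_iff.2 fun c _ h => ?_)
    have := congrArg (MvPolynomial.eval ![1, 0]) h
    simp at this
  have hRS : R * S = 0 := by
    refine MvPolynomial.funext fun w => ?_
    rw [map_mul, map_zero]
    by_contra hne
    have hSw := right_ne_zero_of_mul hne
    rw [hS, map_mul, MvPolynomial.eval_X, map_prod] at hSw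
    have hw1 : w 1 ≠ 0 := left_ne_zero_of_mul hSw
    have hcZ : w 0 / w 1 ∉ Z := by
      intro hmem
      refine Finset.prod_ne_zero_iff.1 (right_ne_zero_of_mul hSw) _ hmem ?_
      simp only [map_sub, map_mul, MvPolynomial.eval_X, MvPolynomial.eval_C]
      field_simp
      simp
    obtain ⟨s, hs, hsx⟩ := hZ _ hcZ
    obtain ⟨x, hx⟩ := Finset.card_pos.1 (by omega : 0 < s.card)
    obtain ⟨-, hx1, hx2⟩ := hsx x hx
    obtain ⟨μ, hμ⟩ := IsAlgClosed.exists_pow_nat_eq (w 1 / evalVec f ![1, x] 2)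
      (by omega : 0 < n)
    refine left_ne_zero_of_mul hne ?_
    rw [← hvan (μ • ![1, x]), evalVec_smul hf.homog, hμ]
    congr 2
    funext i
    fin_cases i
    · simp [hx1]; field_simp
    · simp; field_simp
  exact (mul_eq_zero.1 hRS).resolve_right hS0

theorem eval₂_finSuccEquiv (f : Fin 3 → MvPolynomial (Fin 2) K) (F : MvPolynomial (Fin 3) K) :
    Polynomial.eval₂ (MvPolynomial.aeval (fun i : Fin 2 => f i.succ) :
      MvPolynomial (Fin 2) K →ₐ[K] MvPolynomial (Fin 2) K).toRingHom (f 0)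
      (MvPolynomial.finSuccEquiv K 2 F) = MvPolynomial.aeval f F := by
  have h : (Polynomial.eval₂RingHom (MvPolynomial.aeval (fun i : Fin 2 => f i.succ) :
      MvPolynomial (Fin 2) K →ₐ[K] MvPolynomial (Fin 2) K).toRingHom (f 0)).comp
      (MvPolynomial.finSuccEquiv K 2 : _ →+* _) =
      (MvPolynomial.aeval f : MvPolynomial (Fin 3) K →ₐ[K] MvPolynomial (Fin 2) K).toRingHom := by
    apply MvPolynomial.ringHom_ext
    · intro r
      simp [MvPolynomial.finSuccEquiv_apply]
    · intro i
      refine Fin.cases ?_ (fun j => ?_) i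
      · simp [MvPolynomial.finSuccEquiv_apply]
      · simp [MvPolynomial.finSuccEquiv_apply]
  exact DFunLike.congr_fun h F

/-- An irreducible polynomial over a unique factorization domain `R` which vanishes at `y` through
an injective ring homomorphism from `R` has minimal degree among the nonzero polynomials with this
property. -/
theorem natDegree_le_of_irreducible_of_eval₂_eq_zero {R S : Type*} [CommRing R] [IsDomain R]
    [UniqueFactorizationMonoid R] (L : Type*) [Field L] [Algebra R L] [IsFractionRing R L]
    [CommRing S] [IsDomain S] (M : Type*) [Field M] [Algebra S M]
    [IsFractionRing S M] {φ : R →+* S}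
    (hφ : Function.Injective φ) {y : S} {P Q : Polynomial R} (hP : Irreducible P)
    (hP0 : P.natDegree ≠ 0) (hQ : Q ≠ 0) (hPy : P.eval₂ φ y = 0) (hQy : Q.eval₂ φ y = 0) :
    P.natDegree ≤ Q.natDegree := by
  have hφL : Function.Injective ((algebraMap S M).comp φ) := by
    rw [RingHom.coe_comp]
    exact (IsFractionRing.injective S M).comp hφ
  obtain ⟨ψ, hψ⟩ : ∃ ψ : L →+* M,
      ψ.comp (algebraMap R L) = (algebraMap S M).comp φ :=
    ⟨IsFractionRing.lift hφL, RingHom.ext fun r => IsFractionRing.lift_algebraMap hφL r⟩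
  have hev : ∀ G : Polynomial R, G.eval₂ φ y = 0 →
      Polynomial.eval₂ ψ (algebraMap S M y)
        (G.map (algebraMap R L)) = 0 := by
    intro G hG
    rw [Polynomial.eval₂_map, hψ, ← Polynomial.hom_eval₂, hG, map_zero]
  have hirrL : Irreducible (P.map (algebraMap R L)) :=
    ((hP.isPrimitive hP0).irreducible_iff_irreducible_map_fraction_map).1 hP
  have hdvd : P.map (algebraMap R L) ∣ Q.map (algebraMap R L) := by
    by_contra hnd
    obtain ⟨a, b, hab⟩ := (hirrL.coprime_iff_not_dvd).2 hnd
    have := congrArg (Polynomial.eval₂ ψ (algebraMap S M y)) hab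
    rw [Polynomial.eval₂_add, Polynomial.eval₂_mul, Polynomial.eval₂_mul, hev P hPy, hev Q hQy,
      Polynomial.eval₂_one, mul_zero, mul_zero, add_zero] at this
    exact zero_ne_one this
  have hinj := IsFractionRing.injective R L
  have := Polynomial.natDegree_le_of_dvd hdvd ((Polynomial.map_ne_zero_iff hinj).2 hQ)
  rwa [Polynomial.natDegree_map_eq_of_injective hinj,
    Polynomial.natDegree_map_eq_of_injective hinj] at this

/-- An irreducible relation has minimal degree in `w_0` among all relations, provided that
`f_1, f_2` are algebraically independent. -/
theorem degreeOf_le_of_irreducible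
    (hind : ∀ R : MvPolynomial (Fin 2) K,
      MvPolynomial.aeval (fun i : Fin 2 => f i.succ) R = 0 → R = 0)
    {F H : MvPolynomial (Fin 3) K} (hF : Irreducible F) (hFf : MvPolynomial.aeval f F = 0)
    (hH : H ≠ 0) (hHf : MvPolynomial.aeval f H = 0) (hdeg : MvPolynomial.degreeOf 0 F ≠ 0) :
    MvPolynomial.degreeOf 0 F ≤ MvPolynomial.degreeOf 0 H := by
  rw [← MvPolynomial.natDegree_finSuccEquiv] at hdeg
  rw [← MvPolynomial.natDegree_finSuccEquiv, ← MvPolynomial.natDegree_finSuccEquiv]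
  exact natDegree_le_of_irreducible_of_eval₂_eq_zero
    (FractionRing (MvPolynomial (Fin 2) K)) (FractionRing (MvPolynomial (Fin 2) K))
    ((injective_iff_map_eq_zero _).2 hind)
    ((MulEquiv.irreducible_iff (MvPolynomial.finSuccEquiv K 2)).2 hF) hdeg
    ((map_ne_zero_iff _ (MvPolynomial.finSuccEquiv K 2).injective).2 hH)
    ((eval₂_finSuccEquiv f F).trans hFf) ((eval₂_finSuccEquiv f H).trans hHf)

/-- If a form of degree `k` divides `f_1` and `f_2`, there is a relation of degree at most
`n - k` in `w_0`. -/
theorem exists_relation_of_dvd (hf : ∀ u, (f u).IsHomogeneous n) {k : ℕ} (hkn : k ≤ n)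
    {g : MvPolynomial (Fin 2) K} (hg : g.IsHomogeneous k) (h1 : g ∣ f 1) (h2 : g ∣ f 2) :
    ∃ H : MvPolynomial (Fin 3) K, H ≠ 0 ∧ MvPolynomial.aeval f H = 0 ∧
      MvPolynomial.degreeOf 0 H ≤ n - k := by
  classical
  obtain ⟨q₁, hq₁, he₁⟩ := exists_dehom_eq_mul_of_dvd hkn hg (hf 1) h1
  obtain ⟨q₂, hq₂, he₂⟩ := exists_dehom_eq_mul_of_dvd hkn hg (hf 2) h2
  set d := n - k with hd
  let M := n * d + 1
  let ι := Fin (d + 1) × Fin (M + 1)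
  let b : ι → Polynomial K := fun i => dehom K (f 0) ^ (i.1 : ℕ) *
    dehom K (f 2) ^ (d - (i.1 : ℕ)) * (q₁ ^ (i.2 : ℕ) * q₂ ^ (M - (i.2 : ℕ)))
  have hbdeg : ∀ i, b i ∈ Polynomial.degreeLT K (n * d + d * M + 1) := by
    intro i
    rw [Polynomial.mem_degreeLT]
    refine lt_of_le_of_lt Polynomial.degree_le_natDegree ?_
    have hi1 := i.1.isLt
    have hi2 := i.2.isLt
    have e0 : (dehom K (f 0) ^ (i.1 : ℕ)).natDegree ≤ (i.1 : ℕ) * n :=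
      Polynomial.natDegree_pow_le_of_le _ (natDegree_dehom_le (hf 0))
    have e2 : (dehom K (f 2) ^ (d - (i.1 : ℕ))).natDegree ≤ (d - (i.1 : ℕ)) * n :=
      Polynomial.natDegree_pow_le_of_le _ (natDegree_dehom_le (hf 2))
    have eq1 : (q₁ ^ (i.2 : ℕ)).natDegree ≤ (i.2 : ℕ) * d :=
      Polynomial.natDegree_pow_le_of_le _ hq₁
    have eq2 : (q₂ ^ (M - (i.2 : ℕ))).natDegree ≤ (M - (i.2 : ℕ)) * d :=
      Polynomial.natDegree_pow_le_of_le _ hq₂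
    have hle : (b i).natDegree ≤ n * d + d * M := by
      have s1 : (i.1 : ℕ) * n + (d - (i.1 : ℕ)) * n = n * d := by
        rw [← add_mul, Nat.add_sub_cancel' (by omega), mul_comm]
      have s2 : (i.2 : ℕ) * d + (M - (i.2 : ℕ)) * d = d * M := by
        rw [← add_mul, Nat.add_sub_cancel' (by omega), mul_comm]
      refine Polynomial.natDegree_mul_le.trans ?_
      have t1 := Polynomial.natDegree_mul_le (p := dehom K (f 0) ^ (i.1 : ℕ))
        (q := dehom K (f 2) ^ (d - (i.1 : ℕ)))
      have t2 := Polynomial.natDegree_mul_le (p := q₁ ^ (i.2 : ℕ)) (q := q₂ ^ (M - (i.2 : ℕ)))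
      omega
    exact_mod_cast Nat.lt_succ_of_le hle
  have hdep : ¬ LinearIndependent K b := by
    intro hli
    have hli' : LinearIndependent K (fun i =>
        (⟨b i, hbdeg i⟩ : Polynomial.degreeLT K (n * d + d * M + 1))) :=
      LinearIndependent.of_comp (Submodule.subtype _) hli
    have hfin : Module.finrank K (Polynomial.degreeLT K (n * d + d * M + 1)) =
        n * d + d * M + 1 := by
      rw [(Polynomial.degreeLTEquiv K _).finrank_eq, Module.finrank_fin_fun]
    have : Module.Finite K (Polynomial.degreeLT K (n * d + d * M + 1)) :=
      Module.Finite.equiv (Polynomial.degreeLTEquiv K _).symm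
    have hcard := hli'.fintype_card_le_finrank
    rw [hfin, Fintype.card_prod, Fintype.card_fin, Fintype.card_fin] at hcard
    have : (d + 1) * (M + 1) = d * M + d + M + 1 := by ring
    simp only [M] at *
    omega
  rw [Fintype.not_linearIndependent_iff] at hdep
  obtain ⟨c, hc, i₀, hi₀⟩ := hdep
  let e : ι → (Fin 3 →₀ ℕ) := fun i => Finsupp.single 0 (i.1 : ℕ) + Finsupp.single 1 (i.2 : ℕ) +
    Finsupp.single 2 (M - (i.2 : ℕ) + (d - (i.1 : ℕ)))
  have he0 : ∀ i, e i 0 = i.1 := fun i => by simp [e]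
  have he1 : ∀ i, e i 1 = i.2 := fun i => by simp [e]
  have he2 : ∀ i, e i 2 = M - (i.2 : ℕ) + (d - (i.1 : ℕ)) := fun i => by simp [e]
  have hinj : Function.Injective e := fun i j hij =>
    Prod.ext (Fin.ext (by rw [← he0, ← he0, hij])) (Fin.ext (by rw [← he1, ← he1, hij]))
  let H : MvPolynomial (Fin 3) K := ∑ i, MvPolynomial.monomial (e i) (c i)
  have hcoeff : ∀ m, H.coeff m = ∑ i, if e i = m then c i else 0 := by
    intro m
    simp only [H, MvPolynomial.coeff_sum, MvPolynomial.coeff_monomial]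
  refine ⟨H, fun h0 => hi₀ ?_, ?_, ?_⟩
  · have := hcoeff (e i₀)
    rw [h0, MvPolynomial.coeff_zero, Finset.sum_eq_single i₀ (fun j _ hj => if_neg fun h =>
      hj (hinj h)) (by simp), if_pos rfl] at this
    exact this.symm
  · have hHhom : H.IsHomogeneous (M + d) := by
      refine MvPolynomial.IsHomogeneous.sum _ _ _ fun i _ =>
        MvPolynomial.isHomogeneous_monomial _ ?_
      have := i.1.isLt
      have := i.2.isLt
      rw [Finsupp.degree_eq_sum, Fin.sum_univ_three, he0, he1, he2]
      omega
    refine eq_of_dehom_eq (hHhom.aeval f hf) (MvPolynomial.isHomogeneous_zero _ _ _) ?_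
    rw [map_zero]
    have hmon : ∀ i, dehom K (MvPolynomial.aeval f (MvPolynomial.monomial (e i) (c i))) =
        dehom K g ^ M * (c i • b i) := by
      intro i
      have hi2 := i.2.isLt
      have hpow : dehom K g ^ M = dehom K g ^ (i.2 : ℕ) * dehom K g ^ (M - (i.2 : ℕ)) := by
        rw [← pow_add, Nat.add_sub_cancel' (by omega)]
      rw [MvPolynomial.aeval_monomial, Finsupp.prod_fintype _ _ (fun _ => pow_zero _),
        Fin.prod_univ_three]
      simp only [map_mul, map_pow, he0, he1, he2, AlgHom.commutes, Polynomial.algebraMap_eq,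
        Polynomial.smul_eq_C_mul, b, pow_add, hpow, he₁, he₂, mul_pow]
      ring
    simp only [H, map_sum, hmon]
    rw [← Finset.mul_sum, hc, mul_zero]
  · rw [MvPolynomial.degreeOf_le_iff]
    intro m hm
    rw [MvPolynomial.mem_support_iff, hcoeff] at hm
    obtain ⟨i, -, hi⟩ := Finset.exists_ne_zero_of_sum_ne_zero hm
    have him : e i = m := by
      by_contra h
      exact hi (if_neg h)
    rw [← him, he0]
    have := i.1.isLt
    omega

end ImplicitDegree

section LinearChange

variable {K : Type*} [Field K]

/-- The linear combinations of `f_0, f_1, f_2` with coefficients in the rows of `M`. -/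
def linComb {A : Type*} [CommRing A] [Algebra K A] (M : Matrix (Fin 3) (Fin 3) K)
    (f : Fin 3 → A) : Fin 3 → A :=
  fun u => ∑ j, M u j • f j

/-- The linear change of variables given by the matrix `M`. -/
def linSub (M : Matrix (Fin 3) (Fin 3) K) : MvPolynomial (Fin 3) K →ₐ[K] MvPolynomial (Fin 3) K :=
  MvPolynomial.aeval (linComb M MvPolynomial.X)

theorem linComb_linComb {A : Type*} [CommRing A] [Algebra K A] (M N : Matrix (Fin 3) (Fin 3) K)
    (f : Fin 3 → A) : linComb M (linComb N f) = linComb (M * N) f := by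
  funext u
  simp only [linComb, Finset.smul_sum, smul_smul, Matrix.mul_apply, Finset.sum_smul]
  exact Finset.sum_comm

theorem linComb_one {A : Type*} [CommRing A] [Algebra K A] (f : Fin 3 → A) :
    linComb (1 : Matrix (Fin 3) (Fin 3) K) f = f := by
  funext u
  simp [linComb, Matrix.one_apply]

theorem aeval_linSub {A : Type*} [CommRing A] [Algebra K A] (M : Matrix (Fin 3) (Fin 3) K)
    (f : Fin 3 → A) (F : MvPolynomial (Fin 3) K) :
    MvPolynomial.aeval f (linSub M F) = MvPolynomial.aeval (linComb M f) F := by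
  have h : (MvPolynomial.aeval f : MvPolynomial (Fin 3) K →ₐ[K] A).comp (linSub M) =
      MvPolynomial.aeval (linComb M f) := by
    apply MvPolynomial.algHom_ext
    intro i
    simp [linSub, linComb]
  exact DFunLike.congr_fun h F

theorem linSub_linSub (M N : Matrix (Fin 3) (Fin 3) K) (F : MvPolynomial (Fin 3) K) :
    linSub M (linSub N F) = linSub (N * M) F := by
  rw [linSub, aeval_linSub, linComb_linComb, linSub]

theorem linSub_one (F : MvPolynomial (Fin 3) K) :
    linSub (1 : Matrix (Fin 3) (Fin 3) K) F = F := by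
  rw [linSub, linComb_one, MvPolynomial.aeval_X_left_apply]

theorem linComb_eq_mulVec (M : Matrix (Fin 3) (Fin 3) K) (v : Fin 3 → K) :
    linComb M v = M.mulVec v := by
  funext u
  simp [linComb, Matrix.mulVec, dotProduct]

theorem eval_linSub (M : Matrix (Fin 3) (Fin 3) K) (v : Fin 3 → K) (F : MvPolynomial (Fin 3) K) :
    MvPolynomial.eval v (linSub M F) = MvPolynomial.eval (M.mulVec v) F := by
  rw [← MvPolynomial.aeval_eq_eval, ← MvPolynomial.aeval_eq_eval, ← linComb_eq_mulVec]
  exact aeval_linSub M v F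

theorem isHomogeneous_linComb {σ : Type*} (M : Matrix (Fin 3) (Fin 3) K) {n : ℕ}
    {f : Fin 3 → MvPolynomial σ K} (hf : ∀ u, (f u).IsHomogeneous n) (u : Fin 3) :
    (linComb M f u).IsHomogeneous n := by
  refine MvPolynomial.IsHomogeneous.sum _ _ _ fun j _ => ?_
  rw [MvPolynomial.smul_eq_C_mul]
  simpa using (MvPolynomial.isHomogeneous_C _ (M u j)).mul (hf j)

theorem isHomogeneous_linSub (M : Matrix (Fin 3) (Fin 3) K) {n : ℕ}
    {F : MvPolynomial (Fin 3) K} (hF : F.IsHomogeneous n) : (linSub M F).IsHomogeneous n := by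
  have h := hF.aeval _ (isHomogeneous_linComb M (MvPolynomial.isHomogeneous_X K))
  rwa [one_mul] at h

theorem irreducible_linSub {M N : Matrix (Fin 3) (Fin 3) K} (hMN : M * N = 1)
    {F : MvPolynomial (Fin 3) K} (hF : Irreducible F) : Irreducible (linSub M F) := by
  have hNM := mul_eq_one_comm.1 hMN
  let e : MvPolynomial (Fin 3) K ≃ₐ[K] MvPolynomial (Fin 3) K :=
    AlgEquiv.ofAlgHom (linSub M) (linSub N)
      (AlgHom.ext fun G => by simp [linSub_linSub, hNM, linSub_one])
      (AlgHom.ext fun G => by simp [linSub_linSub, hMN, linSub_one])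
  exact (MulEquiv.irreducible_iff e).2 hF

theorem linSub_mem_pointIdeal_pow (M : Matrix (Fin 3) (Fin 3) K) {v : Fin 3 → K} {m : ℕ}
    {F : MvPolynomial (Fin 3) K} (hF : F ∈ pointIdeal (M.mulVec v) ^ m) :
    linSub M F ∈ pointIdeal v ^ m := by
  have hle : (pointIdeal (M.mulVec v)).map (linSub M) ≤ pointIdeal v := by
    rw [pointIdeal, Ideal.map_span, Ideal.span_le]
    rintro _ ⟨L, ⟨hL, hL0⟩, rfl⟩
    exact Ideal.subset_span ⟨isHomogeneous_linSub M hL, (eval_linSub M v L).trans hL0⟩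
  have := Ideal.mem_map_of_mem (linSub M) hF
  rw [Ideal.map_pow] at this
  exact Ideal.pow_right_mono hle m this

theorem multAt_linSub {M N : Matrix (Fin 3) (Fin 3) K} (hMN : M * N = 1) (v : Fin 3 → K)
    (F : MvPolynomial (Fin 3) K) : multAt (linSub M F) v = multAt F (M.mulVec v) := by
  unfold multAt
  congr 1
  ext m
  refine ⟨fun h => ?_, linSub_mem_pointIdeal_pow M⟩
  have hv : v = N.mulVec (M.mulVec v) := by
    rw [Matrix.mulVec_mulVec, mul_eq_one_comm.1 hMN, Matrix.one_mulVec]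
  simp only [Set.mem_ofPred_eq] at h
  rw [hv] at h
  have := linSub_mem_pointIdeal_pow N h
  rwa [linSub_linSub, hMN, linSub_one] at this

theorem exists_matrix_mulVec_eq {p : Fin 3 → K} (hp : p ≠ 0) :
    ∃ M N : Matrix (Fin 3) (Fin 3) K, M * N = 1 ∧ M.mulVec ![1, 0, 0] = p := by
  obtain ⟨i, hi⟩ := Function.ne_iff.1 hp
  simp only [Pi.zero_apply] at hi
  fin_cases i
  · refine ⟨!![p 0, 0, 0; p 1, 1, 0; p 2, 0, 1],
      !![1 / p 0, 0, 0; -p 1 / p 0, 1, 0; -p 2 / p 0, 0, 1], ?_, ?_⟩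
    · ext a b
      fin_cases a <;> fin_cases b <;> simp [Matrix.mul_apply, Fin.sum_univ_three] <;>
        field_simp <;> simp_all
    · funext a
      fin_cases a <;> simp
  · refine ⟨!![p 0, 1, 0; p 1, 0, 0; p 2, 0, 1],
      !![0, 1 / p 1, 0; 1, -p 0 / p 1, 0; 0, -p 2 / p 1, 1], ?_, ?_⟩
    · ext a b
      fin_cases a <;> fin_cases b <;> simp [Matrix.mul_apply, Fin.sum_univ_three] <;>
        field_simp <;> simp_all
    · funext a
      fin_cases a <;> simp
  · refine ⟨!![p 0, 1, 0; p 1, 0, 1; p 2, 0, 0],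
      !![0, 0, 1 / p 2; 1, 0, -p 0 / p 2; 0, 1, -p 1 / p 2], ?_, ?_⟩
    · ext a b
      fin_cases a <;> fin_cases b <;> simp [Matrix.mul_apply, Fin.sum_univ_three] <;>
        field_simp <;> simp_all
    · funext a
      fin_cases a <;> simp

theorem sum_eq_of_mem_support {n : ℕ} {F : MvPolynomial (Fin 3) K} (hF : F.IsHomogeneous n)
    {e : Fin 3 →₀ ℕ} (he : e ∈ F.support) : e 0 + e 1 + e 2 = n := by
  rw [← Fin.sum_univ_three e, ← Finsupp.degree_eq_sum, Finsupp.degree_eq_weight_one]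
  exact hF (MvPolynomial.mem_support_iff.1 he)

theorem le_of_mem_pointIdeal_pow {m : ℕ} {G : MvPolynomial (Fin 3) K}
    (hG : G ∈ pointIdeal (![1, 0, 0] : Fin 3 → K) ^ m) :
    ∀ d ∈ G.support, m ≤ d 1 + d 2 := by
  classical
  have h1 : ∀ L ∈ pointIdeal (![1, 0, 0] : Fin 3 → K), ∀ d ∈ L.support, 1 ≤ d 1 + d 2 := by
    intro L hL
    induction hL using Submodule.span_induction with
    | mem L hL =>
      intro d hd
      by_contra hlt
      have hd1 : d 1 = 0 := by omega
      have hd2 : d 2 = 0 := by omega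
      have hdeg : ∀ e ∈ L.support, e 0 + e 1 + e 2 = 1 := fun e => sum_eq_of_mem_support hL.1
      have hev := hL.2
      rw [MvPolynomial.eval_eq', Finset.sum_eq_single d] at hev
      · refine MvPolynomial.mem_support_iff.1 hd ?_
        simpa [Fin.prod_univ_three, hd1, hd2] using hev
      · intro e he hed
        have he' : e 1 ≠ 0 ∨ e 2 ≠ 0 := by
          by_contra! h
          refine hed (Finsupp.ext fun i => ?_)
          have := hdeg e he
          have := hdeg d hd
          fin_cases i <;> simp <;> omega
        rcases he' with h | h <;> simp [Fin.prod_univ_three, h]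
      · exact fun h => absurd hd h
    | zero => simp
    | add x y _ _ hx hy =>
      intro d hd
      rcases Finset.mem_union.1 (MvPolynomial.support_add hd) with h | h
      · exact hx d h
      · exact hy d h
    | smul a x _ hx =>
      intro d hd
      obtain ⟨a', -, b', hb', rfl⟩ := Finset.mem_add.1 (MvPolynomial.support_mul _ _ hd)
      have := hx b' hb'
      simp only [Finsupp.add_apply]
      omega
  induction m generalizing G with
  | zero => exact fun _ _ => Nat.zero_le _
  | succ m ih =>
    rw [pow_succ] at hG
    induction hG using Submodule.mul_induction_on' with
    | mem_mul_mem x hx y hy =>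
      intro d hd
      obtain ⟨a', ha', b', hb', rfl⟩ := Finset.mem_add.1 (MvPolynomial.support_mul _ _ hd)
      have := ih hx a' ha'
      have := h1 y hy b' hb'
      simp only [Finsupp.add_apply]
      omega
    | add x _ y _ hx hy =>
      intro d hd
      rcases Finset.mem_union.1 (MvPolynomial.support_add hd) with h | h
      · exact hx d h
      · exact hy d h

theorem mem_pointIdeal_pow_iff {n m : ℕ} {F : MvPolynomial (Fin 3) K} (hF : F.IsHomogeneous n)
    (hF0 : F ≠ 0) :
    F ∈ pointIdeal (![1, 0, 0] : Fin 3 → K) ^ m ↔ MvPolynomial.degreeOf 0 F + m ≤ n := by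
  have hdeg : ∀ e ∈ F.support, e 0 + e 1 + e 2 = n := fun e => sum_eq_of_mem_support hF
  constructor
  · intro h
    have hle := le_of_mem_pointIdeal_pow h
    obtain ⟨d, hd, hd0⟩ := Finset.exists_mem_eq_sup F.support
      (MvPolynomial.support_nonempty.2 hF0) (fun e => e 0)
    rw [MvPolynomial.degreeOf_eq_sup, hd0]
    have := hdeg d hd
    have := hle d hd
    omega
  · intro h
    rw [F.as_sum]
    refine Ideal.sum_mem _ fun d hd => ?_
    have hd0 := MvPolynomial.monomial_le_degreeOf 0 hd
    have := hdeg d hd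
    have hX : ∀ i : Fin 3, i ≠ 0 →
        (MvPolynomial.X i : MvPolynomial (Fin 3) K) ∈ pointIdeal (![1, 0, 0] : Fin 3 → K) := by
      intro i hi
      refine Ideal.subset_span ⟨MvPolynomial.isHomogeneous_X _ _, ?_⟩
      fin_cases i <;> simp at hi ⊢
    rw [MvPolynomial.monomial_eq, Finsupp.prod_fintype _ _ (fun _ => pow_zero _),
      Fin.prod_univ_three, mul_assoc]
    refine Ideal.mul_mem_left _ _ (Ideal.mul_mem_left _ _ ?_)
    refine Ideal.pow_le_pow_right (by omega : m ≤ d 1 + d 2) ?_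
    rw [pow_add]
    exact Ideal.mul_mem_mul (Ideal.pow_mem_pow (hX 1 (by decide)) _)
      (Ideal.pow_mem_pow (hX 2 (by decide)) _)

theorem multAt_eq_sub_degreeOf {n : ℕ} {F : MvPolynomial (Fin 3) K} (hF : F.IsHomogeneous n)
    (hF0 : F ≠ 0) :
    multAt F ![1, 0, 0] = n - MvPolynomial.degreeOf 0 F := by
  have hle : MvPolynomial.degreeOf 0 F ≤ n := by
    simpa using (mem_pointIdeal_pow_iff (m := 0) hF hF0).1 (by simp)
  have : {m | F ∈ pointIdeal (![1, 0, 0] : Fin 3 → K) ^ m} =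
      Set.Iic (n - MvPolynomial.degreeOf 0 F) := by
    ext m
    rw [Set.mem_ofPred_eq, mem_pointIdeal_pow_iff hF hF0, Set.mem_Iic]
    omega
  rw [multAt, this, csSup_Iic]

theorem evalVec_linComb (N : Matrix (Fin 3) (Fin 3) K) (f : Fin 3 → MvPolynomial (Fin 2) K)
    (v : Fin 2 → K) : evalVec (linComb N f) v = N.mulVec (evalVec f v) := by
  funext u
  simp [evalVec, linComb, Matrix.mulVec, dotProduct]

theorem IsGoodParam.linComb {n : ℕ} {f : Fin 3 → MvPolynomial (Fin 2) K} (hf : IsGoodParam n f)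
    {M N : Matrix (Fin 3) (Fin 3) K} (hMN : M * N = 1) : IsGoodParam n (linComb N f) := by
  have hinj : ∀ v w : Fin 3 → K, N.mulVec v = N.mulVec w → v = w := by
    intro v w h
    have := congrArg M.mulVec h
    rwa [Matrix.mulVec_mulVec, Matrix.mulVec_mulVec, hMN, Matrix.one_mulVec,
      Matrix.one_mulVec] at this
  refine ⟨isHomogeneous_linComb N hf.homog, fun v hv h => hf.no_common_zero v hv ?_, ?_⟩
  · rw [evalVec_linComb] at h
    exact hinj _ _ (by rw [h, Matrix.mulVec_zero])
  · obtain ⟨T, hT⟩ := hf.gen_injective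
    refine ⟨T, fun x hx y hy c h => hT x hx y hy c (hinj _ _ ?_)⟩
    rw [evalVec_linComb, evalVec_linComb] at h
    rw [h, Matrix.mulVec_smul]

theorem dvd_crossDiff_iff {M N : Matrix (Fin 3) (Fin 3) K} (hMN : M * N = 1)
    {p : Fin 3 → K} (hp : p ≠ 0) (hMp : M.mulVec ![1, 0, 0] = p)
    (f : Fin 3 → MvPolynomial (Fin 2) K) (g : MvPolynomial (Fin 2) K) :
    (∀ i j : Fin 3, i < j → g ∣ crossDiff f p i j) ↔
      g ∣ linComb N f 1 ∧ g ∣ linComb N f 2 := by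
  have hM0 : ∀ i, M i 0 = p i := fun i => by
    rw [← hMp]; simp [Matrix.mulVec, dotProduct, Fin.sum_univ_three]
  constructor
  · intro h
    have h' := dvd_crossDiff_of_lt h
    obtain ⟨i, hi⟩ := Function.ne_iff.1 hp
    have hNp : N.mulVec p = ![1, 0, 0] := by
      rw [← hMp, Matrix.mulVec_mulVec, mul_eq_one_comm.1 hMN, Matrix.one_mulVec]
    have key : ∀ l : Fin 3, N.mulVec p l = 0 → g ∣ linComb N f l := by
      intro l hl
      have hsum : MvPolynomial.C (p i) * linComb N f l =
          ∑ j, MvPolynomial.C (N l j) * crossDiff f p i j := by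
        have h0 : ∑ j, MvPolynomial.C (σ := Fin 2) (N l j) * MvPolynomial.C (p j) = 0 := by
          simp only [← MvPolynomial.C_mul, ← map_sum]
          rw [← map_zero MvPolynomial.C]
          exact congrArg _ hl
        calc MvPolynomial.C (p i) * linComb N f l
            = MvPolynomial.C (p i) * linComb N f l -
              (∑ j, MvPolynomial.C (σ := Fin 2) (N l j) * MvPolynomial.C (p j)) * f i := by
              rw [h0]; ring
          _ = _ := by
              simp only [linComb, crossDiff, Fin.sum_univ_three, MvPolynomial.smul_eq_C_mul]
              ring
      have hu : IsUnit (MvPolynomial.C (σ := Fin 2) (p i)) := (IsUnit.mk0 _ hi).map _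
      rw [← hu.dvd_mul_left, hsum]
      exact Finset.dvd_sum fun j _ => Dvd.dvd.mul_left (h' i j) _
    exact ⟨key 1 (by rw [hNp]; rfl), key 2 (by rw [hNp]; rfl)⟩
  · rintro ⟨h1, h2⟩ i j -
    have hf : ∀ u, f u = ∑ l, MvPolynomial.C (M u l) * linComb N f l := by
      intro u
      have := congrFun (linComb_linComb M N f) u
      rw [hMN, linComb_one] at this
      rw [← this]
      simp only [linComb, MvPolynomial.smul_eq_C_mul]
    have : crossDiff f p i j =
        MvPolynomial.C (M i 0 * M j 1 - M j 0 * M i 1) * linComb N f 1 +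
        MvPolynomial.C (M i 0 * M j 2 - M j 0 * M i 2) * linComb N f 2 := by
      rw [crossDiff, ← hM0, ← hM0, hf i, hf j]
      simp only [Fin.sum_univ_three, map_sub, map_mul]
      ring
    rw [this]
    exact dvd_add (Dvd.dvd.mul_left h1 _) (Dvd.dvd.mul_left h2 _)

/-- The multiplicity of the curve at `p` is the degree of the greatest common divisor `Γ` of the
cross differences at `p`. -/
theorem IsGoodParam.exists_gcd_crossDiff [IsAlgClosed K] [CharZero K] {n : ℕ}
    {f : Fin 3 → MvPolynomial (Fin 2) K} (hf : IsGoodParam n f) (hn : 2 ≤ n)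
    {F : MvPolynomial (Fin 3) K} (hFirr : Irreducible F) (hFhom : F.IsHomogeneous n)
    (hFf : MvPolynomial.aeval f F = 0) {p : Fin 3 → K} (hp : p ≠ 0) :
    multAt F p ≤ n - 1 ∧ ∃ Γ : MvPolynomial (Fin 2) K, Γ.IsHomogeneous (multAt F p) ∧ Γ ≠ 0 ∧
      (∀ i j : Fin 3, i < j → Γ ∣ crossDiff f p i j) ∧
      ∀ (k : ℕ) (g : MvPolynomial (Fin 2) K), k ≤ n → g.IsHomogeneous k →
        (∀ i j : Fin 3, i < j → g ∣ crossDiff f p i j) → g ∣ Γ := by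
  obtain ⟨M, N, hMN, hMp⟩ := exists_matrix_mulVec_eq hp
  have hf' := hf.linComb hMN
  set f' := _root_.linComb N f with hf'def
  obtain ⟨d, Γ, A, B, h1, h2, hAB, hd, hd1, hdn, hΓdeg, hΓ⟩ := hf'.exists_gcd hn
  have hF'irr := irreducible_linSub hMN hFirr
  have hF'hom := isHomogeneous_linSub M hFhom
  have hF'f : MvPolynomial.aeval f' (linSub M F) = 0 := by
    rw [aeval_linSub, hf'def, linComb_linComb, hMN, linComb_one, hFf]
  have hGdeh : dehom K (homForm (n - d) Γ) = Γ := dehom_homForm hΓdeg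
  have hGhom : (homForm (n - d) Γ).IsHomogeneous (n - d) := homForm_isHomogeneous _ _
  have hA : A.natDegree ≤ n - (n - d) := by omega
  have hB : B.natDegree ≤ n - (n - d) := by omega
  have hG1 : homForm (n - d) Γ ∣ f' 1 :=
    dvd_of_dehom_eq_mul (by omega) hGhom (hf'.homog 1) hA (by rw [hGdeh, h1])
  have hG2 : homForm (n - d) Γ ∣ f' 2 :=
    dvd_of_dehom_eq_mul (by omega) hGhom (hf'.homog 2) hB (by rw [hGdeh, h2])
  have hlow := hf'.le_degreeOf hF'hom hF'irr.ne_zero hF'f h1 h2 hAB hd hd1 hΓ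
  obtain ⟨H, hH0, hHf, hHdeg⟩ := exists_relation_of_dvd hf'.homog (by omega) hGhom hG1 hG2
  have hup := degreeOf_le_of_irreducible (fun R hR => hf'.algebraicIndependent hn hR) hF'irr hF'f
    hH0 hHf (by omega)
  have hmult : multAt F p = n - d := by
    rw [← hMp, ← multAt_linSub hMN, multAt_eq_sub_degreeOf hF'hom hF'irr.ne_zero]
    omega
  rw [hmult]
  refine ⟨by omega, homForm (n - d) Γ, hGhom, fun h => hΓ (by rw [← hGdeh, h, map_zero]),
    (dvd_crossDiff_iff hMN hp hMp f _).2 ⟨hG1, hG2⟩, fun k g hkn hg hgc => ?_⟩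
  obtain ⟨hg1, hg2⟩ := (dvd_crossDiff_iff hMN hp hMp f g).1 hgc
  obtain ⟨q₁, hq₁, he₁⟩ := exists_dehom_eq_mul_of_dvd hkn hg (hf'.homog 1) hg1
  obtain ⟨q₂, hq₂, he₂⟩ := exists_dehom_eq_mul_of_dvd hkn hg (hf'.homog 2) hg2
  obtain ⟨a, b, hab⟩ := hAB
  rw [h1] at he₁
  rw [h2] at he₂
  have hγ : Γ = dehom K g * (a * q₁ + b * q₂) := by
    linear_combination (-Γ) * hab + a * he₁ + b * he₂
  set γ := a * q₁ + b * q₂ with hγdef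
  have hg0 : dehom K g ≠ 0 := fun h => hΓ (by rw [hγ, h, zero_mul])
  have hγ0 : γ ≠ 0 := fun h => hΓ (by rw [hγ, h, mul_zero])
  have e₁ : q₁ = γ * A := mul_left_cancel₀ hg0 (by rw [← he₁, hγ]; ring)
  have e₂ : q₂ = γ * B := mul_left_cancel₀ hg0 (by rw [← he₂, hγ]; ring)
  have hdeg : γ.natDegree + d ≤ n - k := by
    rcases max_choice A.natDegree B.natDegree with h | h
    · have hA0 : A ≠ 0 := by
        rintro rfl
        simp at hd h
        omega
      rw [e₁, Polynomial.natDegree_mul hγ0 hA0] at hq₁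
      omega
    · have hB0 : B ≠ 0 := by
        rintro rfl
        simp at hd h
        omega
      rw [e₂, Polynomial.natDegree_mul hγ0 hB0] at hq₂
      omega
  exact dvd_of_dehom_eq_mul (by omega) hg hGhom (by omega : γ.natDegree ≤ n - d - k)
    (by rw [hGdeh, hγ])

end LinearChange

section SingularPoints

variable {K : Type*} [Field K]

theorem exists_isGcdOfCross_dvd_iff (f : Fin 3 → MvPolynomial (Fin 2) K) (p : Fin 3 → K)
    (g : MvPolynomial (Fin 2) K) :
    (∃ G, IsGcdOfCross f p G ∧ g ∣ G) ↔ ∀ i j : Fin 3, i < j → g ∣ crossDiff f p i j := by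
  refine ⟨fun ⟨G, hG, hgG⟩ i j hij => hgG.trans (hG.1 i j hij), fun h => ?_⟩
  let _ := UniqueFactorizationMonoid.toGCDMonoid (MvPolynomial (Fin 2) K)
  refine ⟨gcd (crossDiff f p 0 1) (gcd (crossDiff f p 0 2) (crossDiff f p 1 2)),
    ⟨fun i j hij => ?_, fun D hD => ?_⟩, ?_⟩
  · fin_cases i <;> fin_cases j <;> simp at hij ⊢
    · exact gcd_dvd_left _ _
    · exact (gcd_dvd_right _ _).trans (gcd_dvd_left _ _)
    · exact (gcd_dvd_right _ _).trans (gcd_dvd_right _ _)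
  · exact dvd_gcd (hD 0 1 (by decide)) (dvd_gcd (hD 0 2 (by decide)) (hD 1 2 (by decide)))
  · exact dvd_gcd (h 0 1 (by decide)) (dvd_gcd (h 0 2 (by decide)) (h 1 2 (by decide)))

theorem dvd_crossDiff_smul {f : Fin 3 → MvPolynomial (Fin 2) K} {p : Fin 3 → K}
    {g : MvPolynomial (Fin 2) K} (h : ∀ i j : Fin 3, i < j → g ∣ crossDiff f p i j) (c : K) :
    ∀ i j : Fin 3, i < j → g ∣ crossDiff f (c • p) i j := by
  intro i j hij
  have : crossDiff f (c • p) i j = MvPolynomial.C c * crossDiff f p i j := by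
    simp only [crossDiff, Pi.smul_apply, smul_eq_mul, map_mul]
    ring
  rw [this]
  exact Dvd.dvd.mul_left (h i j hij) _

/-- A root of a common divisor of the cross differences at `p` is mapped to `p`. -/
theorem exists_evalVec_eq_smul {f : Fin 3 → MvPolynomial (Fin 2) K}
    (hzero : ∀ v : Fin 2 → K, v ≠ 0 → evalVec f v ≠ 0) {p : Fin 3 → K} (hp : p ≠ 0)
    {g : MvPolynomial (Fin 2) K} (h : ∀ i j : Fin 3, i < j → g ∣ crossDiff f p i j)
    {v : Fin 2 → K} (hv : v ≠ 0) (hgv : MvPolynomial.eval v g = 0) :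
    ∃ c : K, c ≠ 0 ∧ evalVec f v = c • p := by
  obtain ⟨i, hi⟩ := Function.ne_iff.1 hp
  simp only [Pi.zero_apply] at hi
  have hev : evalVec f v = (evalVec f v i / p i) • p := by
    funext j
    have hd := map_dvd (MvPolynomial.eval v) (dvd_crossDiff_of_lt h i j)
    rw [hgv, zero_dvd_iff] at hd
    simp only [crossDiff, map_sub, map_mul, MvPolynomial.eval_C] at hd
    simp only [Pi.smul_apply, smul_eq_mul, evalVec]
    field_simp
    linear_combination hd
  refine ⟨_, fun h0 => hzero v hv ?_, hev⟩
  rw [hev, h0, zero_smul]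

theorem exists_smul_of_evalVec_eq {p q r : Fin 3 → K} {a b : K} (ha : a ≠ 0) (hb : b ≠ 0)
    (hp : r = a • p) (hq : r = b • q) : ∃ c : K, c ≠ 0 ∧ q = c • p := by
  refine ⟨b⁻¹ * a, mul_ne_zero (inv_ne_zero hb) ha, ?_⟩
  rw [mul_smul, ← hp, hq, inv_smul_smul₀ hb]

/-- Every nonzero form is, up to a scalar, the form attached to a point of projective space. -/
theorem exists_formOf_rep_eq {k : ℕ} {g : MvPolynomial (Fin 2) K} (hg : g.IsHomogeneous k)
    (hg0 : g ≠ 0) :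
    ∃ (x : Projectivization K (Fin (k + 1) → K)) (c : K), c ≠ 0 ∧
      formOf k x.rep = MvPolynomial.C c * g := by
  have hb : bcoeff k g ≠ 0 := by
    intro h
    apply hg0
    rw [eq_formOf_bcoeff hg, h]
    simp [formOf]
  obtain ⟨a, ha⟩ := Projectivization.exists_smul_eq_mk_rep K (bcoeff k g) hb
  refine ⟨Projectivization.mk K _ hb, a, a.ne_zero, ?_⟩
  rw [← ha, Units.smul_def, formOf_smul, ← eq_formOf_bcoeff hg]

theorem exists_eq_formOf_smul {k : ℕ} {x : Fin (k + 1) → K} {g : MvPolynomial (Fin 2) K}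
    (hg : g.IsHomogeneous k) (hd : formOf k x ∣ g) : ∃ a : K, g = formOf k (a • x) := by
  obtain ⟨q, hq, he⟩ :=
    exists_dehom_eq_mul_of_dvd le_rfl (formOf_isHomogeneous k x) hg hd
  rw [Nat.sub_self, Nat.le_zero] at hq
  refine ⟨q.coeff 0, eq_of_dehom_eq hg (formOf_isHomogeneous k _) ?_⟩
  rw [he, Polynomial.eq_C_of_natDegree_eq_zero hq, formOf_smul, map_mul, mul_comm]
  simp [dehom]

theorem eq_of_formOf_rep_dvd {k : ℕ} {x y : Projectivization K (Fin (k + 1) → K)}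
    {g : MvPolynomial (Fin 2) K} (hg : g.IsHomogeneous k) (hg0 : g ≠ 0)
    (hx : formOf k x.rep ∣ g) (hy : formOf k y.rep ∣ g) : x = y := by
  obtain ⟨a, ha⟩ := exists_eq_formOf_smul hg hx
  obtain ⟨b, hb⟩ := exists_eq_formOf_smul hg hy
  have hab : a • x.rep = b • y.rep := formOf_injective (ha.symm.trans hb)
  have ha0 : a ≠ 0 := by
    rintro rfl
    exact hg0 (by rw [ha, zero_smul]; simp [formOf])
  rw [← x.mk_rep, ← y.mk_rep, Projectivization.mk_eq_mk_iff']
  exact ⟨a⁻¹ * b, by rw [mul_smul, ← hab, inv_smul_smul₀ ha0]⟩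

end SingularPoints

/-- (1) `X_k(K)` is exactly the set of classes of degree-`k` homogeneous divisors of the
forms `G_P`, `P` ranging over the singular points of `C`; (2) for each such divisor the
singular point is unique, so `#X_k(K)` is the sum over singular points `P` of the number of
classes of degree-`k` divisors of `G_P`; (3) if `k₀` is the largest `k` with `X_k(K) ≠ ∅`,
then every singular point has multiplicity at most `k₀` and `[G] ↦ f(root of G)` is a
bijection from `X_{k₀}(K)` onto the singular points of multiplicity exactly `k₀`. -/
theorem statement_9 {K : Type*} [Field K] [IsAlgClosed K] [CharZero K]
    (n : ℕ) (hn : 3 ≤ n) (f : Fin 3 → MvPolynomial (Fin 2) K)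
    (hf : IsProperParam n f)
    (F : MvPolynomial (Fin 3) K) (hFirr : Irreducible F) (hFhom : F.IsHomogeneous n)
    (hFf : MvPolynomial.aeval f F = 0)
    (k : ℕ) (hk2 : 2 ≤ k) (hkn : k ≤ n - 1) :
    -- (1)
    (∀ x : Projectivization K (Fin (k + 1) → K),
      x ∈ XkSet n k f ↔
        ∃ p : Fin 3 → K, p ≠ 0 ∧ 2 ≤ multAt F p ∧
          ∃ G : MvPolynomial (Fin 2) K, IsGcdOfCross f p G ∧ formOf k x.rep ∣ G) ∧
    -- (2): uniqueness of the singular point attached to a point of X_k …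
    (∀ x ∈ XkSet n k f, ∀ p q : Fin 3 → K, p ≠ 0 → q ≠ 0 →
      2 ≤ multAt F p → 2 ≤ multAt F q →
      (∃ G : MvPolynomial (Fin 2) K, IsGcdOfCross f p G ∧ formOf k x.rep ∣ G) →
      (∃ G : MvPolynomial (Fin 2) K, IsGcdOfCross f q G ∧ formOf k x.rep ∣ G) →
      ∃ c : K, c ≠ 0 ∧ q = c • p) ∧
    -- … so X_k(K) is the disjoint union over singular points of the divisor classes:
    ((XkSet n k f).ncard =
      { q : Projectivization K (Fin 3 → K) × Projectivization K (Fin (k + 1) → K) |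
        2 ≤ multAt F q.1.rep ∧
        ∃ G : MvPolynomial (Fin 2) K, IsGcdOfCross f q.1.rep G ∧
          formOf k q.2.rep ∣ G }.ncard) ∧
    -- (3)
    (∀ k₀ : ℕ, 2 ≤ k₀ → k₀ ≤ n - 1 → (XkSet n k₀ f).Nonempty →
      (∀ k' : ℕ, k₀ < k' → k' ≤ n - 1 → XkSet n k' f = ∅) →
      -- every singular point has multiplicity at most k₀
      (∀ p : Fin 3 → K, p ≠ 0 → multAt F p ≤ k₀) ∧
      -- x ↦ f(any root of the corresponding form) is well defined on X_{k₀} …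
      (∀ x ∈ XkSet n k₀ f, ∀ v w : Fin 2 → K, v ≠ 0 → w ≠ 0 →
        MvPolynomial.eval v (formOf k₀ x.rep) = 0 →
        MvPolynomial.eval w (formOf k₀ x.rep) = 0 →
        ∃ c : K, c ≠ 0 ∧ evalVec f w = c • evalVec f v) ∧
      -- … takes values in the singular points of multiplicity exactly k₀ …
      (∀ x ∈ XkSet n k₀ f, ∀ v : Fin 2 → K, v ≠ 0 →
        MvPolynomial.eval v (formOf k₀ x.rep) = 0 → multAt F (evalVec f v) = k₀) ∧
      -- … is injective …
      (∀ x ∈ XkSet n k₀ f, ∀ y ∈ XkSet n k₀ f, ∀ v w : Fin 2 → K, v ≠ 0 → w ≠ 0 →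
        MvPolynomial.eval v (formOf k₀ x.rep) = 0 →
        MvPolynomial.eval w (formOf k₀ y.rep) = 0 →
        (∃ c : K, c ≠ 0 ∧ evalVec f w = c • evalVec f v) → x = y) ∧
      -- … and surjective onto the singular points of multiplicity exactly k₀.
      (∀ p : Fin 3 → K, p ≠ 0 → multAt F p = k₀ →
        ∃ x ∈ XkSet n k₀ f, ∃ v : Fin 2 → K, v ≠ 0 ∧
          MvPolynomial.eval v (formOf k₀ x.rep) = 0 ∧
          ∃ c : K, c ≠ 0 ∧ evalVec f v = c • p)) := by
  have hgood := hf.isGoodParam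
  have hkey := fun (p : Fin 3 → K) (hp : p ≠ 0) =>
    hgood.exists_gcd_crossDiff (by omega) hFirr hFhom hFf hp
  have hle : ∀ (l : ℕ) (g : MvPolynomial (Fin 2) K) (p : Fin 3 → K), p ≠ 0 → l ≤ n →
      g.IsHomogeneous l → (∀ i j : Fin 3, i < j → g ∣ crossDiff f p i j) → l ≤ multAt F p := by
    intro l g p hp hln hg h
    obtain ⟨-, Γ, hΓ, hΓ0, -, hmax⟩ := hkey p hp
    exact le_of_dvd_of_isHomogeneous hg hΓ hΓ0 (hmax l g hln hg h)
  have hmem := fun (l : ℕ) (hl : 2 ≤ l) (hln : l ≤ n - 1) =>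
    mem_XkSet_iff (K := K) (by omega : 1 ≤ l) (by omega : l ≤ n) hf.homog hf.no_common_zero
  have huniq : ∀ (x : Projectivization K (Fin (k + 1) → K)) (p q : Fin 3 → K), p ≠ 0 → q ≠ 0 →
      (∀ i j : Fin 3, i < j → formOf k x.rep ∣ crossDiff f p i j) →
      (∀ i j : Fin 3, i < j → formOf k x.rep ∣ crossDiff f q i j) →
      ∃ c : K, c ≠ 0 ∧ q = c • p := by
    intro x p q hp hq hxp hxq
    obtain ⟨v, hv, hxv⟩ := exists_root_of_isHomogeneous (by omega : 1 ≤ k)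
      (formOf_isHomogeneous k x.rep)
    obtain ⟨a, ha, hap⟩ := exists_evalVec_eq_smul hf.no_common_zero hp hxp hv hxv
    obtain ⟨b, hb, hbq⟩ := exists_evalVec_eq_smul hf.no_common_zero hq hxq hv hxv
    exact exists_smul_of_evalVec_eq ha hb hap hbq
  simp only [exists_isGcdOfCross_dvd_iff]
  refine ⟨fun x => ?_, ?_, ?_, ?_⟩
  · rw [hmem k hk2 hkn]
    constructor
    · rintro ⟨p, hp, h⟩
      exact ⟨p, hp, hk2.trans (hle k _ p hp (by omega) (formOf_isHomogeneous k _) h), h⟩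
    · rintro ⟨p, hp, -, h⟩
      exact ⟨p, hp, h⟩
  · exact fun x _ p q hp hq _ _ hxp hxq => huniq x p q hp hq hxp hxq
  · rw [← Set.InjOn.ncard_image (f := Prod.snd)]
    · congr 1
      ext x
      rw [hmem k hk2 hkn, Set.mem_image]
      constructor
      · rintro ⟨p, hp, h⟩
        obtain ⟨a, ha⟩ := Projectivization.exists_smul_eq_mk_rep K p hp
        have h' : ∀ i j : Fin 3, i < j →
            formOf k x.rep ∣ crossDiff f (Projectivization.mk K p hp).rep i j := by
          rw [← ha, Units.smul_def]
          exact dvd_crossDiff_smul h _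
        exact ⟨(Projectivization.mk K p hp, x), ⟨hk2.trans (hle k _ _
          (Projectivization.rep_nonzero _) (by omega) (formOf_isHomogeneous k _) h'), h'⟩, rfl⟩
      · rintro ⟨⟨P, y⟩, ⟨-, h⟩, rfl⟩
        exact ⟨P.rep, P.rep_nonzero, h⟩
    · rintro ⟨P, x⟩ ⟨-, hP⟩ ⟨Q, y⟩ ⟨-, hQ⟩ hxy
      obtain rfl : x = y := hxy
      obtain ⟨c, hc, hcq⟩ := huniq x P.rep Q.rep P.rep_nonzero Q.rep_nonzero hP hQ
      have : Q = P := by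
        rw [← P.mk_rep, ← Q.mk_rep, Projectivization.mk_eq_mk_iff']
        exact ⟨c, hcq.symm⟩
      rw [this]
  · intro k₀ hk₀ hk₀n _ hmaxk
    have hpoint : ∀ p : Fin 3 → K, p ≠ 0 → 2 ≤ multAt F p →
        ∃ x ∈ XkSet n (multAt F p) f, ∀ i j : Fin 3, i < j →
          formOf (multAt F p) x.rep ∣ crossDiff f p i j := by
      intro p hp h2
      obtain ⟨hn1, Γ, hΓ, hΓ0, hdvd, -⟩ := hkey p hp
      obtain ⟨x, c, hc, hx⟩ := exists_formOf_rep_eq hΓ hΓ0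
      have hu : IsUnit (MvPolynomial.C (σ := Fin 2) c) := (IsUnit.mk0 _ hc).map _
      have hcross : ∀ i j : Fin 3, i < j →
          formOf (multAt F p) x.rep ∣ crossDiff f p i j := by
        intro i j hij
        rw [hx, hu.mul_left_dvd]
        exact hdvd i j hij
      exact ⟨x, (hmem _ h2 hn1 x).2 ⟨p, hp, hcross⟩, hcross⟩
    have hbound : ∀ p : Fin 3 → K, p ≠ 0 → multAt F p ≤ k₀ := by
      intro p hp
      by_contra! hlt
      obtain ⟨x, hx, -⟩ := hpoint p hp (by omega)
      rw [hmaxk _ hlt (hkey p hp).1] at hx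
      exact hx
    have hval : ∀ x ∈ XkSet n k₀ f, ∀ v : Fin 2 → K, v ≠ 0 →
        MvPolynomial.eval v (formOf k₀ x.rep) = 0 →
        ∀ i j : Fin 3, i < j → formOf k₀ x.rep ∣ crossDiff f (evalVec f v) i j := by
      intro x hx v hv hxv
      obtain ⟨p, hp, h⟩ := (hmem k₀ hk₀ hk₀n x).1 hx
      obtain ⟨c, -, hcp⟩ := exists_evalVec_eq_smul hf.no_common_zero hp h hv hxv
      rw [hcp]
      exact dvd_crossDiff_smul h c
    have hmult : ∀ x ∈ XkSet n k₀ f, ∀ v : Fin 2 → K, v ≠ 0 →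
        MvPolynomial.eval v (formOf k₀ x.rep) = 0 → multAt F (evalVec f v) = k₀ := by
      intro x hx v hv hxv
      have hv' := hf.no_common_zero v hv
      exact le_antisymm (hbound _ hv') (hle k₀ _ _ hv' (by omega) (formOf_isHomogeneous k₀ _)
        (hval x hx v hv hxv))
    refine ⟨hbound, ?_, hmult, ?_, ?_⟩
    · intro x hx v w hv hw hxv hxw
      exact exists_evalVec_eq_smul hf.no_common_zero (hf.no_common_zero v hv)
        (hval x hx v hv hxv) hw hxw
    · rintro x hx y hy v w hv hw hxv hyw ⟨c, hc, hcw⟩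
      obtain ⟨-, Γ, hΓ, hΓ0, -, hmax⟩ := hkey _ (hf.no_common_zero w hw)
      rw [hmult y hy w hw hyw] at hΓ
      refine eq_of_formOf_rep_dvd hΓ hΓ0
        (hmax k₀ _ (by omega) (formOf_isHomogeneous k₀ _) ?_)
        (hmax k₀ _ (by omega) (formOf_isHomogeneous k₀ _) (hval y hy w hw hyw))
      rw [hcw]
      exact dvd_crossDiff_smul (hval x hx v hv hxv) c
    · rintro p hp rfl
      obtain ⟨x, hx, h⟩ := hpoint p hp hk₀
      obtain ⟨v, hv, hxv⟩ := exists_root_of_isHomogeneous (by omega : 1 ≤ multAt F p)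
        (formOf_isHomogeneous _ x.rep)
      exact ⟨x, hx, v, hv, hxv, exists_evalVec_eq_smul hf.no_common_zero hp h hv hxv⟩

end
end

section
/- For every v ∈ ℙ¹(K), the point f(v) is a singular point of C (i.e., m_{f(v)}(C) ≥ 2) if and only if there exists a class [G] ∈ X_2(K) with G(v) = 0; consequently the preimage under f of the singular locus of C is exactly the set of roots of the binary quadratic forms parameterized by X_2(K). -/
open MvPolynomial

noncomputable section

section Homogeneous

variable {σ K : Type*} [Field K]

theorem homogeneousComponent_mul_of_isHomogeneous {L h : MvPolynomial σ K} {k m : ℕ}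
    (hL : L.IsHomogeneous k) :
    homogeneousComponent (k + m) (L * h) = L * homogeneousComponent m h := by
  let _ : GradedAlgebra (homogeneousSubmodule σ K) := gradedAlgebra
  have := DirectSum.coe_decompose_mul_add_of_left_mem (homogeneousSubmodule σ K)
    (i := k) (j := m) (a := L) (b := h) hL
  rw [← decomposition.decompose'_apply, ← decomposition.decompose'_apply]
  exact this

theorem exists_isHomogeneous_quotient {L h : MvPolynomial σ K} {k m : ℕ}
    (hL : L.IsHomogeneous k) (hh : h.IsHomogeneous (k + m)) (hd : L ∣ h) :
    ∃ q : MvPolynomial σ K, q.IsHomogeneous m ∧ h = L * q := by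
  obtain ⟨q, rfl⟩ := hd
  refine ⟨homogeneousComponent m q, homogeneousComponent_isHomogeneous _ _, ?_⟩
  rw [← homogeneousComponent_mul_of_isHomogeneous hL, homogeneousComponent_eq_self hh]

theorem aeval_smul_point {A : MvPolynomial σ K} {d : ℕ} (hA : A.IsHomogeneous d)
    {S : Type*} [CommRing S] [Algebra K S] (p : σ → K) (x : S) :
    aeval (fun i => algebraMap K S (p i) * x) A = algebraMap K S (eval p A) * x ^ d := by
  rw [aeval_def, eval₂_eq, eval_eq, map_sum, Finset.sum_mul]
  refine Finset.sum_congr rfl fun e he => ?_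
  have hdeg : ∑ i ∈ e.support, e i = d := (hA.degree_eq_sum_deg_support he).symm
  simp only [mul_pow, Finset.prod_mul_distrib, Finset.prod_pow_eq_pow_sum, hdeg, map_mul,
    map_prod, map_pow]
  ring

theorem sub_eval_mul_pow_mem {A : MvPolynomial σ K} {d : ℕ} (hA : A.IsHomogeneous d)
    (p : σ → K) (x : MvPolynomial σ K) (I : Ideal (MvPolynomial σ K))
    (hI : ∀ i, X i - C (p i) * x ∈ I) : A - C (eval p A) * x ^ d ∈ I := by
  have h1 : A = aeval X A := by simp
  have h2 := aeval_smul_point hA p (Ideal.Quotient.mkₐ K I x)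
  rw [← Ideal.Quotient.eq]
  change Ideal.Quotient.mkₐ K I _ = Ideal.Quotient.mkₐ K I _
  conv_lhs => rw [h1]
  rw [comp_aeval_apply, map_mul, map_pow, ← MvPolynomial.algebraMap_eq, AlgHom.commutes, ← h2]
  congr 2
  funext i
  rw [← AlgHom.commutes (Ideal.Quotient.mkₐ K I), ← map_mul]
  exact Ideal.Quotient.eq.2 (hI i)

/-- First order Taylor expansion of a polynomial along `x ↦ p x`, modulo the square of an
ideal containing all `X i - p i x`. -/
theorem taylor_mem_sq [Fintype σ] (A : MvPolynomial σ K) (p : σ → K) (x : MvPolynomial σ K)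
    (I : Ideal (MvPolynomial σ K)) (hI : ∀ i, X i - C (p i) * x ∈ I) :
    A - (aeval (fun i => C (p i) * x) A +
      ∑ i, aeval (fun i => C (p i) * x) (pderiv i A) * (X i - C (p i) * x)) ∈ I ^ 2 := by
  classical
  induction A using MvPolynomial.induction_on with
  | C a => simp
  | add A B hA hB =>
    convert add_mem hA hB using 1
    simp only [map_add, add_mul, Finset.sum_add_distrib]
    ring
  | mul_X A j hA =>
    have h2 : (∑ i, aeval (fun i => C (p i) * x) (pderiv i A) * (X i - C (p i) * x)) *
        (X j - C (p j) * x) ∈ I ^ 2 := by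
      rw [pow_two]
      exact Ideal.mul_mem_mul (sum_mem fun i _ => I.mul_mem_left _ (hI i)) (hI j)
    convert add_mem (Ideal.mul_mem_left _ (X j) hA) h2 using 1
    have h3 : ∑ i, aeval (fun i => C (p i) * x) (pderiv i (A * X j)) * (X i - C (p i) * x) =
        aeval (fun i => C (p i) * x) A * (X j - C (p j) * x) + C (p j) * x *
        ∑ i, aeval (fun i => C (p i) * x) (pderiv i A) * (X i - C (p i) * x) := by
      rw [Finset.mul_sum, ← Finset.sum_erase_add _ _ (Finset.mem_univ j),
        ← Finset.sum_erase_add (a := j) (f := fun i => C (p j) * x * _) _ (Finset.mem_univ j)]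
      have : ∑ i ∈ Finset.univ.erase j,
          aeval (fun i => C (p i) * x) (pderiv i (A * X j)) * (X i - C (p i) * x) =
          ∑ i ∈ Finset.univ.erase j, C (p j) * x *
            (aeval (fun i => C (p i) * x) (pderiv i A) * (X i - C (p i) * x)) := by
        refine Finset.sum_congr rfl fun i hi => ?_
        rw [Derivation.leibniz, pderiv_X_of_ne (Finset.ne_of_mem_erase hi).symm]
        simp
        ring
      rw [this, Derivation.leibniz, pderiv_X_self]
      simp
      ring
    rw [h3, map_mul, aeval_X]
    ring

theorem homogeneousComponent_aeval {τ : Type*} {n : ℕ} (hn : n ≠ 0) {f : σ → MvPolynomial τ K}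
    (hf : ∀ i, (f i).IsHomogeneous n) (A : MvPolynomial σ K) (d : ℕ) :
    homogeneousComponent (n * d) (aeval f A) = aeval f (homogeneousComponent d A) := by
  conv_lhs => rw [← sum_homogeneousComponent A, map_sum, map_sum]
  have h : ∀ i, homogeneousComponent (n * d) (aeval f (homogeneousComponent i A)) =
      if i = d then aeval f (homogeneousComponent d A) else 0 := by
    intro i
    rw [homogeneousComponent_of_mem
      ((homogeneousComponent_isHomogeneous i A).aeval f hf)]
    by_cases hid : i = d
    · simp [hid]
    · rw [if_neg, if_neg hid]
      intro h
      exact hid (Nat.eq_of_mul_eq_mul_left (Nat.pos_of_ne_zero hn) h).symm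
  simp only [h, Finset.sum_ite_eq', Finset.mem_range]
  split_ifs with hlt
  · rfl
  · rw [homogeneousComponent_eq_zero _ _ (by omega), map_zero]

end Homogeneous

section BinaryForms

variable {K : Type*} [Field K]

theorem linFormOf_isHomogeneous (v : Fin 2 → K) : (linFormOf v).IsHomogeneous 1 :=
  (isHomogeneous_C_mul_X _ _).sub (isHomogeneous_C_mul_X _ _)

theorem eval_linFormOf (v w : Fin 2 → K) : eval w (linFormOf v) = v 1 * w 0 - v 0 * w 1 := by
  simp [linFormOf]

theorem eval_linFormOf_self (v : Fin 2 → K) : eval v (linFormOf v) = 0 := by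
  rw [eval_linFormOf]; ring

theorem linFormOf_ne_zero {v : Fin 2 → K} (hv : v ≠ 0) : linFormOf v ≠ 0 := by
  intro h
  apply hv
  have h0 := eval_linFormOf v ![1, 0]
  have h1 := eval_linFormOf v ![0, 1]
  rw [h] at h0 h1
  funext i
  fin_cases i
  · simpa using h1.symm
  · simpa using h0.symm

theorem exists_sum_mul_eq_one {ι : Type*} [Fintype ι] {p : ι → K} (hp : p ≠ 0) :
    ∃ a : ι → K, ∑ i, a i * p i = 1 := by
  classical
  obtain ⟨j, hj⟩ := Function.ne_iff.1 hp
  refine ⟨Pi.single j (p j)⁻¹, ?_⟩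
  rw [Finset.sum_eq_single j] <;> simp_all

theorem linFormOf_dvd {v : Fin 2 → K} (hv : v ≠ 0) {h : MvPolynomial (Fin 2) K} {d : ℕ}
    (hh : h.IsHomogeneous d) (h0 : eval v h = 0) : linFormOf v ∣ h := by
  obtain ⟨a, ha⟩ := exists_sum_mul_eq_one hv
  rw [Fin.sum_univ_two] at ha
  have haC : (C (a 0) * C (v 0) + C (a 1) * C (v 1) : MvPolynomial (Fin 2) K) = 1 := by
    rw [← C_mul, ← C_mul, ← C_add, ha, C_1]
  have := sub_eval_mul_pow_mem hh v (C (a 0) * X 0 + C (a 1) * X 1) (Ideal.span {linFormOf v}) ?_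
  · rwa [h0, C_0, zero_mul, sub_zero, Ideal.mem_span_singleton] at this
  · intro i
    rw [Ideal.mem_span_singleton]
    fin_cases i
    · refine ⟨C (a 1), ?_⟩
      simp only [linFormOf, Fin.zero_eta]
      linear_combination (-X 0 : MvPolynomial (Fin 2) K) * haC
    · refine ⟨-C (a 0), ?_⟩
      simp only [linFormOf, Fin.mk_one]
      linear_combination (-X 1 : MvPolynomial (Fin 2) K) * haC

theorem exists_linFormOf_mul_eq {v : Fin 2 → K} (hv : v ≠ 0) {h : MvPolynomial (Fin 2) K} {d : ℕ}
    (hh : h.IsHomogeneous (d + 1)) (h0 : eval v h = 0) :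
    ∃ q : MvPolynomial (Fin 2) K, q.IsHomogeneous d ∧ h = linFormOf v * q :=
  exists_isHomogeneous_quotient (linFormOf_isHomogeneous v) (by rwa [add_comm])
    (linFormOf_dvd hv hh h0)

theorem prime_linFormOf {v : Fin 2 → K} (hv : v ≠ 0) : Prime (linFormOf v) := by
  rw [← irreducible_iff_prime]
  have hne := linFormOf_ne_zero hv
  refine irreducible_of_totalDegree_eq_one ((linFormOf_isHomogeneous v).totalDegree hne) ?_
  intro x hx
  rw [isUnit_iff_ne_zero]
  rintro rfl
  exact hne (MvPolynomial.ext _ _ fun i => by simpa using hx i)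

theorem exists_forall_isHomogeneous_eq_sum [IsAlgClosed K] {ι : Type*} [Fintype ι]
    {g : ι → MvPolynomial (Fin 2) K} {m : ℕ} (hg : ∀ i, (g i).IsHomogeneous m)
    (h0 : ∀ w : Fin 2 → K, (∀ i, eval w (g i) = 0) → w = 0) :
    ∃ E : ℕ, ∀ e, E ≤ e → ∀ h : MvPolynomial (Fin 2) K, h.IsHomogeneous (m + e) →
      ∃ q : ι → MvPolynomial (Fin 2) K, (∀ i, (q i).IsHomogeneous e) ∧ h = ∑ i, g i * q i := by
  set J : Ideal (MvPolynomial (Fin 2) K) := Ideal.span (Set.range g) with hJ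
  have hrad : ∀ i : Fin 2, (X i : MvPolynomial (Fin 2) K) ∈ J.radical := by
    intro i
    rw [← vanishingIdeal_zeroLocus_eq_radical (K := K)]
    intro w hw
    have : w = 0 := h0 w fun j => by
      simpa [aeval_eq_eval] using hw (g j) (Ideal.subset_span ⟨j, rfl⟩)
    simp [this]
  obtain ⟨a, ha⟩ := hrad 0
  obtain ⟨b, hb⟩ := hrad 1
  refine ⟨a + b, fun e he h hh => ?_⟩
  have hmem : h ∈ J := by
    rw [h.as_sum]
    refine sum_mem fun d hd => ?_
    have hdeg := hh.degree_eq_sum_deg_support hd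
    rw [Finset.sum_subset (Finset.subset_univ _) (by simp), Fin.sum_univ_two] at hdeg
    rw [monomial_eq, Finsupp.prod_fintype _ _ (by simp), Fin.prod_univ_two]
    refine J.mul_mem_left _ ?_
    rcases le_or_gt a (d 0) with h1 | h1
    · exact J.mul_mem_right _ (J.pow_mem_of_pow_mem ha h1)
    · exact J.mul_mem_left _ (J.pow_mem_of_pow_mem hb (by omega))
  obtain ⟨c, hc⟩ := Ideal.mem_span_range_iff_exists_fun.1 hmem
  refine ⟨fun i => homogeneousComponent e (c i), fun i => homogeneousComponent_isHomogeneous _ _,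
    ?_⟩
  rw [← homogeneousComponent_eq_self hh, ← hc, map_sum]
  refine Finset.sum_congr rfl fun i _ => ?_
  rw [mul_comm (c i), homogeneousComponent_mul_of_isHomogeneous (hg i)]

theorem aeval_isIntegral [IsAlgClosed K] {ι : Type*} [Fintype ι]
    {f : ι → MvPolynomial (Fin 2) K} {n : ℕ} (hn : n ≠ 0) (hf : ∀ i, (f i).IsHomogeneous n)
    (h0 : ∀ w : Fin 2 → K, (∀ i, eval w (f i) = 0) → w = 0) :
    (aeval f : MvPolynomial ι K →ₐ[K] MvPolynomial (Fin 2) K).toRingHom.IsIntegral := by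
  obtain ⟨E, hE⟩ := exists_forall_isHomogeneous_eq_sum hf h0
  set φ := (aeval f : MvPolynomial ι K →ₐ[K] MvPolynomial (Fin 2) K) with hφ
  refine RingHom.Finite.to_isIntegral ?_
  let := φ.toRingHom.toAlgebra
  have hsmul : ∀ (A : MvPolynomial ι K) (h : MvPolynomial (Fin 2) K), A • h = φ A * h :=
    fun A h => Algebra.smul_def A h
  have hfin : {d : Fin 2 →₀ ℕ | d.degree ≤ n + E}.Finite := Finsupp.finite_of_degree_le _
  set T : Set (MvPolynomial (Fin 2) K) := (fun d => monomial d 1) '' {d | d.degree ≤ n + E}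
  have key : ∀ e, ∀ h : MvPolynomial (Fin 2) K, h.IsHomogeneous e →
      h ∈ Submodule.span (MvPolynomial ι K) T := by
    intro e
    induction e using Nat.strong_induction_on with
    | _ e ih =>
      intro h hh
      rcases le_or_gt e (n + E) with he | he
      · rw [h.as_sum]
        refine sum_mem fun d hd => ?_
        have : monomial d (coeff d h) =
            (C (coeff d h) : MvPolynomial ι K) • (monomial d 1 : MvPolynomial (Fin 2) K) := by
          rw [hsmul, hφ, aeval_C, algebraMap_eq, C_mul_monomial, mul_one]
        rw [this]
        refine Submodule.smul_mem _ _ (Submodule.subset_span ⟨d, ?_, rfl⟩)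
        have := hh.degree_eq_sum_deg_support hd
        simp only [Set.mem_ofPred_eq, Finsupp.degree_apply]
        omega
      · obtain ⟨q, hq, rfl⟩ := hE (e - n) (by omega) h (by convert hh; omega)
        refine sum_mem fun i _ => ?_
        have : f i * q i = (X i : MvPolynomial ι K) • q i := by rw [hsmul, hφ, aeval_X]
        rw [this]
        exact Submodule.smul_mem _ _ (ih (e - n) (by omega) _ (hq i))
  refine ⟨⟨(hfin.image fun d => (monomial d 1 : MvPolynomial (Fin 2) K)).toFinset, ?_⟩⟩
  rw [Set.Finite.coe_toFinset, eq_top_iff]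
  rintro h -
  rw [← sum_homogeneousComponent h]
  exact sum_mem fun e _ => key e _ (homogeneousComponent_isHomogeneous _ _)

theorem ringKrullDim_le_of_isIntegral {R S : Type*} [CommRing R] [CommRing S] (φ : R →+* S)
    (hφ : φ.IsIntegral) : ringKrullDim S ≤ ringKrullDim R := by
  let := φ.toAlgebra
  have : Algebra.IsIntegral R S := ⟨hφ⟩
  refine Order.krullDim_le_of_strictMono (PrimeSpectrum.comap φ) fun P Q h => ?_
  exact Ideal.IsIntegral.comap_lt_comap (show P.asIdeal < Q.asIdeal from h)

theorem ringKrullDim_add_one_add_one_le {R S : Type*} [CommRing R] [IsDomain R] [CommRing S]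
    (φ : R →+* S) (hφ : φ.IsIntegral) {F A : R} (hF : Prime F) (hFφ : φ F = 0) (hAφ : φ A = 0)
    (hFA : ¬ F ∣ A) : ringKrullDim S + 1 + 1 ≤ ringKrullDim R := by
  set I : Ideal R := Ideal.span {F}
  have : I.IsPrime := (Ideal.span_singleton_prime hF.ne_zero).2 hF
  set a := Ideal.Quotient.mk I A
  have ha : a ≠ 0 := by
    rwa [Ne, Ideal.Quotient.eq_zero_iff_mem, Ideal.mem_span_singleton]
  have hRI := ringKrullDim_quotient_succ_le_of_nonZeroDivisor
    (mem_nonZeroDivisors_of_ne_zero hF.ne_zero)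
  have hRIa := ringKrullDim_quotient_succ_le_of_nonZeroDivisor (mem_nonZeroDivisors_of_ne_zero ha)
  let ψ : R ⧸ I →+* S := Ideal.Quotient.lift I φ (by
    intro b hb
    obtain ⟨c, rfl⟩ := Ideal.mem_span_singleton.1 hb
    rw [map_mul, hFφ, zero_mul])
  let χ : (R ⧸ I) ⧸ Ideal.span {a} →+* S := Ideal.Quotient.lift _ ψ (by
    intro b hb
    obtain ⟨c, rfl⟩ := Ideal.mem_span_singleton.1 hb
    have : ψ a = 0 := hAφ
    rw [map_mul, this, zero_mul])
  have hχ : χ.IsIntegral := by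
    have hcomp : φ = χ.comp ((Ideal.Quotient.mk (Ideal.span {a})).comp (Ideal.Quotient.mk I)) := rfl
    rw [hcomp] at hφ
    exact hφ.tower_top _ _
  refine le_trans ?_ hRI
  gcongr
  refine le_trans ?_ hRIa
  gcongr
  exact ringKrullDim_le_of_isIntegral χ hχ

/-- The implicit equation generates the kernel of the parameterization. -/
theorem dvd_of_aeval_eq_zero [IsAlgClosed K] {f : Fin 3 → MvPolynomial (Fin 2) K} {n : ℕ}
    (hn : n ≠ 0) (hf : ∀ i, (f i).IsHomogeneous n)
    (h0 : ∀ w : Fin 2 → K, (∀ i, eval w (f i) = 0) → w = 0)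
    {F : MvPolynomial (Fin 3) K} (hF : Irreducible F) (hFf : aeval f F = 0)
    {A : MvPolynomial (Fin 3) K} (hA : aeval f A = 0) : F ∣ A := by
  by_contra hdvd
  have h := ringKrullDim_add_one_add_one_le _ (aeval_isIntegral hn hf h0)
    (irreducible_iff_prime.1 hF) hFf hA hdvd
  rw [MvPolynomial.ringKrullDim_of_isNoetherianRing, MvPolynomial.ringKrullDim_of_isNoetherianRing,
    ringKrullDim_eq_zero_of_field, Nat.card_fin, Nat.card_fin, zero_add, zero_add] at h
  norm_cast at h

end BinaryForms

section Minors

variable {K : Type*} [Field K]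

theorem exists_mulVec_eq_zero_of_minors {a b N : ℕ} (hN : N = b) (M : Matrix (Fin a) (Fin b) K)
    (h : ∀ (r : Fin N → Fin a) (c : Fin N → Fin b), Function.Injective r → Function.Injective c →
      (M.submatrix r c).det = 0) : ∃ y : Fin b → K, y ≠ 0 ∧ M.mulVec y = 0 := by
  subst hN
  by_contra! hy
  have hinj : Function.Injective M.mulVecLin := by
    rw [← LinearMap.ker_eq_bot, LinearMap.ker_eq_bot']
    intro y hy0
    by_contra hne
    exact hy y hne hy0
  have hrank : M.rank = N := by
    rw [Matrix.rank, LinearMap.finrank_range_of_inj hinj, Module.finrank_fin_fun]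
  obtain ⟨κ, r, hr, hspan, hli⟩ := exists_linearIndependent' K M.row
  have hfin : Finite κ := Finite.of_injective r hr
  have := Fintype.ofFinite κ
  have hcard : Fintype.card κ = N := by
    rw [← hrank, Matrix.rank_eq_finrank_span_row, ← hspan, finrank_span_eq_card hli]
  let e : Fin N ≃ κ := (finCongr hcard.symm).trans (Fintype.equivFin κ).symm
  have hdet := h (r ∘ e) id (hr.comp e.injective) Function.injective_id
  have hunit : IsUnit (M.submatrix (r ∘ e) id) := by
    rw [← Matrix.linearIndependent_rows_iff_isUnit]
    exact hli.comp e e.injective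
  rw [Matrix.isUnit_iff_isUnit_det, hdet] at hunit
  exact not_isUnit_zero hunit

theorem minors_eq_zero_of_mulVec_eq_zero {a b N : ℕ} (hN : N = b) (M : Matrix (Fin a) (Fin b) K)
    {y : Fin b → K} (hy : y ≠ 0) (hM : M.mulVec y = 0) (r : Fin N → Fin a) (c : Fin N → Fin b)
    (hc : Function.Injective c) : (M.submatrix r c).det = 0 := by
  subst hN
  rw [← Matrix.exists_mulVec_eq_zero_iff]
  let e : Fin N ≃ Fin N := Equiv.ofBijective c (Finite.injective_iff_bijective.1 hc)
  refine ⟨y ∘ e, fun h => hy ?_, ?_⟩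
  · funext i
    simpa using congrFun h (e.symm i)
  · have := Matrix.submatrix_mulVec_equiv M (y ∘ e) r e
    rw [show M.submatrix r c = M.submatrix r e from rfl, this, Function.comp_assoc,
      Equiv.self_comp_symm, Function.comp_id, hM]
    rfl

/-- The linear functional on binary forms of degree `n` with values `y` on the monomials. -/
def coeffFunctional (n : ℕ) (y : Fin (n + 1) → K) : MvPolynomial (Fin 2) K →ₗ[K] K where
  toFun h := ∑ i, bcoeff n h i * y i
  map_add' g h := by simp [bcoeff, add_mul, Finset.sum_add_distrib]
  map_smul' a h := by simp [bcoeff, Finset.mul_sum, mul_assoc]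

theorem coeffFunctional_apply (n : ℕ) (y : Fin (n + 1) → K) (h : MvPolynomial (Fin 2) K) :
    coeffFunctional n y h = ∑ i, bcoeff n h i * y i := rfl

theorem bcoeff_C_mul_X_pow (n : ℕ) (a : K) {i j : ℕ} (hij : i + j = n) (c : Fin (n + 1)) :
    bcoeff n (C a * X 0 ^ i * X 1 ^ j) c = if j = (c : ℕ) then a else 0 := by
  have h : (C a * X 0 ^ i * X 1 ^ j : MvPolynomial (Fin 2) K) =
      monomial (Finsupp.single 0 i + Finsupp.single 1 j) a := by
    rw [X_pow_eq_monomial, X_pow_eq_monomial, C_mul_monomial, monomial_mul]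
    simp
  rw [h, bcoeff, coeff_monomial]
  refine if_congr ⟨fun h => ?_, fun h => ?_⟩ rfl rfl
  · simpa using DFunLike.congr_fun h 1
  · have := c.isLt
    rw [h, show i = n - c by omega]

theorem coeffFunctional_C_mul_X_pow (n : ℕ) (y : Fin (n + 1) → K) (a : K) {i j : ℕ}
    (hij : i + j = n) :
    coeffFunctional n y (C a * X 0 ^ i * X 1 ^ j) = a * y ⟨j, by omega⟩ := by
  rw [coeffFunctional_apply]
  rw [Finset.sum_eq_single ⟨j, by omega⟩]
  · rw [bcoeff_C_mul_X_pow n a hij, if_pos rfl]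
  · intro c _ hc
    rw [bcoeff_C_mul_X_pow n a hij, if_neg (fun h => hc (Fin.ext h.symm)), zero_mul]
  · simp

theorem isHomogeneous_eq_sum {n : ℕ} {h : MvPolynomial (Fin 2) K} (hh : h.IsHomogeneous n) :
    h = ∑ i : Fin (n + 1), C (bcoeff n h i) * X 0 ^ (n - (i : ℕ)) * X 1 ^ (i : ℕ) := by
  ext d
  rw [coeff_sum]
  have hmon : ∀ i : Fin (n + 1),
      (C (bcoeff n h i) * X 0 ^ (n - (i : ℕ)) * X 1 ^ (i : ℕ) : MvPolynomial (Fin 2) K) =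
      monomial (Finsupp.single 0 (n - (i : ℕ)) + Finsupp.single 1 (i : ℕ)) (bcoeff n h i) := by
    intro i
    rw [X_pow_eq_monomial, X_pow_eq_monomial, C_mul_monomial, monomial_mul]
    simp
  simp only [hmon, coeff_monomial]
  by_cases hd : d.degree = n
  · have hd2 : d 0 + d 1 = n := by
      rw [← hd, Finsupp.degree_eq_sum, Fin.sum_univ_two]
    have hdd : Finsupp.single 0 (n - d 1) + Finsupp.single 1 (d 1) = d := by
      ext i
      fin_cases i
      · simp; omega
      · simp
    rw [Finset.sum_eq_single ⟨d 1, by omega⟩]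
    · rw [if_pos hdd, bcoeff, hdd]
    · intro i _ hi
      rw [if_neg]
      rintro rfl
      exact hi (Fin.ext (by simp))
    · simp
  · rw [hh.coeff_eq_zero hd, Finset.sum_eq_zero]
    intro i _
    rw [if_neg]
    rintro rfl
    apply hd
    have := i.isLt
    simp [Finsupp.degree_eq_sum]
    omega

theorem coeffFunctional_eq_zero {n : ℕ} {y : Fin (n + 1) → K}
    (h : ∀ q : MvPolynomial (Fin 2) K, q.IsHomogeneous n → coeffFunctional n y q = 0) : y = 0 := by
  funext i
  have hi := i.isLt
  have := h (C 1 * X 0 ^ (n - (i : ℕ)) * X 1 ^ (i : ℕ)) (by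
    have h1 : (C 1 * X 0 ^ (n - (i : ℕ)) * X 1 ^ (i : ℕ) :
      MvPolynomial (Fin 2) K).IsHomogeneous (n - i + i) :=
      (isHomogeneous_C_mul_X_pow _ _ _).mul (isHomogeneous_X_pow _ _)
    rwa [Nat.sub_add_cancel (by omega)] at h1)
  rwa [coeffFunctional_C_mul_X_pow n y 1 (by omega), one_mul] at this

theorem formOf_two (x : Fin 3 → K) : formOf 2 x =
    C (x 0) * X 0 ^ 2 + C (x 1) * X 0 * X 1 + C (x 2) * X 1 ^ 2 := by
  rw [formOf, Fin.sum_univ_three]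
  simp

theorem formOf_two_isHomogeneous (x : Fin 3 → K) : (formOf 2 x).IsHomogeneous 2 := by
  refine IsHomogeneous.sum _ _ _ fun i _ => ?_
  have := (isHomogeneous_C_mul_X_pow (x i) (0 : Fin 2) (2 - i)).mul
    (isHomogeneous_X_pow (R := K) (1 : Fin 2) i)
  rwa [Nat.sub_add_cancel (by omega)] at this

theorem Mmat_mulVec {n : ℕ} (hn : 3 ≤ n) (f : Fin 3 → MvPolynomial (Fin 2) K) (x : Fin 3 → K)
    (y : Fin (n + 1) → K) (j : Fin (n - 2 + 4)) :
    (((Mmat n 2 f).map (eval x)).mulVec y) j =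
      if hj : (j : ℕ) ≤ n - 2 then
        coeffFunctional n y (formOf 2 x * (X 0 ^ (n - 2 - (j : ℕ)) * X 1 ^ (j : ℕ)))
      else coeffFunctional n y (f ⟨(j : ℕ) - (n - 2 + 1), by have := j.isLt; omega⟩) := by
  split_ifs with hj
  · rw [coeffFunctional_apply, Matrix.mulVec, dotProduct]
    refine Finset.sum_congr rfl fun c _ => ?_
    congr 1
    have hmul : formOf 2 x * (X 0 ^ (n - 2 - (j : ℕ)) * X 1 ^ (j : ℕ)) =
        C (x 0) * X 0 ^ (n - j) * X 1 ^ (j : ℕ) + C (x 1) * X 0 ^ (n - j - 1) * X 1 ^ (j + 1 : ℕ)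
        + C (x 2) * X 0 ^ (n - j - 2) * X 1 ^ (j + 2 : ℕ) := by
      rw [formOf_two]
      obtain ⟨m, hm⟩ : ∃ m, n - 2 - (j : ℕ) = m := ⟨_, rfl⟩
      rw [hm, show n - (j : ℕ) = m + 2 by omega, show m + 2 - 1 = m + 1 by omega,
        show m + 2 - 2 = m by omega]
      ring
    have hadd : ∀ g h : MvPolynomial (Fin 2) K, bcoeff n (g + h) c = bcoeff n g c + bcoeff n h c :=
      fun g h => coeff_add _ _ _
    rw [hmul, hadd, hadd, bcoeff_C_mul_X_pow n _ (by omega), bcoeff_C_mul_X_pow n _ (by omega),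
      bcoeff_C_mul_X_pow n _ (by omega), Matrix.map_apply]
    simp only [Mmat, hj, dif_pos]
    split_ifs with h1 h2 h3 h4 h5 h6 h7 <;> first | omega | skip
    all_goals simp
    all_goals (congr 1; ext; simp; omega)
  · rw [coeffFunctional_apply, Matrix.mulVec, dotProduct]
    refine Finset.sum_congr rfl fun c _ => ?_
    rw [Matrix.map_apply]
    simp only [Mmat, hj, dif_neg, not_false_eq_true, eval_C]

theorem mem_XkSet_two_iff {n : ℕ} (hn : 3 ≤ n) (f : Fin 3 → MvPolynomial (Fin 2) K)
    (P : Projectivization K (Fin 3 → K)) :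
    P ∈ XkSet n 2 f ↔ ∃ y : Fin (n + 1) → K, y ≠ 0 ∧
      (∀ q : MvPolynomial (Fin 2) K, q.IsHomogeneous (n - 2) →
        coeffFunctional n y (formOf 2 P.rep * q) = 0) ∧ ∀ u, coeffFunctional n y (f u) = 0 := by
  have hdet : ∀ r c, eval P.rep (((Mmat n 2 f).submatrix r c).det) =
      (((Mmat n 2 f).map (eval P.rep)).submatrix r c).det (n := Fin (n - 2 + 3)) := by
    intro r c
    rw [RingHom.map_det]
    rfl
  constructor
  · intro hP
    obtain ⟨y, hy, hM⟩ := exists_mulVec_eq_zero_of_minors (N := n - 2 + 3) (by omega)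
      ((Mmat n 2 f).map (eval P.rep)) fun r c hr hc => by
        rw [← hdet]
        exact hP _ ⟨r, c, hr, hc, rfl⟩
    refine ⟨y, hy, fun q hq => ?_, fun u => ?_⟩
    · rw [isHomogeneous_eq_sum hq, Finset.mul_sum, map_sum]
      refine Finset.sum_eq_zero fun i _ => ?_
      have := congrFun hM ⟨i, by omega⟩
      rw [Mmat_mulVec hn, dif_pos (by simp; omega)] at this
      rw [mul_assoc, mul_left_comm, ← smul_eq_C_mul, map_smul, this, Pi.zero_apply, smul_zero]
    · have := congrFun hM ⟨n - 2 + 1 + u, by omega⟩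
      rw [Mmat_mulVec hn, dif_neg (by simp; omega)] at this
      simpa using this
  · rintro ⟨y, hy, hq, hu⟩ g ⟨r, c, hr, hc, rfl⟩
    change eval P.rep _ = 0
    rw [hdet]
    refine minors_eq_zero_of_mulVec_eq_zero (by omega) _ hy ?_ r c hc
    funext j
    rw [Mmat_mulVec hn]
    split_ifs with hj
    · refine hq _ ?_
      have := (isHomogeneous_X_pow (R := K) (0 : Fin 2) (n - 2 - j)).mul
        (isHomogeneous_X_pow (R := K) (1 : Fin 2) j)
      rwa [Nat.sub_add_cancel hj] at this
    · exact hu _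

end Minors

section LocalForm

variable {K : Type*} [Field K]

theorem exists_eq_linFormOf {q : MvPolynomial (Fin 2) K} (hq : q.IsHomogeneous 1) :
    ∃ w : Fin 2 → K, q = linFormOf w := by
  refine ⟨![-bcoeff 1 q 1, bcoeff 1 q 0], ?_⟩
  conv_lhs => rw [isHomogeneous_eq_sum hq]
  simp [linFormOf, Fin.sum_univ_two]

theorem formOf_two_smul (c : K) (x : Fin 3 → K) : formOf 2 (c • x) = C c * formOf 2 x := by
  simp only [formOf_two, Pi.smul_apply, smul_eq_mul, C_mul]
  ring

theorem formOf_two_ne_zero {x : Fin 3 → K} (hx : x ≠ 0) : formOf 2 x ≠ 0 := by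
  intro h
  apply hx
  have h0 : ∀ i, bcoeff 2 (formOf 2 x) i = x i := by
    intro i
    have hadd : ∀ g h : MvPolynomial (Fin 2) K, bcoeff 2 (g + h) i = bcoeff 2 g i + bcoeff 2 h i :=
      fun g h => coeff_add _ _ _
    have : formOf 2 x = C (x 0) * X 0 ^ 2 * X 1 ^ 0 + C (x 1) * X 0 ^ 1 * X 1 ^ 1 +
        C (x 2) * X 0 ^ 0 * X 1 ^ 2 := by
      rw [formOf_two]; ring
    rw [this, hadd, hadd, bcoeff_C_mul_X_pow _ _ (by omega), bcoeff_C_mul_X_pow _ _ (by omega),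
      bcoeff_C_mul_X_pow _ _ (by omega)]
    fin_cases i <;> simp
  funext i
  rw [← h0, h]
  simp [bcoeff]

theorem linFormOf_mul_linFormOf (v w : Fin 2 → K) : linFormOf v * linFormOf w =
    formOf 2 ![v 1 * w 1, -(v 1 * w 0 + v 0 * w 1), v 0 * w 0] := by
  rw [formOf_two, linFormOf, linFormOf]
  simp only [Matrix.cons_val_zero, Matrix.cons_val_one, Matrix.cons_val, C_mul, C_neg, C_add]
  ring

/-- A normal form of the parameterization near `v`: modulo the linear form vanishing at `v`, it is
`evalVec f v` times a single form `ξ`. -/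
structure IsLocalForm (n : ℕ) (f : Fin 3 → MvPolynomial (Fin 2) K) (v : Fin 2 → K)
    (a : Fin 3 → K) (ξ : MvPolynomial (Fin 2) K) (g : Fin 3 → MvPolynomial (Fin 2) K) : Prop where
  sum_eq_one : ∑ i, a i * evalVec f v i = 1
  xi_eq : ξ = ∑ i, C (a i) * f i
  xi_homog : ξ.IsHomogeneous n
  eval_xi : eval v ξ = 1
  homog : ∀ i, (g i).IsHomogeneous (n - 1)
  eq : ∀ i, f i = C (evalVec f v i) * ξ + linFormOf v * g i

theorem exists_isLocalForm {n : ℕ} (hn : n ≠ 0) {f : Fin 3 → MvPolynomial (Fin 2) K}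
    (hf : ∀ i, (f i).IsHomogeneous n) {v : Fin 2 → K} (hv : v ≠ 0) (hp : evalVec f v ≠ 0) :
    ∃ a ξ g, IsLocalForm n f v a ξ g := by
  obtain ⟨a, ha⟩ := exists_sum_mul_eq_one hp
  set ξ := ∑ i, C (a i) * f i with hξ
  have hξh : ξ.IsHomogeneous n := IsHomogeneous.sum _ _ _ fun i _ => (hf i).C_mul _
  have hξv : eval v ξ = 1 := by
    rw [hξ, map_sum, ← ha]
    simp [evalVec]
  have h : ∀ i, ∃ q : MvPolynomial (Fin 2) K, q.IsHomogeneous (n - 1) ∧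
      f i - C (evalVec f v i) * ξ = linFormOf v * q := fun i => by
    refine exists_linFormOf_mul_eq hv ?_ ?_
    · rw [Nat.sub_add_cancel (by omega)]
      exact (hf i).sub (hξh.C_mul _)
    · simp [hξv, evalVec]
  choose g hg hfg using h
  exact ⟨a, ξ, g, ha, hξ, hξh, hξv, hg, fun i => by rw [← hfg]; ring⟩

theorem exists_common_zero_of_mem_XkSet {n : ℕ} (hn : 3 ≤ n) {f g : Fin 3 → MvPolynomial (Fin 2) K}
    {v : Fin 2 → K} (hv : v ≠ 0) {a : Fin 3 → K} {ξ : MvPolynomial (Fin 2) K}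
    (hl : IsLocalForm n f v a ξ g) {P : Projectivization K (Fin 3 → K)} (hP : P ∈ XkSet n 2 f)
    (hPv : eval v (formOf 2 P.rep) = 0) : ∃ w : Fin 2 → K, w ≠ 0 ∧ ∀ i, eval w (g i) = 0 := by
  obtain ⟨q, hq, hGq⟩ := exists_linFormOf_mul_eq hv (formOf_two_isHomogeneous P.rep) hPv
  obtain ⟨w, rfl⟩ := exists_eq_linFormOf hq
  have hw : w ≠ 0 := by
    rintro rfl
    apply formOf_two_ne_zero P.rep_nonzero
    rw [hGq]
    simp [linFormOf]
  refine ⟨w, hw, ?_⟩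
  by_contra! hgw
  obtain ⟨i, hi⟩ := hgw
  obtain ⟨y, hy, hyG, hyf⟩ := (mem_XkSet_two_iff hn f P).1 hP
  rw [hGq] at hyG
  set T := coeffFunctional n y with hT
  have hTC : ∀ (c : K) h, T (C c * h) = c * T h := fun c h => by
    rw [← smul_eq_C_mul, map_smul, smul_eq_mul]
  have hTξ : T ξ = 0 := by
    rw [hl.xi_eq, map_sum]
    exact Finset.sum_eq_zero fun j _ => by rw [hTC, hyf, mul_zero]
  have hTg : T (linFormOf v * g i) = 0 := by
    have h := hyf i
    rwa [hl.eq i, map_add, hTC, hTξ, mul_zero, zero_add] at h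
  have hTL : ∀ q : MvPolynomial (Fin 2) K, q.IsHomogeneous (n - 1) → T (linFormOf v * q) = 0 := by
    intro q hq
    obtain ⟨r, hr, hqr⟩ := exists_linFormOf_mul_eq (d := n - 2) hw
      (h := C (eval w (g i)) * q - C (eval w q) * g i) (by
        rw [show n - 2 + 1 = n - 1 by omega]
        exact (hq.C_mul _).sub ((hl.homog i).C_mul _)) (by simp; ring)
    have h := hyG r hr
    rw [mul_assoc, ← hqr, mul_sub, mul_left_comm, mul_left_comm _ (C (eval w q)), map_sub, hTC, hTC,
      hTg, mul_zero, sub_zero] at h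
    exact (mul_eq_zero.1 h).resolve_left hi
  apply hy
  refine coeffFunctional_eq_zero fun q hq => ?_
  obtain ⟨r, hr, hqr⟩ := exists_linFormOf_mul_eq (d := n - 1) hv
    (h := q - C (eval v q) * ξ) (by
      rw [Nat.sub_add_cancel (by omega)]
      exact hq.sub (hl.xi_homog.C_mul _)) (by simp [hl.eval_xi])
  have h := hTL r hr
  rwa [← hqr, map_sub, hTC, hTξ, mul_zero, sub_zero] at h

theorem exists_mem_XkSet_of_common_zero {n : ℕ} (hn : 3 ≤ n) {f g : Fin 3 → MvPolynomial (Fin 2) K}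
    {v : Fin 2 → K} (hv : v ≠ 0) {a : Fin 3 → K} {ξ : MvPolynomial (Fin 2) K}
    (hl : IsLocalForm n f v a ξ g) {w : Fin 2 → K} (hw : w ≠ 0) (hgw : ∀ i, eval w (g i) = 0) :
    ∃ P ∈ XkSet n 2 f, eval v (formOf 2 P.rep) = 0 := by
  set x : Fin 3 → K := ![v 1 * w 1, -(v 1 * w 0 + v 0 * w 1), v 0 * w 0] with hx
  have hG := linFormOf_mul_linFormOf v w
  rw [← hx] at hG
  have hx0 : x ≠ 0 := by
    intro h
    have h0 : linFormOf v * linFormOf w = 0 := by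
      rw [hG, h, formOf_two]
      simp
    exact mul_ne_zero (linFormOf_ne_zero hv) (linFormOf_ne_zero hw) h0
  obtain ⟨c, hc⟩ := Projectivization.exists_smul_eq_mk_rep K x hx0
  have hGrep : formOf 2 (Projectivization.mk K x hx0).rep =
      C (c : K) * (linFormOf v * linFormOf w) := by
    rw [← hc, hG]
    exact formOf_two_smul _ _
  refine ⟨Projectivization.mk K x hx0, (mem_XkSet_two_iff hn f _).2 ?_, ?_⟩
  · let Φ : (Fin (n + 1) → K) →ₗ[K] (Fin (n - 2 + 1) ⊕ Unit → K) := LinearMap.pi fun j =>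
      ∑ i, (bcoeff n (Sum.elim (fun j : Fin (n - 2 + 1) => linFormOf v * linFormOf w *
        (X 0 ^ (n - 2 - (j : ℕ)) * X 1 ^ (j : ℕ))) (fun _ => ξ) j) i) • LinearMap.proj i
    have hΦ : ∀ y j, Φ y j = coeffFunctional n y (Sum.elim (fun j : Fin (n - 2 + 1) =>
        linFormOf v * linFormOf w *
        (X 0 ^ (n - 2 - (j : ℕ)) * X 1 ^ (j : ℕ))) (fun _ => ξ) j) := by
      intro y j
      simp [Φ, coeffFunctional_apply, LinearMap.sum_apply]
    have hker : LinearMap.ker Φ ≠ ⊥ := by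
      apply LinearMap.ker_ne_bot_of_finrank_lt
      simp
      omega
    obtain ⟨y, hyΦ, hy⟩ := (Submodule.ne_bot_iff _).1 hker
    rw [LinearMap.mem_ker] at hyΦ
    have hTC : ∀ (c : K) h, coeffFunctional n y (C c * h) = c * coeffFunctional n y h :=
      fun c h => by rw [← smul_eq_C_mul, map_smul, smul_eq_mul]
    have hyG : ∀ q : MvPolynomial (Fin 2) K, q.IsHomogeneous (n - 2) →
        coeffFunctional n y (linFormOf v * linFormOf w * q) = 0 := by
      intro q hq
      rw [isHomogeneous_eq_sum hq, Finset.mul_sum, map_sum]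
      refine Finset.sum_eq_zero fun i _ => ?_
      have h := hΦ y (Sum.inl i)
      rw [hyΦ, Sum.elim_inl] at h
      rw [mul_assoc (C _), mul_left_comm, hTC, ← h, Pi.zero_apply, mul_zero]
    refine ⟨y, hy, fun q hq => ?_, fun i => ?_⟩
    · rw [hGrep, mul_assoc, hTC, hyG q hq, mul_zero]
    · have hξ := hΦ y (Sum.inr ())
      rw [hyΦ, Sum.elim_inr, Pi.zero_apply] at hξ
      obtain ⟨r, hr, hgr⟩ := exists_linFormOf_mul_eq (d := n - 2) hw (h := g i) (by
        rw [show n - 2 + 1 = n - 1 by omega]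
        exact hl.homog i) (hgw i)
      rw [hl.eq i, map_add, hTC, ← hξ, mul_zero, zero_add, hgr, ← mul_assoc, hyG r hr]
  · rw [hGrep, map_mul, map_mul, eval_linFormOf_self]
    simp

end LocalForm

section Multiplicity

variable {K : Type*} [Field K]

theorem eval_eq_zero_of_mem_pointIdeal {p : Fin 3 → K} {A : MvPolynomial (Fin 3) K}
    (hA : A ∈ pointIdeal p) : eval p A = 0 := by
  have h : pointIdeal p ≤ RingHom.ker (eval p) := Ideal.span_le.2 fun L hL => hL.2
  exact h hA

theorem eval_pderiv_eq_zero_of_mem_pointIdeal_sq {p : Fin 3 → K} {A : MvPolynomial (Fin 3) K}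
    (hA : A ∈ pointIdeal p ^ 2) (i : Fin 3) : eval p (pderiv i A) = 0 := by
  rw [pow_two] at hA
  induction hA using Submodule.mul_induction_on' with
  | mem_mul_mem B hB D hD =>
    simp [eval_eq_zero_of_mem_pointIdeal hB, eval_eq_zero_of_mem_pointIdeal hD]
  | add B _ D _ hB hD => simp [hB, hD]

theorem two_le_multAt_iff {F : MvPolynomial (Fin 3) K} (hF : F ≠ 0) (p : Fin 3 → K) :
    2 ≤ multAt F p ↔ F ∈ pointIdeal p ^ 2 := by
  have hne : pointIdeal p ≠ ⊤ := by
    intro h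
    have h1 : (1 : MvPolynomial (Fin 3) K) ∈ pointIdeal p := h ▸ Submodule.mem_top
    simpa using eval_eq_zero_of_mem_pointIdeal h1
  obtain ⟨N, hN⟩ : ∃ N, F ∉ pointIdeal p ^ N := by
    by_contra! h
    apply hF
    rw [← Submodule.mem_bot (MvPolynomial (Fin 3) K), ← Ideal.iInf_pow_eq_bot_of_isDomain _ hne]
    simpa [Submodule.mem_iInf] using h
  have hbdd : BddAbove {m | F ∈ pointIdeal p ^ m} := by
    refine ⟨N, fun m hm => ?_⟩
    by_contra! h
    exact hN (Ideal.pow_le_pow_right h.le hm)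
  refine ⟨fun h => ?_, fun h => le_csSup hbdd h⟩
  have hmem : multAt F p ∈ {m | F ∈ pointIdeal p ^ m} := Nat.sSup_mem ⟨0, by simp⟩ hbdd
  exact Ideal.pow_le_pow_right h hmem

theorem X_sub_mem_pointIdeal {p a : Fin 3 → K} (ha : ∑ i, a i * p i = 1) (i : Fin 3) :
    X i - C (p i) * ∑ j, C (a j) * X j ∈ pointIdeal p := by
  refine Ideal.subset_span ⟨?_, ?_⟩
  · exact (isHomogeneous_X _ _).sub
      ((IsHomogeneous.sum _ _ _ fun j _ => isHomogeneous_C_mul_X _ _).C_mul _)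
  · simp [ha]

end Multiplicity

section Conductor

variable {K : Type*} [Field K]

theorem map_det_mul_mem_range {ι R S : Type*} [Fintype ι] [DecidableEq ι] [CommRing R] [CommRing S]
    (φ : R →+* S) (B : Matrix ι ι R) (h : ι → S) (r : ι → R)
    (hB : ∀ k, ∑ j, φ (B k j) * h j = φ (r k)) (k : ι) : φ B.det * h k ∈ φ.range := by
  have hB' : (B.map φ).mulVec h = φ ∘ r := funext hB
  have h1 : ((B.map φ).adjugate).mulVec ((B.map φ).mulVec h) = (B.map φ).det • h := by
    rw [Matrix.mulVec_mulVec, Matrix.adjugate_mul, Matrix.smul_mulVec, Matrix.one_mulVec]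
  have h2 : (B.map φ).det = φ B.det := (RingHom.map_det φ B).symm
  have h3 : (B.map φ).adjugate = (B.adjugate).map φ := (RingHom.map_adjugate φ B).symm
  rw [hB', h2, h3] at h1
  refine ⟨B.adjugate.mulVec r k, ?_⟩
  rw [RingHom.map_mulVec]
  exact congrFun h1 k

theorem aeval_coordinate_sub {n : ℕ} {f g : Fin 3 → MvPolynomial (Fin 2) K}
    {v : Fin 2 → K} {a : Fin 3 → K} {ξ : MvPolynomial (Fin 2) K} (hl : IsLocalForm n f v a ξ g)
    (i : Fin 3) : aeval f (X i - C (evalVec f v i) * ∑ j, C (a j) * X j :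
      MvPolynomial (Fin 3) K) = linFormOf v * g i := by
  have hx : aeval f (∑ j, C (a j) * X j : MvPolynomial (Fin 3) K) = ξ := by
    rw [hl.xi_eq]
    simp [algebraMap_eq]
  rw [map_sub, map_mul, hx, aeval_X, aeval_C, algebraMap_eq, sub_eq_iff_eq_add']
  exact hl.eq i

theorem exists_conductor {n d : ℕ} (hn : n ≠ 0) {f g : Fin 3 → MvPolynomial (Fin 2) K}
    {v : Fin 2 → K} (hv : v ≠ 0) {a : Fin 3 → K} {ξ : MvPolynomial (Fin 2) K}
    (hl : IsLocalForm n f v a ξ g)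
    (hd : ∀ h : MvPolynomial (Fin 2) K, h.IsHomogeneous (n - 1 + n * d) →
      ∃ q : Fin 3 → MvPolynomial (Fin 2) K, (∀ i, (q i).IsHomogeneous (n * d)) ∧
        h = ∑ i, g i * q i) :
    ∃ U : MvPolynomial (Fin 3) K, eval (evalVec f v) U = 1 ∧
      ∀ h : MvPolynomial (Fin 2) K, h.IsHomogeneous (n * d) →
        ∃ R : MvPolynomial (Fin 3) K, aeval f R = aeval f U * h := by
  set p := evalVec f v with hp
  set x : MvPolynomial (Fin 3) K := ∑ j, C (a j) * X j with hx
  have hxf : aeval f x = ξ := by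
    rw [hl.xi_eq, hx]
    simp [algebraMap_eq]
  have hxp : eval p x = 1 := by simpa [hx] using hl.sum_eq_one
  have hlp : ∀ i, eval p (X i - C (p i) * x) = 0 := fun i => by simp [hxp]
  let mon : Fin (n * d + 1) → MvPolynomial (Fin 2) K :=
    fun j => X 0 ^ (n * d - (j : ℕ)) * X 1 ^ (j : ℕ)
  have hmonh : ∀ j, (mon j).IsHomogeneous (n * d) := fun j => by
    have := (isHomogeneous_X_pow (R := K) (0 : Fin 2) (n * d - j)).mul
      (isHomogeneous_X_pow (R := K) (1 : Fin 2) j)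
    rwa [Nat.sub_add_cancel (by omega)] at this
  have hmon : ∀ h : MvPolynomial (Fin 2) K, h.IsHomogeneous (n * d) →
      h = ∑ j, C (bcoeff (n * d) h j) * mon j := fun h hh => by
    conv_lhs => rw [isHomogeneous_eq_sum hh]
    exact Finset.sum_congr rfl fun j _ => mul_assoc _ _ _
  have hstep : ∀ k, ∃ q : Fin 3 → MvPolynomial (Fin 2) K, (∀ i, (q i).IsHomogeneous (n * d)) ∧
      ξ * mon k - C (eval v (mon k)) * ξ ^ (d + 1) =
        ∑ i, aeval f (X i - C (p i) * x) * q i := by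
    intro k
    have hdeg : n - 1 + n * d + 1 = n + n * d := by omega
    obtain ⟨s, hs, hks⟩ := exists_linFormOf_mul_eq (d := n - 1 + n * d) hv
      (h := ξ * mon k - C (eval v (mon k)) * ξ ^ (d + 1)) (by
        rw [hdeg]
        refine (hl.xi_homog.mul (hmonh k)).sub (IsHomogeneous.C_mul ?_ _)
        have := hl.xi_homog.pow (d + 1)
        rwa [show n * (d + 1) = n + n * d by ring] at this) (by simp [hl.eval_xi])
    obtain ⟨q, hq, hsq⟩ := hd s hs
    refine ⟨q, hq, ?_⟩
    rw [hks, hsq, Finset.mul_sum]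
    refine Finset.sum_congr rfl fun i _ => ?_
    rw [aeval_coordinate_sub hl, mul_assoc]
  choose q hq hkq using hstep
  let c : Matrix (Fin (n * d + 1)) (Fin (n * d + 1)) (MvPolynomial (Fin 3) K) := fun k j =>
    ∑ i, (X i - C (p i) * x) * C (bcoeff (n * d) (q k i) j)
  let B : Matrix (Fin (n * d + 1)) (Fin (n * d + 1)) (MvPolynomial (Fin 3) K) :=
    Matrix.scalar _ x - c
  have hB : ∀ k, ∑ j, aeval f (B k j) * mon j = aeval f (C (eval v (mon k)) * x ^ (d + 1)) := by
    intro k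
    have h1 : ∑ j, aeval f (Matrix.scalar (Fin (n * d + 1)) x k j) * mon j = ξ * mon k := by
      rw [Finset.sum_eq_single k]
      · rw [Matrix.scalar_apply, Matrix.diagonal_apply_eq, hxf]
      · intro j _ hj
        simp [Matrix.diagonal_apply_ne _ hj.symm]
      · simp
    have h2 : ∑ j, aeval f (c k j) * mon j = ∑ i, aeval f (X i - C (p i) * x) * q k i := by
      simp only [c, map_sum, map_mul, Finset.sum_mul]
      rw [Finset.sum_comm]
      refine Finset.sum_congr rfl fun i _ => ?_
      conv_rhs => rw [hmon _ (hq k i), Finset.mul_sum]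
      refine Finset.sum_congr rfl fun j _ => ?_
      rw [aeval_C, algebraMap_eq, mul_assoc]
    have h3 : ∀ j, aeval f (B k j) * mon j =
        aeval f (Matrix.scalar (Fin (n * d + 1)) x k j) * mon j - aeval f (c k j) * mon j := by
      intro j
      rw [← sub_mul, ← map_sub]
      rfl
    have h4 : ∀ b : K, aeval f (C b * x ^ (d + 1)) = C b * ξ ^ (d + 1) := fun b => by
      rw [map_mul, map_pow, hxf, aeval_C, algebraMap_eq]
    rw [Finset.sum_congr rfl fun j _ => h3 j, Finset.sum_sub_distrib, h1, h2, ← hkq, h4]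
    ring
  refine ⟨B.det, ?_, fun h hh => ?_⟩
  · rw [RingHom.map_det]
    have : (eval p).mapMatrix B = 1 := by
      ext k j
      have hc : eval p (c k j) = 0 := by
        rw [map_sum]
        exact Finset.sum_eq_zero fun i _ => by rw [map_mul, hlp, zero_mul]
      change eval p (Matrix.scalar (Fin (n * d + 1)) x k j - c k j) = _
      rw [map_sub, hc, sub_zero, Matrix.scalar_apply]
      by_cases hkj : k = j
      · subst hkj
        rw [Matrix.diagonal_apply_eq, Matrix.one_apply_eq, hxp]
      · rw [Matrix.diagonal_apply_ne _ hkj, Matrix.one_apply_ne hkj, map_zero]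
    rw [this, Matrix.det_one]
  · have hr := map_det_mul_mem_range (aeval f : MvPolynomial (Fin 3) K →ₐ[K] _).toRingHom B mon _ hB
    choose R hR using hr
    refine ⟨∑ j, C (bcoeff (n * d) h j) * R j, ?_⟩
    conv_rhs => rw [hmon h hh, Finset.mul_sum]
    rw [map_sum]
    refine Finset.sum_congr rfl fun j _ => ?_
    rw [map_mul, aeval_C, algebraMap_eq, mul_left_comm]
    congr 1
    exact hR j

theorem notMem_pointIdeal_sq [IsAlgClosed K] {n : ℕ} (hn : 3 ≤ n)
    {f g : Fin 3 → MvPolynomial (Fin 2) K} (hf : ∀ i, (f i).IsHomogeneous n)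
    (h0 : ∀ w : Fin 2 → K, (∀ i, eval w (f i) = 0) → w = 0)
    {F : MvPolynomial (Fin 3) K} (hF : Irreducible F) (hFf : aeval f F = 0)
    {v : Fin 2 → K} (hv : v ≠ 0) {a : Fin 3 → K} {ξ : MvPolynomial (Fin 2) K}
    (hl : IsLocalForm n f v a ξ g)
    (hg0 : ∀ w : Fin 2 → K, (∀ i, eval w (g i) = 0) → w = 0) :
    F ∉ pointIdeal (evalVec f v) ^ 2 := by
  intro hFmem
  obtain ⟨d, hE⟩ := exists_forall_isHomogeneous_eq_sum hl.homog hg0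
  have hnd : d ≤ n * d := Nat.le_mul_of_pos_left d (by omega)
  obtain ⟨U, hU, hUR⟩ := exists_conductor (by omega) hv hl (hE (n * d) hnd)
  set p := evalVec f v with hp
  set x : MvPolynomial (Fin 3) K := ∑ j, C (a j) * X j with hx
  have hxf : aeval f x = ξ := by
    rw [hl.xi_eq, hx]
    simp [algebraMap_eq]
  have hxp : eval p x = 1 := by simpa [hx] using hl.sum_eq_one
  obtain ⟨b, hb0, hbp, hbg⟩ : ∃ b : Fin 3 → K, b ≠ 0 ∧ ∑ i, b i * p i = 0 ∧
      ∑ i, b i * eval v (g i) = 0 := by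
    let Φ : (Fin 3 → K) →ₗ[K] (Fin 2 → K) :=
      (Matrix.of ![p, fun i => eval v (g i)]).mulVecLin
    obtain ⟨b, hb, hb0⟩ := (Submodule.ne_bot_iff _).1
      (LinearMap.ker_ne_bot_of_finrank_lt (f := Φ) (by simp))
    have hΦ : ∀ i, Φ b i = 0 := fun i => congrFun (LinearMap.mem_ker.1 hb) i
    refine ⟨b, hb0, ?_, ?_⟩
    · simpa [Φ, Matrix.mulVec, dotProduct, mul_comm] using hΦ 0
    · simpa [Φ, Matrix.mulVec, dotProduct, mul_comm] using hΦ 1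
  set lb : MvPolynomial (Fin 3) K := ∑ i, C (b i) * X i with hlb
  have hlbp : eval p lb = 0 := by simpa [hlb] using hbp
  obtain ⟨e, he, hge⟩ := exists_linFormOf_mul_eq (d := n - 2) hv (h := ∑ i, C (b i) * g i) (by
    rw [show n - 2 + 1 = n - 1 by omega]
    exact IsHomogeneous.sum _ _ _ fun i _ => (hl.homog i).C_mul _) (by simpa using hbg)
  have hlbf : aeval f lb = linFormOf v * (linFormOf v * e) := by
    have hbpC : ∑ i, C (b i) * C (p i) = (0 : MvPolynomial (Fin 2) K) := by
      simp only [← C_mul, ← map_sum, hbp, map_zero]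
    calc aeval f lb = ∑ i, C (b i) * f i := by simp [hlb, algebraMap_eq]
      _ = ∑ i, (C (b i) * C (p i) * ξ + linFormOf v * (C (b i) * g i)) :=
        Finset.sum_congr rfl fun i _ => by
          conv_lhs => rw [hl.eq i]
          ring
      _ = linFormOf v * (linFormOf v * e) := by
        rw [Finset.sum_add_distrib, ← Finset.sum_mul, hbpC, zero_mul, zero_add, ← Finset.mul_sum,
          hge]
  obtain ⟨q, hq, heq⟩ := hE (n - 1 + n * d) (by omega) (e * ξ ^ (d + 1)) (by
    have := he.mul (hl.xi_homog.pow (d + 1))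
    rwa [mul_add, mul_one,
      show n - 2 + (n * d + n) = n - 1 + (n - 1 + n * d) by omega] at this)
  choose r hr hqr using fun i => hE (n * d) hnd (q i) (hq i)
  choose R hR using fun i j => hUR (r i j) (hr i j)
  set D := lb * (x ^ (d + 1) * U) with hD
  set Q := ∑ i, ∑ j, ((X i - C (p i) * x) * (X j - C (p j) * x)) * R i j with hQ
  have hQmem : Q ∈ pointIdeal p ^ 2 := by
    refine Ideal.sum_mem _ fun i _ => Ideal.sum_mem _ fun j _ => Ideal.mul_mem_right _ _ ?_
    rw [pow_two]
    exact Ideal.mul_mem_mul (X_sub_mem_pointIdeal hl.sum_eq_one i)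
      (X_sub_mem_pointIdeal hl.sum_eq_one j)
  have hDQ : aeval f (D - Q) = 0 := by
    rw [map_sub, sub_eq_zero]
    calc aeval f D = linFormOf v * linFormOf v * aeval f U * (e * ξ ^ (d + 1)) := by
          rw [hD, map_mul, map_mul, map_pow, hxf, hlbf]; ring
      _ = ∑ i, ∑ j, (linFormOf v * g i) * (linFormOf v * g j) * (aeval f U * r i j) := by
          rw [heq, Finset.mul_sum]
          refine Finset.sum_congr rfl fun i _ => ?_
          rw [hqr i, Finset.mul_sum, Finset.mul_sum]
          exact Finset.sum_congr rfl fun j _ => by ring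
      _ = aeval f Q := by
          simp only [hQ, map_sum]
          refine Finset.sum_congr rfl fun i _ => Finset.sum_congr rfl fun j _ => ?_
          rw [map_mul, map_mul, hR, aeval_coordinate_sub hl, aeval_coordinate_sub hl]
  have hDmem : D ∈ pointIdeal p ^ 2 := by
    have hdvd := dvd_of_aeval_eq_zero (by omega) hf h0 hF hFf hDQ
    have := add_mem (Ideal.mem_of_dvd _ hdvd hFmem) hQmem
    rwa [sub_add_cancel] at this
  apply hb0
  funext i
  have h := eval_pderiv_eq_zero_of_mem_pointIdeal_sq hDmem i
  have hder : pderiv i lb = C (b i) := by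
    simp [hlb, pderiv_X, Pi.single_apply]
  rw [hD, Derivation.leibniz, hder] at h
  simpa [hlbp, hxp, hU] using h

end Conductor

section SmoothPoint

variable {K : Type*} [Field K]

theorem exists_basis_of_orthogonal {p b : Fin 3 → K} (hp : p ≠ 0) (hb : b ≠ 0)
    (hbp : ∑ i, b i * p i = 0) : ∃ c : Fin 3 → K, c ≠ 0 ∧ ∑ i, c i * p i = 0 ∧
      ∀ m : Fin 3 → K, ∑ i, m i * p i = 0 → ∃ s t, ∀ i, m i = s * b i + t * c i := by
  obtain ⟨q, hq⟩ := exists_sum_mul_eq_one hb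
  simp only [Fin.sum_univ_three] at hbp hq ⊢
  obtain ⟨c, hc0, hc1, hc2⟩ : ∃ c : Fin 3 → K, c 0 = p 1 * q 2 - p 2 * q 1 ∧
      c 1 = p 2 * q 0 - p 0 * q 2 ∧ c 2 = p 0 * q 1 - p 1 * q 0 :=
    ⟨![p 1 * q 2 - p 2 * q 1, p 2 * q 0 - p 0 * q 2, p 0 * q 1 - p 1 * q 0], rfl, rfl, rfl⟩
  have hc : c ≠ 0 := by
    intro h
    simp only [h, Pi.zero_apply] at hc0 hc1 hc2
    apply hp
    funext i
    fin_cases i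
    · change p 0 = 0
      linear_combination q 0 * hbp - p 0 * hq - b 1 * hc2 + b 2 * hc1
    · change p 1 = 0
      linear_combination q 1 * hbp - p 1 * hq - b 2 * hc0 + b 0 * hc2
    · change p 2 = 0
      linear_combination q 2 * hbp - p 2 * hq - b 0 * hc1 + b 1 * hc0
  refine ⟨c, hc, by rw [hc0, hc1, hc2]; ring, fun m hm => ?_⟩
  obtain ⟨r, hr⟩ := exists_sum_mul_eq_one hc
  rw [Fin.sum_univ_three] at hr
  obtain ⟨s, hs⟩ : ∃ s, s = m 0 * q 0 + m 1 * q 1 + m 2 * q 2 := ⟨_, rfl⟩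
  obtain ⟨k, hk⟩ : ∃ k : Fin 3 → K, ∀ i, k i = m i - s * b i := ⟨_, fun _ => rfl⟩
  have hkp : k 0 * p 0 + k 1 * p 1 + k 2 * p 2 = 0 := by
    simp only [hk]; linear_combination hm - s * hbp
  have hkq : k 0 * q 0 + k 1 * q 1 + k 2 * q 2 = 0 := by
    simp only [hk]; linear_combination -hs - s * hq
  have h0 : k 1 * c 2 - k 2 * c 1 = 0 := by
    rw [hc1, hc2]; linear_combination p 0 * hkq - q 0 * hkp
  have h1 : k 2 * c 0 - k 0 * c 2 = 0 := by
    rw [hc0, hc2]; linear_combination p 1 * hkq - q 1 * hkp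
  have h2 : k 0 * c 1 - k 1 * c 0 = 0 := by
    rw [hc0, hc1]; linear_combination p 2 * hkq - q 2 * hkp
  refine ⟨s, r 0 * k 0 + r 1 * k 1 + r 2 * k 2, fun i => ?_⟩
  have hki : k i = (r 0 * k 0 + r 1 * k 1 + r 2 * k 2) * c i := by
    fin_cases i
    · change k 0 = (r 0 * k 0 + r 1 * k 1 + r 2 * k 2) * c 0
      linear_combination -k 0 * hr + r 1 * h2 - r 2 * h1
    · change k 1 = (r 0 * k 0 + r 1 * k 1 + r 2 * k 2) * c 1
      linear_combination -k 1 * hr + r 2 * h0 - r 0 * h2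
    · change k 2 = (r 0 * k 0 + r 1 * k 1 + r 2 * k 2) * c 2
      linear_combination -k 2 * hr + r 0 * h1 - r 1 * h0
  linear_combination hki - hk i

theorem pointIdeal_eq_span {p a : Fin 3 → K} (ha : ∑ i, a i * p i = 1) :
    pointIdeal p = Ideal.span (Set.range fun i : Fin 3 =>
      (X i - C (p i) * ∑ j, C (a j) * X j : MvPolynomial (Fin 3) K)) := by
  apply le_antisymm
  · refine Ideal.span_le.2 fun L hL => ?_
    have := sub_eval_mul_pow_mem hL.1 p (∑ j, C (a j) * X j) (Ideal.span (Set.range fun i : Fin 3 =>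
      (X i - C (p i) * ∑ j, C (a j) * X j : MvPolynomial (Fin 3) K)))
      fun i => Ideal.subset_span ⟨i, rfl⟩
    rwa [hL.2, C_0, zero_mul, sub_zero] at this
  · refine Ideal.span_le.2 ?_
    rintro _ ⟨i, rfl⟩
    exact X_sub_mem_pointIdeal ha i

theorem sum_C_mul_X_isHomogeneous (c : Fin 3 → K) :
    (∑ i, C (c i) * X i : MvPolynomial (Fin 3) K).IsHomogeneous 1 :=
  IsHomogeneous.sum _ _ _ fun _ _ => isHomogeneous_C_mul_X _ _

theorem sum_C_mul_X_mem_pointIdeal {p c : Fin 3 → K} (hc : ∑ i, c i * p i = 0) :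
    (∑ i, C (c i) * X i : MvPolynomial (Fin 3) K) ∈ pointIdeal p :=
  Ideal.subset_span ⟨sum_C_mul_X_isHomogeneous c, by simpa using hc⟩

/-- At a smooth point `p` of `F = 0`, the ideal of `p` is locally generated by `F` and one linear
form. -/
theorem exists_local_parameter {n : ℕ} {F : MvPolynomial (Fin 3) K}
    (hFh : F.IsHomogeneous n) {p a : Fin 3 → K} (ha : ∑ i, a i * p i = 1) (hFp : eval p F = 0)
    (hF2 : F ∉ pointIdeal p ^ 2) :
    ∃ U l : MvPolynomial (Fin 3) K, eval p U = 1 ∧ l.IsHomogeneous 1 ∧ l ≠ 0 ∧ l ∈ pointIdeal p ∧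
      ∀ A ∈ pointIdeal p, ∃ α β, U * A = α * F + β * l := by
  have hp : p ≠ 0 := by
    rintro rfl
    simp at ha
  set x : MvPolynomial (Fin 3) K := ∑ j, C (a j) * X j with hx
  have hxp : eval p x = 1 := by simpa [hx] using ha
  set D : Fin 3 → K := fun i => eval p (pderiv i F) with hD
  set s := ∑ i, D i * p i with hs
  set b : Fin 3 → K := fun i => D i - s * a i with hb
  have hbp : ∑ i, b i * p i = 0 := by
    simp only [hb, sub_mul, Finset.sum_sub_distrib, mul_assoc, ← Finset.mul_sum, ha]
    rw [← hs, mul_one, sub_self]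
  set lam : MvPolynomial (Fin 3) K := ∑ i, C (b i) * X i with hlam
  have hlam' : lam = ∑ i, C (D i) * (X i - C (p i) * x) := by
    simp only [hlam, hb, hs, hx, Fin.sum_univ_three, C_sub, C_mul, C_add]
    ring
  have htaylor : F - x ^ (n - 1) * lam ∈ pointIdeal p ^ 2 := by
    have h := taylor_mem_sq F p x (pointIdeal p) (X_sub_mem_pointIdeal ha)
    have h1 : aeval (fun i => C (p i) * x) F = 0 := by
      have := aeval_smul_point hFh p x
      rw [hFp] at this
      simpa [algebraMap_eq] using this
    have h2 : ∀ i, aeval (fun i => C (p i) * x) (pderiv i F) = C (D i) * x ^ (n - 1) := fun i =>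
      aeval_smul_point (hFh.pderiv (i := i)) p x
    rw [h1, zero_add] at h
    convert h using 2
    rw [hlam', Finset.mul_sum]
    exact Finset.sum_congr rfl fun i _ => by rw [h2]; ring
  have hb0 : b ≠ 0 := by
    intro h
    apply hF2
    have : lam = 0 := by simp [hlam, h]
    rwa [this, mul_zero, sub_zero] at htaylor
  obtain ⟨c, hc0, hcp, hspan⟩ := exists_basis_of_orthogonal hp hb0 hbp
  set l : MvPolynomial (Fin 3) K := ∑ i, C (c i) * X i with hl
  have hl0 : l ≠ 0 := by
    intro h
    apply hc0
    funext i
    have h1 : pderiv i l = C (c i) := by simp [hl, pderiv_X, Pi.single_apply]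
    rw [h, map_zero] at h1
    simpa using h1.symm
  have hIspan : pointIdeal p ≤ Ideal.span {lam, l} := by
    rw [pointIdeal_eq_span ha]
    refine Ideal.span_le.2 ?_
    rintro _ ⟨i, rfl⟩
    obtain ⟨s, t, hst⟩ := hspan (fun j => (if j = i then 1 else 0) - p i * a j) (by
      simp [sub_mul, Finset.sum_sub_distrib, mul_assoc, ← Finset.mul_sum, ha])
    refine Ideal.mem_span_pair.2 ⟨C s, C t, ?_⟩
    have h1 : (X i - C (p i) * ∑ j, C (a j) * X j : MvPolynomial (Fin 3) K) =
        ∑ j, C ((if j = i then 1 else 0) - p i * a j) * X j := by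
      simp [sub_mul, Finset.sum_sub_distrib, mul_assoc, ← Finset.mul_sum]
    change _ = (X i - C (p i) * ∑ j, C (a j) * X j : MvPolynomial (Fin 3) K)
    rw [h1, hlam, hl, Finset.mul_sum, Finset.mul_sum, ← Finset.sum_add_distrib]
    refine Finset.sum_congr rfl fun j _ => ?_
    rw [hst j, C_add, C_mul, C_mul]
    ring
  have hlmem : l ∈ pointIdeal p := sum_C_mul_X_mem_pointIdeal hcp
  obtain ⟨i, hi, j, hij⟩ : ∃ i ∈ pointIdeal p, ∃ j, F - x ^ (n - 1) * lam = i * lam + j * l := by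
    rw [pow_two] at htaylor
    have h := Ideal.mul_mono_right hIspan htaylor
    rw [Ideal.span_insert, Ideal.mul_sup] at h
    obtain ⟨y, hy, z, hz, hyz⟩ := Submodule.mem_sup.1 h
    obtain ⟨i, hi, rfl⟩ := Ideal.mem_mul_span_singleton.1 hy
    obtain ⟨j, -, rfl⟩ := Ideal.mem_mul_span_singleton.1 hz
    exact ⟨i, hi, j, hyz.symm⟩
  refine ⟨x ^ (n - 1) + i, l, ?_, sum_C_mul_X_isHomogeneous c, hl0, hlmem, fun A hA => ?_⟩
  · simp [hxp, eval_eq_zero_of_mem_pointIdeal hi]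
  · obtain ⟨α, β, rfl⟩ := Ideal.mem_span_pair.1 (hIspan hA)
    exact ⟨α, (x ^ (n - 1) + i) * β - α * j, by linear_combination -α * hij⟩

end SmoothPoint

section Descent

variable {K : Type*} [Field K]

theorem eq_zero_of_aeval_eq_zero [IsAlgClosed K] {n : ℕ} (hn : n ≠ 0)
    {f : Fin 3 → MvPolynomial (Fin 2) K} (hf : ∀ i, (f i).IsHomogeneous n)
    (h0 : ∀ w : Fin 2 → K, (∀ i, eval w (f i) = 0) → w = 0)
    {F : MvPolynomial (Fin 3) K} (hF : Irreducible F) (hFh : F.IsHomogeneous n)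
    (hFf : aeval f F = 0) {A : MvPolynomial (Fin 3) K} {d : ℕ} (hA : A.IsHomogeneous d)
    (hd : d < n) (hAf : aeval f A = 0) : A = 0 := by
  by_contra hA0
  obtain ⟨q, rfl⟩ := dvd_of_aeval_eq_zero hn hf h0 hF hFf hAf
  have h1 := hA.totalDegree hA0
  rw [totalDegree_mul_of_isDomain hF.ne_zero (right_ne_zero_of_mul hA0),
    hFh.totalDegree hF.ne_zero] at h1
  omega

theorem eq_zero_of_bcoeff_eq_zero {n : ℕ} {h : MvPolynomial (Fin 2) K} (hh : h.IsHomogeneous n)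
    (h0 : ∀ i, bcoeff n h i = 0) : h = 0 := by
  rw [isHomogeneous_eq_sum hh]
  simp [h0]

theorem exists_linearMap_isHomogeneous (d : ℕ) :
    ∃ Q : (Fin ((d + 2).choose 2) → K) →ₗ[K] MvPolynomial (Fin 3) K,
      (∀ b, (Q b).IsHomogeneous d) ∧ ∀ b, Q b = 0 → b = 0 := by
  classical
  let T := (Finset.univ : Finset (Fin 3)).finsuppAntidiag d
  have hT : T.card = (d + 2).choose 2 := by
    rw [Finset.card_finsuppAntidiag_nat_eq_choose, Finset.card_univ, Fintype.card_fin,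
      show 3 + d - 1 = d + 2 by omega, ← Nat.choose_symm (by omega), Nat.add_sub_cancel_left]
  let e : Fin ((d + 2).choose 2) ≃ T := (T.equivFinOfCardEq hT).symm
  let Q : (Fin ((d + 2).choose 2) → K) →ₗ[K] MvPolynomial (Fin 3) K :=
    ∑ k, (monomial (e k).1).comp (LinearMap.proj k)
  have hQ : ∀ b, Q b = ∑ k, monomial (e k).1 (b k) := fun b => by
    simp [Q, LinearMap.sum_apply]
  refine ⟨Q, fun b => ?_, fun b hb => ?_⟩
  · rw [hQ]
    refine IsHomogeneous.sum _ _ _ fun k _ => isHomogeneous_monomial _ ?_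
    rw [Finsupp.degree_eq_sum]
    exact (Finset.mem_finsuppAntidiag.1 (e k).2).1
  · funext k
    have h1 : coeff (e k).1 (Q b) = b k := by
      rw [hQ, coeff_sum, Finset.sum_eq_single k]
      · simp
      · intro u _ hu
        rw [coeff_monomial, if_neg fun h => hu (e.injective (Subtype.ext h))]
      · simp
    rw [← h1, hb, coeff_zero, Pi.zero_apply]

theorem exists_ne_zero_map_eq_zero {V : Type*} [AddCommGroup V] [Module K V] {N : ℕ}
    (φ : V →ₗ[K] MvPolynomial (Fin 2) K) (hφ : ∀ z, (φ z).IsHomogeneous N)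
    (hV : N + 1 < Module.finrank K V) : ∃ z ≠ 0, φ z = 0 := by
  have : FiniteDimensional K V := Module.finite_of_finrank_pos (by omega)
  let Ψ : V →ₗ[K] (Fin (N + 1) → K) :=
    (LinearMap.pi fun i => lcoeff K (Finsupp.single 0 (N - (i : ℕ)) + Finsupp.single 1 (i : ℕ))) ∘ₗ φ
  have hΨ : ∀ z i, Ψ z i = bcoeff N (φ z) i := fun z i => rfl
  obtain ⟨z, hz, hz0⟩ := (Submodule.ne_bot_iff _).1
    (LinearMap.ker_ne_bot_of_finrank_lt (f := Ψ) (by rwa [Module.finrank_fin_fun]))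
  refine ⟨z, hz0, eq_zero_of_bcoeff_eq_zero (hφ z) fun i => ?_⟩
  rw [← hΨ, LinearMap.mem_ker.1 hz, Pi.zero_apply]

/-- The curve `F = 0` has the same degree as `f`, so the parameter is a rational function of the
coordinates of the curve. -/
theorem exists_rational_inverse [IsAlgClosed K] {n : ℕ} (hn : 3 ≤ n)
    {f : Fin 3 → MvPolynomial (Fin 2) K} (hf : ∀ i, (f i).IsHomogeneous n)
    (h0 : ∀ w : Fin 2 → K, (∀ i, eval w (f i) = 0) → w = 0)
    {F : MvPolynomial (Fin 3) K} (hF : Irreducible F) (hFh : F.IsHomogeneous n)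
    (hFf : aeval f F = 0) :
    ∃ A B : MvPolynomial (Fin 3) K, X 0 * aeval f B = X 1 * aeval f A ∧ aeval f A ≠ 0 := by
  obtain ⟨Q, hQh, hQ0⟩ := exists_linearMap_isHomogeneous (K := K) (n - 1)
  have hinj : ∀ b, aeval f (Q b) = 0 → b = 0 := fun b hb =>
    hQ0 b (eq_zero_of_aeval_eq_zero (by omega) hf h0 hF hFh hFf (hQh b) (by omega) hb)
  let φ := (aeval f : MvPolynomial (Fin 3) K →ₐ[K] _).toLinearMap ∘ₗ Q
  let rel := (LinearMap.mulLeft K (X 0 : MvPolynomial (Fin 2) K) ∘ₗ φ).coprod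
    (-(LinearMap.mulLeft K (X 1 : MvPolynomial (Fin 2) K) ∘ₗ φ))
  have hrel : ∀ b c, rel (b, c) = X 0 * aeval f (Q b) - X 1 * aeval f (Q c) := fun b c => by
    rw [sub_eq_add_neg]
    rfl
  obtain ⟨⟨b, c⟩, hne, hbc⟩ := exists_ne_zero_map_eq_zero (N := 1 + n * (n - 1)) rel
    (fun ⟨b, c⟩ => by
      rw [hrel]
      exact ((isHomogeneous_X _ _).mul ((hQh _).aeval f hf)).sub
        ((isHomogeneous_X _ _).mul ((hQh _).aeval f hf))) (by
      rw [Module.finrank_prod, Module.finrank_fin_fun, ← two_mul,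
        show n - 1 + 2 = n + 1 by omega, Nat.choose_two_right, Nat.add_sub_cancel,
        mul_comm (n + 1), Nat.mul_div_cancel' (Nat.even_mul_succ_self n).two_dvd]
      obtain ⟨m, rfl⟩ := Nat.exists_eq_add_of_le' hn
      rw [show m + 3 - 1 = m + 2 by omega]
      nlinarith)
  rw [hrel, sub_eq_zero] at hbc
  refine ⟨Q c, Q b, hbc, fun h => hne ?_⟩
  rw [h, mul_zero] at hbc
  rw [hinj c h, hinj b ((mul_eq_zero.1 hbc).resolve_left (X_ne_zero 0))]
  rfl

theorem exists_notMem_pointIdeal {f : Fin 3 → MvPolynomial (Fin 2) K} {F U l : MvPolynomial (Fin 3) K}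
    (hFf : aeval f F = 0) {v : Fin 2 → K} (hv : v ≠ 0) (hU : ¬ linFormOf v ∣ aeval f U)
    (hlf : aeval f l ≠ 0) (hlv : linFormOf v ∣ aeval f l)
    {I : Ideal (MvPolynomial (Fin 3) K)} (hI : ∀ A ∈ I, ∃ α β, U * A = α * F + β * l)
    (k : ℕ) (A B : MvPolynomial (Fin 3) K) (hAB : X 0 * aeval f B = X 1 * aeval f A)
    (hk : ¬ linFormOf v ^ k ∣ aeval f A) :
    ∃ A B : MvPolynomial (Fin 3) K, X 0 * aeval f B = X 1 * aeval f A ∧ (A ∉ I ∨ B ∉ I) := by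
  induction k generalizing A B with
  | zero => simp at hk
  | succ k ih =>
    by_cases hmem : A ∉ I ∨ B ∉ I
    · exact ⟨A, B, hAB, hmem⟩
    push Not at hmem
    obtain ⟨α, β, hA⟩ := hI A hmem.1
    obtain ⟨γ, δ, hB⟩ := hI B hmem.2
    have hA' : aeval f U * aeval f A = aeval f β * aeval f l := by
      simpa only [map_mul, map_add, hFf, mul_zero, zero_add] using congrArg (aeval f) hA
    have hB' : aeval f U * aeval f B = aeval f δ * aeval f l := by
      simpa only [map_mul, map_add, hFf, mul_zero, zero_add] using congrArg (aeval f) hB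
    refine ih β δ (mul_right_cancel₀ hlf ?_) fun hdvd => hk ?_
    · linear_combination X 1 * hA' - X 0 * hB' + aeval f U * hAB
    · refine (prime_linFormOf hv).pow_dvd_of_dvd_mul_left _ hU ?_
      rw [hA', pow_succ]
      exact mul_dvd_mul hdvd hlv

theorem exists_homogeneousComponent_eval_ne_zero {p a : Fin 3 → K} (ha : ∑ i, a i * p i = 1)
    {A : MvPolynomial (Fin 3) K} (hA : A ∉ pointIdeal p) :
    ∃ d, eval p (homogeneousComponent d A) ≠ 0 := by
  by_contra! h
  apply hA
  rw [← sum_homogeneousComponent A]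
  refine Ideal.sum_mem _ fun d _ => ?_
  have := sub_eval_mul_pow_mem (homogeneousComponent_isHomogeneous d A) p _ _
    (X_sub_mem_pointIdeal ha)
  rwa [h d, C_0, zero_mul, sub_zero] at this

theorem mem_pointIdeal_sq [IsAlgClosed K] {n : ℕ} (hn : 3 ≤ n)
    {f g : Fin 3 → MvPolynomial (Fin 2) K} (hf : ∀ i, (f i).IsHomogeneous n)
    (h0 : ∀ w : Fin 2 → K, (∀ i, eval w (f i) = 0) → w = 0)
    {F : MvPolynomial (Fin 3) K} (hF : Irreducible F) (hFh : F.IsHomogeneous n)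
    (hFf : aeval f F = 0)
    {v : Fin 2 → K} (hv : v ≠ 0) {a : Fin 3 → K} {ξ : MvPolynomial (Fin 2) K}
    (hl : IsLocalForm n f v a ξ g) {w : Fin 2 → K} (hw : w ≠ 0) (hgw : ∀ i, eval w (g i) = 0) :
    F ∈ pointIdeal (evalVec f v) ^ 2 := by
  by_contra hF2
  have heval : ∀ A : MvPolynomial (Fin 3) K, eval v (aeval f A) = eval (evalVec f v) A := fun A => by
    have h1 : (aeval v : MvPolynomial (Fin 2) K →ₐ[K] K) (aeval f A) =
        aeval (evalVec f v) A := by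
      rw [comp_aeval_apply]
      rfl
    exact h1
  set p := evalVec f v with hp
  set x : MvPolynomial (Fin 3) K := ∑ j, C (a j) * X j with hx
  have hxf : aeval f x = ξ := by
    rw [hl.xi_eq, hx]
    simp [algebraMap_eq]
  obtain ⟨U, l, hU, hlh, hl0, hlI, hUI⟩ := exists_local_parameter hFh hl.sum_eq_one
    (by rw [← heval, hFf, map_zero]) hF2
  obtain ⟨A, B, hAB, hA0⟩ := exists_rational_inverse hn hf h0 hF hFh hFf
  obtain ⟨k, hk⟩ := FiniteMultiplicity.of_not_isUnit (prime_linFormOf hv).not_isUnit hA0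
  have hUf : ¬ linFormOf v ∣ aeval f U := by
    rintro ⟨q, hq⟩
    have := congrArg (eval v) hq
    rw [heval, hU, map_mul, eval_linFormOf_self, zero_mul] at this
    exact one_ne_zero this
  have hlf : aeval f l ≠ 0 := fun h =>
    hl0 (eq_zero_of_aeval_eq_zero (by omega) hf h0 hF hFh hFf hlh (by omega) h)
  have hlv : linFormOf v ∣ aeval f l := linFormOf_dvd hv (hlh.aeval f hf) (by
    rw [heval, eval_eq_zero_of_mem_pointIdeal hlI])
  obtain ⟨A, B, hAB, hnot⟩ := exists_notMem_pointIdeal hFf hv hUf hlf hlv hUI _ A B hAB hk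
  obtain ⟨d, hd⟩ : ∃ d, eval p (homogeneousComponent d A) ≠ 0 ∨
      eval p (homogeneousComponent d B) ≠ 0 := by
    rcases hnot with h | h
    · exact (exists_homogeneousComponent_eval_ne_zero hl.sum_eq_one h).imp fun _ => Or.inl
    · exact (exists_homogeneousComponent_eval_ne_zero hl.sum_eq_one h).imp fun _ => Or.inr
  have hn0 : n ≠ 0 := by omega
  have hABd : X 0 * aeval f (homogeneousComponent d B) =
      X 1 * aeval f (homogeneousComponent d A) := by
    have := congrArg (homogeneousComponent (1 + n * d)) hAB
    rwa [homogeneousComponent_mul_of_isHomogeneous (isHomogeneous_X _ _),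
      homogeneousComponent_mul_of_isHomogeneous (isHomogeneous_X _ _),
      homogeneousComponent_aeval hn0 hf, homogeneousComponent_aeval hn0 hf] at this
  have hdvd : ∀ D ∈ pointIdeal p, linFormOf v * linFormOf w ∣ aeval f D := by
    have hle : pointIdeal p ≤ (Ideal.span {linFormOf v * linFormOf w}).comap (aeval f) := by
      rw [pointIdeal_eq_span hl.sum_eq_one, Ideal.span_le]
      rintro _ ⟨i, rfl⟩
      rw [SetLike.mem_coe, Ideal.mem_comap, aeval_coordinate_sub hl, Ideal.mem_span_singleton]
      exact mul_dvd_mul_left _ (linFormOf_dvd hw (hl.homog i) (hgw i))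
    exact fun D hD => Ideal.mem_span_singleton.1 (hle hD)
  have hcomp : ∀ D : MvPolynomial (Fin 3) K, linFormOf v * linFormOf w ∣
      aeval f (homogeneousComponent d D) - C (eval p (homogeneousComponent d D)) * ξ ^ d := by
    intro D
    have := hdvd _ (sub_eval_mul_pow_mem (homogeneousComponent_isHomogeneous d D) p x _
      (X_sub_mem_pointIdeal hl.sum_eq_one))
    rwa [map_sub, map_mul, map_pow, hxf, aeval_C, algebraMap_eq] at this
  set u : Fin 2 → K :=
    ![eval p (homogeneousComponent d A), eval p (homogeneousComponent d B)] with hu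
  have hu0 : u ≠ 0 := by
    intro h
    rcases hd with hd | hd
    · exact hd (congrFun h 0)
    · exact hd (congrFun h 1)
  have hM : linFormOf v * linFormOf w ∣ linFormOf u * ξ ^ d := by
    have h := dvd_sub (dvd_mul_of_dvd_right (hcomp A) (X 1)) (dvd_mul_of_dvd_right (hcomp B) (X 0))
    convert h using 1
    rw [linFormOf, show u 1 = eval p (homogeneousComponent d B) from rfl,
      show u 0 = eval p (homogeneousComponent d A) from rfl]
    linear_combination hABd
  have huv : eval v (linFormOf u) = 0 := by
    obtain ⟨q, hq⟩ := hM
    have := congrArg (eval v) hq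
    simpa [hl.eval_xi, eval_linFormOf_self] using this
  obtain ⟨q, hq, huq⟩ := exists_linFormOf_mul_eq (d := 0) hv (linFormOf_isHomogeneous u) huv
  have hqu : q ≠ 0 := by
    rintro rfl
    exact linFormOf_ne_zero hu0 (by rw [huq, mul_zero])
  rw [huq, mul_assoc] at hM
  have hMw := (mul_dvd_mul_iff_left (linFormOf_ne_zero hv)).1 hM
  have hqc : ∃ c : K, q = C c := ⟨coeff 0 q, (totalDegree_eq_zero_iff_eq_C).1 (by
    simpa using hq.totalDegree_le)⟩
  obtain ⟨c, rfl⟩ := hqc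
  have hξw : eval w ξ = 0 := by
    obtain ⟨r, hr⟩ := hMw
    have := congrArg (eval w) hr
    rw [map_mul, map_mul, eval_C, eval_linFormOf_self, zero_mul, map_pow] at this
    refine eq_zero_of_pow_eq_zero ((mul_eq_zero.1 this).resolve_left ?_)
    rintro rfl
    exact hqu C_0
  refine hw (h0 w fun i => ?_)
  rw [hl.eq i, map_add, map_mul, map_mul, hξw, hgw, mul_zero, mul_zero, add_zero]

end Descent

/-- For every `v ∈ ℙ¹(K)`, the point `f(v)` is a singular point of `C` if and only if there
is a class `[G] ∈ X_2(K)` with `G(v) = 0`. -/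
theorem statement_18 {K : Type*} [Field K] [IsAlgClosed K] [CharZero K]
    (n : ℕ) (hn : 3 ≤ n) (f : Fin 3 → MvPolynomial (Fin 2) K)
    (hf : IsProperParam n f)
    (F : MvPolynomial (Fin 3) K) (hFirr : Irreducible F) (hFhom : F.IsHomogeneous n)
    (hFf : MvPolynomial.aeval f F = 0) :
    ∀ v : Fin 2 → K, v ≠ 0 →
      (2 ≤ multAt F (evalVec f v) ↔
        ∃ x ∈ XkSet n 2 f,
          MvPolynomial.eval v (formOf 2 (Projectivization.rep x)) = 0) := by
  intro v hv
  have h0 : ∀ w : Fin 2 → K, (∀ i, eval w (f i) = 0) → w = 0 := by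
    intro w hw
    by_contra hne
    exact hf.no_common_zero w hne (funext hw)
  obtain ⟨a, ξ, g, hl⟩ := exists_isLocalForm (by omega) hf.homog hv (hf.no_common_zero v hv)
  rw [two_le_multAt_iff hFirr.ne_zero]
  constructor
  · intro h2
    by_contra hno
    refine notMem_pointIdeal_sq hn hf.homog h0 hFirr hFf hv hl (fun w hgw => ?_) h2
    by_contra hw
    exact hno (exists_mem_XkSet_of_common_zero hn hv hl hw hgw)
  · rintro ⟨P, hP, hPv⟩
    obtain ⟨w, hw, hgw⟩ := exists_common_zero_of_mem_XkSet hn hv hl hP hPv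
    exact mem_pointIdeal_sq hn hf.homog h0 hFirr hFhom hFf hv hl hw hgw

end
end
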